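/- Let Ω be a bounded pseudoconvex domain in ℂ^n and z₀ ∈ ∂Ω. Suppose W ⊂⊂ U are small open neighborhoods of z₀. Then there exists a positive constant C₁ such that I¹_{U∩Ω}(p;X) ≤ I¹_Ω(p;X) ≤ C₁ · I¹_{U∩Ω}(p;X) for all p ∈ W ∩ Ω and all X ∈ ℂ^n. -/

import Mathlib

open MeasureTheory Complex Topology Filter Set

noncomputable section

/-! ### Wirtinger derivatives and complex Hessians on ℂⁿ -/

/-- The Wirtinger derivative `∂u/∂z_j` of a function `u : ℂⁿ → ℂ` at `z`. -/
def wder (n : ℕ) (j : Fin n) (u : (Fin n → ℂ) → ℂ) (z : Fin n → ℂ) : ℂ :=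
  (1 / 2) * (fderiv ℝ u z (Pi.single j 1) - Complex.I * fderiv ℝ u z (Pi.single j Complex.I))

/-- The conjugate Wirtinger derivative `∂u/∂z̄_j` of a function `u : ℂⁿ → ℂ` at `z`. -/
def wderBar (n : ℕ) (j : Fin n) (u : (Fin n → ℂ) → ℂ) (z : Fin n → ℂ) : ℂ :=
  (1 / 2) * (fderiv ℝ u z (Pi.single j 1) + Complex.I * fderiv ℝ u z (Pi.single j Complex.I))

/-- The complex Hessian `∂²φ/∂z_j∂z̄_k` of a real-valued function `φ` at `z`. -/
def cHess (n : ℕ) (φ : (Fin n → ℂ) → ℝ) (z : Fin n → ℂ) (j k : Fin n) : ℂ :=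
  wderBar n k (fun w => wder n j (fun v => (φ v : ℂ)) w) z

/-- The (real part of the) Hermitian form `Σ_{j,k} H_{jk} X_j conj (Y_k)`. -/
def hermForm (n : ℕ) (H : Fin n → Fin n → ℂ) (X Y : Fin n → ℂ) : ℝ :=
  (∑ j, ∑ k, H j k * X j * starRingEnd ℂ (Y k)).re

/-! ### The Bergman space, Bergman kernel, minimum integrals -/

/-- Membership in the Bergman space `A²(Ω)`: holomorphic and square-integrable on `Ω`. -/
def InBergman (n : ℕ) (Ω : Set (Fin n → ℂ)) (f : (Fin n → ℂ) → ℂ) : Prop :=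
  DifferentiableOn ℂ f Ω ∧ IntegrableOn (fun z => ‖f z‖ ^ 2) Ω

/-- The squared `L²(Ω)`-norm `∫_Ω |f|²`. -/
def l2sq (n : ℕ) (Ω : Set (Fin n → ℂ)) (f : (Fin n → ℂ) → ℂ) : ℝ :=
  ∫ z in Ω, ‖f z‖ ^ 2

/-- The holomorphic directional derivative `Σ_i X_i ∂f/∂z_i(p)`. -/
def holDeriv (n : ℕ) (f : (Fin n → ℂ) → ℂ) (p X : Fin n → ℂ) : ℂ :=
  ∑ i, X i * fderiv ℂ f p (Pi.single i 1)

/-- The second-order holomorphic derivative `Σ_{j,k} X_j Y_k ∂²f/∂z_j∂z_k(p)`. -/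
def holDeriv2 (n : ℕ) (f : (Fin n → ℂ) → ℂ) (p X Y : Fin n → ℂ) : ℂ :=
  ∑ j, ∑ k, X j * Y k * fderiv ℂ (fun z => fderiv ℂ f z (Pi.single k 1)) p (Pi.single j 1)

/-- Bergman's minimum integral `I⁰_Ω(p)`. -/
def I0 (n : ℕ) (Ω : Set (Fin n → ℂ)) (p : Fin n → ℂ) : ℝ :=
  sInf {r | ∃ f, InBergman n Ω f ∧ f p = 1 ∧ r = l2sq n Ω f}

/-- Bergman's minimum integral `I¹_Ω(p; X)`. -/
def I1 (n : ℕ) (Ω : Set (Fin n → ℂ)) (p X : Fin n → ℂ) : ℝ :=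
  sInf {r | ∃ f, InBergman n Ω f ∧ f p = 0 ∧ holDeriv n f p X = 1 ∧ r = l2sq n Ω f}

/-- Bergman's minimum integral `I²_Ω(p; X, Y)`. -/
def I2 (n : ℕ) (Ω : Set (Fin n → ℂ)) (p X Y : Fin n → ℂ) : ℝ :=
  sInf {r | ∃ f, InBergman n Ω f ∧ f p = 0 ∧ fderiv ℂ f p = 0 ∧
    holDeriv2 n f p X Y = 1 ∧ r = l2sq n Ω f}

/-- The Bergman kernel on the diagonal,
`K_Ω(p, p̄) = sup {|f(p)|² : f ∈ A²(Ω), ‖f‖_{L²(Ω)} ≤ 1}`. -/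
def bergmanKernel (n : ℕ) (Ω : Set (Fin n → ℂ)) (p : Fin n → ℂ) : ℝ :=
  sSup {r | ∃ f, InBergman n Ω f ∧ l2sq n Ω f ≤ 1 ∧ r = ‖f p‖ ^ 2}

/-- The components `g_{jk̄}(z) = ∂² log K_Ω(z,z̄)/∂z_j∂z̄_k` of the Bergman metric. -/
def bergMetricMat (n : ℕ) (Ω : Set (Fin n → ℂ)) (z : Fin n → ℂ) (j k : Fin n) : ℂ :=
  cHess n (fun w => Real.log (bergmanKernel n Ω w)) z j k

/-- The Bergman metric `g_Ω(z; X) = Σ_{j,k} g_{jk̄}(z) X_j X̄_k`. -/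
def bergMetric (n : ℕ) (Ω : Set (Fin n → ℂ)) (z X : Fin n → ℂ) : ℝ :=
  hermForm n (bergMetricMat n Ω z) X X

/-- The inverse matrix `(g^{νμ̄})` of the Bergman metric. -/
def bergMetricInv (n : ℕ) (Ω : Set (Fin n → ℂ)) (z : Fin n → ℂ) : Matrix (Fin n) (Fin n) ℂ :=
  (Matrix.of (bergMetricMat n Ω z))⁻¹

/-- The curvature tensor of the Bergman metric,
`R_{h̄jkl̄} = −∂²g_{jh̄}/∂z_k∂z̄_l + g^{νμ̄} (∂g_{jμ̄}/∂z_k)(∂g_{νh̄}/∂z̄_l)`. -/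
def bergCurvTensor (n : ℕ) (Ω : Set (Fin n → ℂ)) (z : Fin n → ℂ) (h j k l : Fin n) : ℂ :=
  - wderBar n l (fun w => wder n k (fun v => bergMetricMat n Ω v j h) w) z
  + ∑ ν, ∑ μ, bergMetricInv n Ω z ν μ *
      wder n k (fun v => bergMetricMat n Ω v j μ) z *
      wderBar n l (fun v => bergMetricMat n Ω v ν h) z

/-- The bisectional curvature of the Bergman metric,
`B_Ω(z;X,Y) = R_{h̄jkl̄} X̄_h X_j Y_k Ȳ_l / (g(z;X) g(z;Y))`. -/
def bisecCurv (n : ℕ) (Ω : Set (Fin n → ℂ)) (z X Y : Fin n → ℂ) : ℝ :=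
  (∑ h, ∑ j, ∑ k, ∑ l, bergCurvTensor n Ω z h j k l *
      starRingEnd ℂ (X h) * X j * Y k * starRingEnd ℂ (Y l)).re /
    (bergMetric n Ω z X * bergMetric n Ω z Y)

/-- The holomorphic sectional curvature `H_Ω(z;X) = B_Ω(z;X,X)`. -/
def holSecCurv (n : ℕ) (Ω : Set (Fin n → ℂ)) (z X : Fin n → ℂ) : ℝ := bisecCurv n Ω z X X

/-- The Ricci curvature `Ric_Ω(z;X) = Σ_j B_Ω(z;E^j,X)` (standard basis). -/
def ricciCurv (n : ℕ) (Ω : Set (Fin n → ℂ)) (z X : Fin n → ℂ) : ℝ :=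
  ∑ j, bisecCurv n Ω z (Pi.single j 1) X

/-! ### Plurisubharmonicity and pseudoconvexity -/

/-- `u` is plurisubharmonic on `Ω`: upper semicontinuous and satisfying the sub-mean value
inequality on circles in complex lines contained in `Ω`. -/
def PSHOn (n : ℕ) (u : (Fin n → ℂ) → ℝ) (Ω : Set (Fin n → ℂ)) : Prop :=
  UpperSemicontinuousOn u Ω ∧
  ∀ z ∈ Ω, ∀ w : Fin n → ℂ, ∀ r : ℝ, 0 < r →
    (∀ t : ℂ, ‖t‖ ≤ r → z + t • w ∈ Ω) →
    u z ≤ (1 / (2 * Real.pi)) *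
      ∫ θ in (0:ℝ)..(2 * Real.pi), u (z + ((r : ℂ) * Complex.exp ((θ : ℂ) * Complex.I)) • w)

/-- A `C²` function `φ` is plurisubharmonic on `Ω` iff its complex Hessian is
positive semidefinite at every point of `Ω`. -/
def PSHOnC2 (n : ℕ) (φ : (Fin n → ℂ) → ℝ) (Ω : Set (Fin n → ℂ)) : Prop :=
  ∀ z ∈ Ω, ∀ X : Fin n → ℂ, 0 ≤ hermForm n (cHess n φ z) X X

/-- `Ω` is pseudoconvex: it admits a continuous plurisubharmonic exhaustion function. -/
def PseudoconvexExh (n : ℕ) (Ω : Set (Fin n → ℂ)) : Prop :=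
  ∃ u : (Fin n → ℂ) → ℝ, ContinuousOn u Ω ∧ PSHOn n u Ω ∧
    ∀ c : ℝ, ∃ K : Set (Fin n → ℂ), IsCompact K ∧ K ⊆ Ω ∧ {z ∈ Ω | u z ≤ c} ⊆ K

/-! ### Smooth boundary, Levi form, Levi rank -/

/-- `ρ` is a (global) smooth defining function for the domain `Ω`. -/
def IsDefining (n : ℕ) (Ω : Set (Fin n → ℂ)) (ρ : (Fin n → ℂ) → ℝ) : Prop :=
  ContDiff ℝ (⊤ : ℕ∞) ρ ∧ (∀ z ∈ Ω, ρ z < 0) ∧ (∀ z ∈ frontier Ω, ρ z = 0) ∧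
    ∀ z ∈ frontier Ω, fderiv ℝ ρ z ≠ 0

/-- The coefficient `∂ρ/∂z_j(q)` of `∂ρ` (for a real-valued `ρ`). -/
def dzCoef (n : ℕ) (ρ : (Fin n → ℂ) → ℝ) (q : Fin n → ℂ) (j : Fin n) : ℂ :=
  wder n j (fun v => (ρ v : ℂ)) q

/-- The ℂ-linear map `X ↦ Σ_j ∂ρ/∂z_j(q) X_j`. -/
def cTangentMap (n : ℕ) (ρ : (Fin n → ℂ) → ℝ) (q : Fin n → ℂ) : (Fin n → ℂ) →ₗ[ℂ] ℂ :=
  ∑ j, dzCoef n ρ q j • (LinearMap.proj j : (Fin n → ℂ) →ₗ[ℂ] ℂ)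

/-- The complex tangent space `T^{1,0}_q(∂Ω) = {X : Σ_j ∂ρ/∂z_j(q) X_j = 0}`. -/
def cTangent (n : ℕ) (ρ : (Fin n → ℂ) → ℝ) (q : Fin n → ℂ) : Submodule ℂ (Fin n → ℂ) :=
  LinearMap.ker (cTangentMap n ρ q)

/-- The Levi form of `ρ` at `q` is positive semidefinite on the complex tangent space. -/
def LeviPSDAt (n : ℕ) (ρ : (Fin n → ℂ) → ℝ) (q : Fin n → ℂ) : Prop :=
  ∀ X ∈ cTangent n ρ q, 0 ≤ hermForm n (cHess n ρ q) X X

/-- The ℂ-linear map `X ↦ Σ_{j,k} ρ_{jk̄}(q) X_j conj (Y_k)` (Levi pairing against `Y`). -/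
def leviPairMap (n : ℕ) (ρ : (Fin n → ℂ) → ℝ) (q Y : Fin n → ℂ) : (Fin n → ℂ) →ₗ[ℂ] ℂ :=
  ∑ j, (∑ k, cHess n ρ q j k * starRingEnd ℂ (Y k)) • (LinearMap.proj j : (Fin n → ℂ) →ₗ[ℂ] ℂ)

/-- The kernel of the Levi form of `ρ` at `q`, as a Hermitian form on `T^{1,0}_q(∂Ω)`. -/
def leviKernel (n : ℕ) (ρ : (Fin n → ℂ) → ℝ) (q : Fin n → ℂ) : Submodule ℂ (Fin n → ℂ) :=
  cTangent n ρ q ⊓ ⨅ Y ∈ cTangent n ρ q, LinearMap.ker (leviPairMap n ρ q Y)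

/-- The Levi form of `ρ` at `q`, as a Hermitian form on `T^{1,0}_q(∂Ω)`, has rank `l`. -/
def LeviRankAt (n : ℕ) (ρ : (Fin n → ℂ) → ℝ) (q : Fin n → ℂ) (l : ℕ) : Prop :=
  Module.finrank ℂ ↥(cTangent n ρ q) - Module.finrank ℂ ↥(leviKernel n ρ q) = l

/-! ### Test functions, polydiscs, Euclidean norms, biholomorphisms -/

/-- A smooth test function compactly supported in `Ω`. -/
def IsTestFun (n : ℕ) (ψ : (Fin n → ℂ) → ℂ) (Ω : Set (Fin n → ℂ)) : Prop :=
  ContDiff ℝ (⊤ : ℕ∞) ψ ∧ HasCompactSupport ψ ∧ tsupport ψ ⊆ Ω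

/-- The polydisc `P(c, β) = {z : |z_j − c_j| < β_j for all j}`. -/
def polydisc (n : ℕ) (c : Fin n → ℂ) (β : Fin n → ℝ) : Set (Fin n → ℂ) :=
  {z | ∀ j, ‖z j - c j‖ < β j}

/-- The Euclidean norm of the components of `ζ` indexed by `s`. -/
def eucNormOn (n : ℕ) (s : Finset (Fin n)) (ζ : Fin n → ℂ) : ℝ :=
  Real.sqrt (∑ j ∈ s, ‖ζ j‖ ^ 2)

/-- The Euclidean ball of radius `r` centered at the origin in ℂⁿ. -/
def eball (n : ℕ) (r : ℝ) : Set (Fin n → ℂ) :=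
  {ζ | eucNormOn n Finset.univ ζ < r}

/-- `f` is a biholomorphism from `A` onto `B`. -/
def Biholo (n : ℕ) (f : (Fin n → ℂ) → (Fin n → ℂ)) (A B : Set (Fin n → ℂ)) : Prop :=
  DifferentiableOn ℂ f A ∧ Set.BijOn f A B ∧
    ∃ g, DifferentiableOn ℂ g B ∧ ∀ z ∈ A, g (f z) = z

/-- The determinant of the complex Jacobian of `f` at `p`. -/
def cJacDet (n : ℕ) (f : (Fin n → ℂ) → (Fin n → ℂ)) (p : Fin n → ℂ) : ℂ :=
  LinearMap.det ((fderiv ℂ f p).toLinearMap)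

/-! ### Mixed derivatives `D^α` in the variables `z_j`, `z̄_j` -/

/-- The multi-index `α : Fin n → ℕ` recording how many of the directions `ι i` hit slot `j`. -/
def multiIdxOf (n : ℕ) {m : ℕ} (ι : Fin m → Fin n) : Fin n → ℕ :=
  fun j => (Finset.univ.filter fun i => ι i = j).card

/-- All mixed derivatives `D^α φ` of total order `≤ mmax`, where in each slot `j` one may
differentiate in the real directions underlying `z_j` and `z̄_j` (i.e. `e_j` and `i·e_j`),
are bounded on `P` by `bound α`. -/
def MixedDerivBound (n : ℕ) (φ : (Fin n → ℂ) → ℝ) (P : Set (Fin n → ℂ))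
    (mmax : ℕ) (bound : (Fin n → ℕ) → ℝ) : Prop :=
  ∀ m : ℕ, m ≤ mmax → ∀ ι : Fin m → Fin n, ∀ ε : Fin m → ℂ,
    (∀ i, ε i = 1 ∨ ε i = Complex.I) → ∀ z ∈ P,
      ‖iteratedFDeriv ℝ m φ z (fun i => Pi.single (ι i) (ε i))‖ ≤ bound (multiIdxOf n ι)

/-- All mixed derivatives `D^α φ` (of any order) are bounded on `P` by `bound α`. -/
def MixedDerivBoundAll (n : ℕ) (φ : (Fin n → ℂ) → ℝ) (P : Set (Fin n → ℂ))
    (bound : (Fin n → ℕ) → ℝ) : Prop :=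
  ∀ m : ℕ, ∀ ι : Fin m → Fin n, ∀ ε : Fin m → ℂ,
    (∀ i, ε i = 1 ∨ ε i = Complex.I) → ∀ z ∈ P,
      ‖iteratedFDeriv ℝ m φ z (fun i => Pi.single (ι i) (ε i))‖ ≤ bound (multiIdxOf n ι)

/-! ### Fu's centering maps and normal forms (constant Levi rank `l`) -/

/-- Lean indices `1,…,l`, i.e. the coordinates `ζ_2,…,ζ_{l+1}` (the block `ζ'`). -/
def primIdx (n l : ℕ) : Finset (Fin n) := Finset.univ.filter fun j => 1 ≤ j.val ∧ j.val ≤ l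

/-- Lean indices `l+1,…,n−1`, i.e. the coordinates `ζ_{l+2},…,ζ_n` (the block `ζ''`). -/
def dprimIdx (n l : ℕ) : Finset (Fin n) := Finset.univ.filter fun j => l + 1 ≤ j.val

/-- Lean indices `1,…,n−l−1`, i.e. the coordinates `ζ_2,…,ζ_{n−l}`. -/
def midIdx (n l : ℕ) : Finset (Fin n) :=
  Finset.univ.filter fun j => 1 ≤ j.val ∧ j.val ≤ n - l - 1

/-- Lean indices `n−l,…,n−1`, i.e. the coordinates `ζ_{n−l+1},…,ζ_n`. -/
def tailIdx (n l : ℕ) : Finset (Fin n) := Finset.univ.filter fun j => n - l ≤ j.val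

/-- `ρ` is a smooth local defining function for the real hypersurface `S` near `0`
(on the Euclidean ball of radius `ε`). -/
def IsLocalDefining (n : ℕ) (S : Set (Fin n → ℂ)) (ρ : (Fin n → ℂ) → ℝ) (ε : ℝ) : Prop :=
  ContDiffOn ℝ (⊤ : ℕ∞) ρ (eball n ε) ∧
    S ∩ eball n ε = {ζ ∈ eball n ε | ρ ζ = 0} ∧
    ∀ ζ ∈ S ∩ eball n ε, fderiv ℝ ρ ζ ≠ 0

/-- `ρ(ζ) = Re ζ₁ + Σ_{j=2}^{l+1} λ_j |ζ_j|² + O(|ζ'|²·|ζ''| + |ζ'|³ + |Im ζ₁|·|ζ|)` near `0`. -/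
def NormalForm (n l : ℕ) [NeZero n] (lam : Fin n → ℝ) (ρ : (Fin n → ℂ) → ℝ) (ε : ℝ) : Prop :=
  ∃ C > (0:ℝ), ∀ ζ ∈ eball n ε,
    |ρ ζ - ((ζ 0).re + ∑ j ∈ primIdx n l, lam j * ‖ζ j‖ ^ 2)| ≤
      C * ((eucNormOn n (primIdx n l) ζ) ^ 2 * eucNormOn n (dprimIdx n l) ζ +
        (eucNormOn n (primIdx n l) ζ) ^ 3 + |(ζ 0).im| * eucNormOn n Finset.univ ζ)

/-- Fu's centering data near a boundary point: for each `q ∈ U ∩ ∂Ω`, `Φ q` is a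
biholomorphism of `U` onto the unit ball with `Φ q q = 0`, depending smoothly on `q`,
such that `Φ q (U ∩ ∂Ω)` has, near `0`, a defining function `ρloc q` in normal form with
positive coefficients `lam q j` (for `j` in the block `ζ'`) depending smoothly on `q`. -/
def CenteringData (n l : ℕ) [NeZero n] (Ω U : Set (Fin n → ℂ))
    (Φ : (Fin n → ℂ) → (Fin n → ℂ) → (Fin n → ℂ))
    (lam : (Fin n → ℂ) → Fin n → ℝ)
    (ρloc : (Fin n → ℂ) → (Fin n → ℂ) → ℝ) (ε : ℝ) : Prop :=
  ContDiffOn ℝ (⊤ : ℕ∞) (fun pq : (Fin n → ℂ) × (Fin n → ℂ) => Φ pq.1 pq.2)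
      ((U ∩ frontier Ω) ×ˢ U) ∧
  (∀ j : Fin n, ContDiffOn ℝ (⊤ : ℕ∞) (fun q => lam q j) (U ∩ frontier Ω)) ∧
  ∀ q ∈ U ∩ frontier Ω,
    Φ q q = 0 ∧ Biholo n (Φ q) U (eball n 1) ∧
    (∀ j ∈ primIdx n l, 0 < lam q j) ∧
    IsLocalDefining n (Φ q '' (U ∩ frontier Ω)) (ρloc q) ε ∧
    NormalForm n l (lam q) (ρloc q) ε

/-- Fu's polydisc-type region
`P_{δ,a} = {ζ : |ζ₁| < aδ, |ζ_j| < aδ^{1/2} (2 ≤ j ≤ n−l), |ζ_k| < a (n−l+1 ≤ k ≤ n)}`. -/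
def PdaSet (n l : ℕ) [NeZero n] (δ a : ℝ) : Set (Fin n → ℂ) :=
  {ζ | ‖ζ 0‖ < a * δ ∧ (∀ j ∈ midIdx n l, ‖ζ j‖ < a * Real.sqrt δ) ∧
    ∀ j ∈ tailIdx n l, ‖ζ j‖ < a}

/-! ### Finite type in the sense of D'Angelo -/

/-- `h` vanishes to order at least `k` at `0`. -/
def vanishGe (E : Type*) [Norm E] (h : ℂ → E) (k : ℕ) : Prop :=
  ∃ C > (0:ℝ), ∃ ε > (0:ℝ), ∀ t : ℂ, ‖t‖ < ε → ‖h t‖ ≤ C * ‖t‖ ^ k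

/-- The vanishing order of `h` at `0`, as an extended natural number. -/
def vOrder (E : Type*) [Norm E] (h : ℂ → E) : ℕ∞ :=
  sSup ((fun k : ℕ => (k : ℕ∞)) '' {k | vanishGe E h k})

/-- `z₀ ∈ ∂Ω` is a point of finite type in the sense of D'Angelo (w.r.t. the defining
function `ρ`): the order of contact of `∂Ω` with nonconstant holomorphic curves through
`z₀` is uniformly bounded. -/
def FiniteTypeAt (n : ℕ) (ρ : (Fin n → ℂ) → ℝ) (z₀ : Fin n → ℂ) : Prop :=
  ∃ T : ℕ, ∀ γ : ℂ → (Fin n → ℂ), AnalyticAt ℂ γ 0 → γ 0 = z₀ →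
    ¬ (∀ᶠ t in 𝓝 (0:ℂ), γ t = z₀) →
    vOrder ℝ (fun t => ρ (γ t)) ≤ (T : ℕ∞) * vOrder (Fin n → ℂ) (fun t => γ t - z₀)

end

section

open scoped ENNReal Convolution

/-! ### Calculus of Wirtinger derivatives -/

theorem wder_congr {n : ℕ} {j : Fin n} {f g : (Fin n → ℂ) → ℂ} {z : Fin n → ℂ}
    (h : f =ᶠ[𝓝 z] g) : wder n j f z = wder n j g z := by
  simp only [wder, h.fderiv_eq]

theorem wderBar_congr {n : ℕ} {j : Fin n} {f g : (Fin n → ℂ) → ℂ} {z : Fin n → ℂ}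
    (h : f =ᶠ[𝓝 z] g) : wderBar n j f z = wderBar n j g z := by
  simp only [wderBar, h.fderiv_eq]

theorem wder_add {n : ℕ} {j : Fin n} {f g : (Fin n → ℂ) → ℂ} {z : Fin n → ℂ}
    (hf : DifferentiableAt ℝ f z) (hg : DifferentiableAt ℝ g z) :
    wder n j (fun w => f w + g w) z = wder n j f z + wder n j g z := by
  simp only [wder, fderiv_fun_add hf hg, _root_.add_apply]; ring

theorem wderBar_add {n : ℕ} {j : Fin n} {f g : (Fin n → ℂ) → ℂ} {z : Fin n → ℂ}
    (hf : DifferentiableAt ℝ f z) (hg : DifferentiableAt ℝ g z) :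
    wderBar n j (fun w => f w + g w) z = wderBar n j f z + wderBar n j g z := by
  simp only [wderBar, fderiv_fun_add hf hg, _root_.add_apply]; ring

theorem wder_sub {n : ℕ} {j : Fin n} {f g : (Fin n → ℂ) → ℂ} {z : Fin n → ℂ}
    (hf : DifferentiableAt ℝ f z) (hg : DifferentiableAt ℝ g z) :
    wder n j (fun w => f w - g w) z = wder n j f z - wder n j g z := by
  simp only [wder, fderiv_fun_sub hf hg, _root_.sub_apply]; ring

theorem wderBar_sub {n : ℕ} {j : Fin n} {f g : (Fin n → ℂ) → ℂ} {z : Fin n → ℂ}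
    (hf : DifferentiableAt ℝ f z) (hg : DifferentiableAt ℝ g z) :
    wderBar n j (fun w => f w - g w) z = wderBar n j f z - wderBar n j g z := by
  simp only [wderBar, fderiv_fun_sub hf hg, _root_.sub_apply]; ring

theorem wder_mul {n : ℕ} {j : Fin n} {f g : (Fin n → ℂ) → ℂ} {z : Fin n → ℂ}
    (hf : DifferentiableAt ℝ f z) (hg : DifferentiableAt ℝ g z) :
    wder n j (fun w => f w * g w) z = f z * wder n j g z + wder n j f z * g z := by
  simp only [wder, fderiv_fun_mul hf hg, _root_.add_apply,
    _root_.smul_apply, smul_eq_mul]; ring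

theorem wderBar_mul {n : ℕ} {j : Fin n} {f g : (Fin n → ℂ) → ℂ} {z : Fin n → ℂ}
    (hf : DifferentiableAt ℝ f z) (hg : DifferentiableAt ℝ g z) :
    wderBar n j (fun w => f w * g w) z = f z * wderBar n j g z + wderBar n j f z * g z := by
  simp only [wderBar, fderiv_fun_mul hf hg, _root_.add_apply,
    _root_.smul_apply, smul_eq_mul]; ring

theorem wder_sum {n : ℕ} {j : Fin n} {ι : Type*} {s : Finset ι} {f : ι → (Fin n → ℂ) → ℂ}
    {z : Fin n → ℂ} (hf : ∀ i ∈ s, DifferentiableAt ℝ (f i) z) :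
    wder n j (fun w => ∑ i ∈ s, f i w) z = ∑ i ∈ s, wder n j (f i) z := by
  simp only [wder, fderiv_fun_sum hf, _root_.sum_apply, Finset.mul_sum,
    ← Finset.sum_sub_distrib]

theorem fderiv_conj_apply {n : ℕ} (f : (Fin n → ℂ) → ℂ) (z v : Fin n → ℂ) :
    fderiv ℝ (fun w => starRingEnd ℂ (f w)) z v = starRingEnd ℂ (fderiv ℝ f z v) := by
  have h : (fun w => starRingEnd ℂ (f w)) = conjCLE ∘ f := by ext; simp
  rw [h, ContinuousLinearEquiv.comp_fderiv]; simp

theorem wder_conj {n : ℕ} (j : Fin n) (f : (Fin n → ℂ) → ℂ) (z : Fin n → ℂ) :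
    wder n j (fun w => starRingEnd ℂ (f w)) z = starRingEnd ℂ (wderBar n j f z) := by
  simp [wder, wderBar, fderiv_conj_apply, sub_eq_add_neg, map_ofNat]

theorem wderBar_conj {n : ℕ} (j : Fin n) (f : (Fin n → ℂ) → ℂ) (z : Fin n → ℂ) :
    wderBar n j (fun w => starRingEnd ℂ (f w)) z = starRingEnd ℂ (wder n j f z) := by
  simp [wder, wderBar, fderiv_conj_apply, sub_eq_add_neg, map_ofNat]

theorem wderBar_ofReal {n : ℕ} (j : Fin n) (f : (Fin n → ℂ) → ℝ) (z : Fin n → ℂ) :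
    wderBar n j (fun w => (f w : ℂ)) z = starRingEnd ℂ (wder n j (fun w => (f w : ℂ)) z) := by
  simp [← wderBar_conj]

theorem ContDiff.wder {n : ℕ} {j : Fin n} {f : (Fin n → ℂ) → ℂ} (hf : ContDiff ℝ (⊤ : ℕ∞) f) :
    ContDiff ℝ (⊤ : ℕ∞) (wder n j f) := by
  have h : ContDiff ℝ (⊤ : ℕ∞) (fderiv ℝ f) := hf.fderiv_right (by simp)
  unfold _root_.wder
  fun_prop

theorem ContDiff.wderBar {n : ℕ} {j : Fin n} {f : (Fin n → ℂ) → ℂ}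
    (hf : ContDiff ℝ (⊤ : ℕ∞) f) : ContDiff ℝ (⊤ : ℕ∞) (wderBar n j f) := by
  have h : ContDiff ℝ (⊤ : ℕ∞) (fderiv ℝ f) := hf.fderiv_right (by simp)
  unfold _root_.wderBar
  fun_prop

theorem ContDiff.continuous_wder {n : ℕ} {j : Fin n} {f : (Fin n → ℂ) → ℂ}
    (hf : ContDiff ℝ 1 f) : Continuous (_root_.wder n j f) := by
  have h : Continuous (fderiv ℝ f) := hf.continuous_fderiv (by simp)
  unfold _root_.wder
  fun_prop

theorem ContDiff.continuous_wderBar {n : ℕ} {j : Fin n} {f : (Fin n → ℂ) → ℂ}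
    (hf : ContDiff ℝ 1 f) : Continuous (_root_.wderBar n j f) := by
  have h : Continuous (fderiv ℝ f) := hf.continuous_fderiv (by simp)
  unfold _root_.wderBar
  fun_prop

theorem wder_eq_zero_of_notMem_tsupport {n : ℕ} {j : Fin n} {f : (Fin n → ℂ) → ℂ}
    {z : Fin n → ℂ} (hz : z ∉ tsupport f) : wder n j f z = 0 := by
  simp [wder, image_eq_zero_of_notMem_tsupport fun h => hz (tsupport_fderiv_subset ℝ h)]

theorem wderBar_eq_zero_of_notMem_tsupport {n : ℕ} {j : Fin n} {f : (Fin n → ℂ) → ℂ}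
    {z : Fin n → ℂ} (hz : z ∉ tsupport f) : wderBar n j f z = 0 := by
  simp [wderBar, image_eq_zero_of_notMem_tsupport fun h => hz (tsupport_fderiv_subset ℝ h)]

theorem tsupport_wder_subset {n : ℕ} (j : Fin n) (f : (Fin n → ℂ) → ℂ) :
    tsupport (wder n j f) ⊆ tsupport f :=
  closure_minimal (fun z hz => by
    by_contra h; exact hz (wder_eq_zero_of_notMem_tsupport h)) isClosed_closure

theorem tsupport_wderBar_subset {n : ℕ} (j : Fin n) (f : (Fin n → ℂ) → ℂ) :
    tsupport (wderBar n j f) ⊆ tsupport f :=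
  closure_minimal (fun z hz => by
    by_contra h; exact hz (wderBar_eq_zero_of_notMem_tsupport h)) isClosed_closure

theorem HasCompactSupport.wder {n : ℕ} {j : Fin n} {f : (Fin n → ℂ) → ℂ}
    (hf : HasCompactSupport f) : HasCompactSupport (_root_.wder n j f) :=
  hf.of_isClosed_subset isClosed_closure (tsupport_wder_subset j f)

theorem HasCompactSupport.wderBar {n : ℕ} {j : Fin n} {f : (Fin n → ℂ) → ℂ}
    (hf : HasCompactSupport f) : HasCompactSupport (_root_.wderBar n j f) :=
  hf.of_isClosed_subset isClosed_closure (tsupport_wderBar_subset j f)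

theorem fderiv_wder_apply {n : ℕ} {j : Fin n} {f : (Fin n → ℂ) → ℂ} {z : Fin n → ℂ}
    (hf : ContDiffAt ℝ 2 f z) (v : Fin n → ℂ) :
    fderiv ℝ (wder n j f) z v = (1 / 2) * (fderiv ℝ (fderiv ℝ f) z v (Pi.single j 1)
      - Complex.I * fderiv ℝ (fderiv ℝ f) z v (Pi.single j Complex.I)) := by
  have hd : DifferentiableAt ℝ (fderiv ℝ f) z :=
    (hf.fderiv_right (m := 1) (by norm_num)).differentiableAt (by norm_num)
  have h : HasFDerivAt (wder n j f) ((1 / 2 : ℂ) •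
      ((fderiv ℝ (fderiv ℝ f) z).flip (Pi.single j 1)
        - Complex.I • (fderiv ℝ (fderiv ℝ f) z).flip (Pi.single j Complex.I))) z := by
    have h1 : ∀ u : Fin n → ℂ, HasFDerivAt (fun x => fderiv ℝ f x u)
        ((fderiv ℝ (fderiv ℝ f) z).flip u) z := fun u => by
      simpa using hd.hasFDerivAt.clm_apply (hasFDerivAt_const u z)
    exact ((h1 _).fun_sub ((h1 _).const_mul _)).const_mul _
  rw [h.fderiv]; simp

theorem fderiv_wderBar_apply {n : ℕ} {j : Fin n} {f : (Fin n → ℂ) → ℂ} {z : Fin n → ℂ}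
    (hf : ContDiffAt ℝ 2 f z) (v : Fin n → ℂ) :
    fderiv ℝ (wderBar n j f) z v = (1 / 2) * (fderiv ℝ (fderiv ℝ f) z v (Pi.single j 1)
      + Complex.I * fderiv ℝ (fderiv ℝ f) z v (Pi.single j Complex.I)) := by
  have hd : DifferentiableAt ℝ (fderiv ℝ f) z :=
    (hf.fderiv_right (m := 1) (by norm_num)).differentiableAt (by norm_num)
  have h : HasFDerivAt (wderBar n j f) ((1 / 2 : ℂ) •
      ((fderiv ℝ (fderiv ℝ f) z).flip (Pi.single j 1)
        + Complex.I • (fderiv ℝ (fderiv ℝ f) z).flip (Pi.single j Complex.I))) z := by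
    have h1 : ∀ u : Fin n → ℂ, HasFDerivAt (fun x => fderiv ℝ f x u)
        ((fderiv ℝ (fderiv ℝ f) z).flip u) z := fun u => by
      simpa using hd.hasFDerivAt.clm_apply (hasFDerivAt_const u z)
    exact ((h1 _).fun_add ((h1 _).const_mul _)).const_mul _
  rw [h.fderiv]; simp; ring

theorem wderBar_wder_comm {n : ℕ} {j k : Fin n} {f : (Fin n → ℂ) → ℂ} {z : Fin n → ℂ}
    (hf : ContDiffAt ℝ 2 f z) :
    wderBar n k (wder n j f) z = wder n j (wderBar n k f) z := by
  have hs : IsSymmSndFDerivAt ℝ f z := hf.isSymmSndFDerivAt (by simp)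
  rw [wderBar, wder, fderiv_wder_apply hf, fderiv_wder_apply hf, fderiv_wderBar_apply hf,
    fderiv_wderBar_apply hf, hs (Pi.single k 1) (Pi.single j 1),
    hs (Pi.single k 1) (Pi.single j I), hs (Pi.single k I) (Pi.single j 1),
    hs (Pi.single k I) (Pi.single j I)]
  ring

theorem wderBar_wderBar_comm {n : ℕ} {j k : Fin n} {f : (Fin n → ℂ) → ℂ} {z : Fin n → ℂ}
    (hf : ContDiffAt ℝ 2 f z) :
    wderBar n k (wderBar n j f) z = wderBar n j (wderBar n k f) z := by
  have hs : IsSymmSndFDerivAt ℝ f z := hf.isSymmSndFDerivAt (by simp)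
  rw [wderBar, wderBar, fderiv_wderBar_apply hf, fderiv_wderBar_apply hf, fderiv_wderBar_apply hf,
    fderiv_wderBar_apply hf, hs (Pi.single k 1) (Pi.single j 1),
    hs (Pi.single k 1) (Pi.single j I), hs (Pi.single k I) (Pi.single j 1),
    hs (Pi.single k I) (Pi.single j I)]
  ring

/-! ### Integration by parts -/

theorem integral_fderiv_apply_eq_zero {n : ℕ} {g : (Fin n → ℂ) → ℂ} (hg : ContDiff ℝ 1 g)
    (hc : HasCompactSupport g) (v : Fin n → ℂ) : ∫ z, fderiv ℝ g z v = 0 := by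
  have hi : Integrable (fun z => fderiv ℝ g z v) :=
    ((hg.continuous_fderiv (by simp)).clm_apply continuous_const).integrable_of_hasCompactSupport
      (hc.fderiv_apply ℝ v)
  have := integral_mul_fderiv_eq_neg_fderiv_mul_of_integrable (μ := (volume : Measure (Fin n → ℂ)))
    (f := fun _ => (1 : ℂ)) (g := g) (v := v) (by simp) (by simpa using hi)
    (by simpa using hg.continuous.integrable_of_hasCompactSupport hc)
    (fun x _ => by fun_prop) (fun x _ => hg.differentiable (by simp) x)
  simpa using this

theorem integral_wder_eq_zero {n : ℕ} {g : (Fin n → ℂ) → ℂ} (hg : ContDiff ℝ 1 g)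
    (hc : HasCompactSupport g) (j : Fin n) : ∫ z, wder n j g z = 0 := by
  have hi : ∀ v, Integrable (fun z => fderiv ℝ g z v) := fun v =>
    ((hg.continuous_fderiv (by simp)).clm_apply continuous_const).integrable_of_hasCompactSupport
      (hc.fderiv_apply ℝ v)
  simp only [wder]
  rw [integral_const_mul, integral_sub (hi _) ((hi _).const_mul _), integral_const_mul,
    integral_fderiv_apply_eq_zero hg hc, integral_fderiv_apply_eq_zero hg hc]
  simp

theorem ContDiff.mul_of_contDiffAt_tsupport {n : ℕ} {k : WithTop ℕ∞} {f g : (Fin n → ℂ) → ℂ}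
    (hg : ContDiff ℝ k g) (hf : ∀ x ∈ tsupport g, ContDiffAt ℝ k f x) :
    ContDiff ℝ k (fun z => f z * g z) := by
  rw [contDiff_iff_contDiffAt]
  intro x
  by_cases hx : x ∈ tsupport g
  · exact (hf x hx).mul hg.contDiffAt
  · have h0 : g =ᶠ[𝓝 x] 0 := notMem_tsupport_iff_eventuallyEq.1 hx
    have : (fun z => f z * g z) =ᶠ[𝓝 x] fun _ => 0 := by
      filter_upwards [h0] with y hy; simp [hy]
    exact contDiffAt_const.congr_of_eventuallyEq this

theorem integral_mul_wder {n : ℕ} {f g : (Fin n → ℂ) → ℂ} (hg : ContDiff ℝ 1 g)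
    (hc : HasCompactSupport g) (hf : ∀ x ∈ tsupport g, ContDiffAt ℝ 1 f x) (j : Fin n) :
    ∫ z, f z * wder n j g z = - ∫ z, wder n j f z * g z := by
  have h1 : ContDiff ℝ 1 (fun z => f z * g z) := hg.mul_of_contDiffAt_tsupport hf
  have hcc : HasCompactSupport (fun z => f z * g z) := hc.mul_left
  have h0 := integral_wder_eq_zero h1 hcc j
  have hpt : ∀ z, wder n j (fun z => f z * g z) z = f z * wder n j g z + wder n j f z * g z := by
    intro z
    by_cases hz : z ∈ tsupport g
    · exact wder_mul ((hf z hz).differentiableAt (by simp)) (hg.differentiable (by simp) z)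
    · rw [wder_eq_zero_of_notMem_tsupport hz, image_eq_zero_of_notMem_tsupport hz,
        wder_eq_zero_of_notMem_tsupport fun h => hz (tsupport_mul_subset_right h)]
      simp
  have hi : Integrable (fun z => f z * wder n j g z) := by
    refine Continuous.integrable_of_hasCompactSupport ?_ hc.wder.mul_left
    refine continuous_iff_continuousAt.2 fun x => ?_
    by_cases hx : x ∈ tsupport g
    · exact (hf x hx).continuousAt.mul hg.continuous_wder.continuousAt
    · have : (fun z => f z * wder n j g z) =ᶠ[𝓝 x] fun _ => 0 := by
        filter_upwards [(isClosed_closure (s := Function.support g)).isOpen_compl.mem_nhds hx]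
          with y hy
        simp [wder_eq_zero_of_notMem_tsupport (j := j) hy]
      exact continuousAt_const.congr this.symm
  have hi2 : Integrable (fun z => wder n j f z * g z) := by
    have : (fun z => wder n j f z * g z)
        = fun z => wder n j (fun z => f z * g z) z - f z * wder n j g z := by
      ext z; rw [hpt]; ring
    rw [this]
    exact (h1.continuous_wder.integrable_of_hasCompactSupport hcc.wder).sub hi
  simp only [hpt] at h0
  rw [integral_add hi hi2] at h0
  exact eq_neg_of_add_eq_zero_left h0

theorem integral_mul_wderBar {n : ℕ} {f g : (Fin n → ℂ) → ℂ} (hg : ContDiff ℝ 1 g)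
    (hc : HasCompactSupport g) (hf : ∀ x ∈ tsupport g, ContDiffAt ℝ 1 f x) (j : Fin n) :
    ∫ z, f z * wderBar n j g z = - ∫ z, wderBar n j f z * g z := by
  have h := integral_mul_wder (f := fun z => starRingEnd ℂ (f z))
    (g := fun z => starRingEnd ℂ (g z)) (conjCLE.contDiff.comp hg)
    (hc.comp_left (map_zero _)) (fun x hx => ?_) j
  · simp only [wder_conj, ← map_mul, integral_conj, ← map_neg] at h
    exact (starRingEnd ℂ).injective h
  · refine conjCLE.contDiff.contDiffAt.comp x (hf x (closure_mono ?_ hx))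
    intro y hy h0
    exact hy (by simp [h0])

/-! ### The weighted Bochner inequality -/

/-- The twisted derivative `∂f/∂z_j - (∂Φ/∂z_j) f`, minus the formal adjoint of `∂/∂z̄_j` in
`L²(e^{-Φ})`. -/
noncomputable def twDer (n : ℕ) (Φ : (Fin n → ℂ) → ℝ) (j : Fin n) (f : (Fin n → ℂ) → ℂ)
    (z : Fin n → ℂ) : ℂ :=
  wder n j f z - wder n j (fun w => (Φ w : ℂ)) z * f z

theorem ContDiff.ofReal_comp {n : ℕ} {k : WithTop ℕ∞} {Φ : (Fin n → ℂ) → ℝ}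
    (hΦ : ContDiff ℝ k Φ) : ContDiff ℝ k (fun w => (Φ w : ℂ)) :=
  ofRealCLM.contDiff.comp hΦ

theorem ContDiff.conj_comp {n : ℕ} {k : WithTop ℕ∞} {f : (Fin n → ℂ) → ℂ}
    (hf : ContDiff ℝ k f) : ContDiff ℝ k (fun w => starRingEnd ℂ (f w)) :=
  conjCLE.contDiff.comp hf

theorem ContDiff.twDer {n : ℕ} {Φ : (Fin n → ℂ) → ℝ} {j : Fin n} {f : (Fin n → ℂ) → ℂ}
    (hΦ : ContDiff ℝ (⊤ : ℕ∞) Φ) (hf : ContDiff ℝ (⊤ : ℕ∞) f) :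
    ContDiff ℝ (⊤ : ℕ∞) (twDer n Φ j f) := by
  have h1 := hf.wder (j := j)
  have h2 := hΦ.ofReal_comp.wder (j := j)
  unfold _root_.twDer
  fun_prop

theorem twDer_eq_zero_of_notMem_tsupport {n : ℕ} {Φ : (Fin n → ℂ) → ℝ} {j : Fin n}
    {f : (Fin n → ℂ) → ℂ} {z : Fin n → ℂ} (hz : z ∉ tsupport f) : twDer n Φ j f z = 0 := by
  simp [twDer, wder_eq_zero_of_notMem_tsupport hz, image_eq_zero_of_notMem_tsupport hz]

theorem HasCompactSupport.twDer {n : ℕ} {Φ : (Fin n → ℂ) → ℝ} {j : Fin n} {f : (Fin n → ℂ) → ℂ}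
    (hf : HasCompactSupport f) : HasCompactSupport (twDer n Φ j f) :=
  hf.mono' fun z hz => by
    by_contra h; exact hz (twDer_eq_zero_of_notMem_tsupport h)

theorem wder_real_exp {n : ℕ} {j : Fin n} {Φ : (Fin n → ℂ) → ℝ} {z : Fin n → ℂ}
    (hΦ : DifferentiableAt ℝ Φ z) :
    wder n j (fun w => ((Real.exp (Φ w) : ℝ) : ℂ)) z
      = (Real.exp (Φ z) : ℝ) * wder n j (fun w => (Φ w : ℂ)) z := by
  have h1 : HasFDerivAt (fun w => (Φ w : ℂ)) (ofRealCLM.comp (fderiv ℝ Φ z)) z :=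
    ofRealCLM.hasFDerivAt.comp z hΦ.hasFDerivAt
  have h2 : HasFDerivAt (fun w => ((Real.exp (Φ w) : ℝ) : ℂ))
      (ofRealCLM.comp (Real.exp (Φ z) • fderiv ℝ Φ z)) z :=
    ofRealCLM.hasFDerivAt.comp z hΦ.hasFDerivAt.exp
  simp only [wder, h1.fderiv, h2.fderiv]
  simp
  ring

theorem integral_twDer_mul_conj {n : ℕ} {Φ : (Fin n → ℂ) → ℝ} {f g : (Fin n → ℂ) → ℂ}
    (hΦ : ContDiff ℝ (⊤ : ℕ∞) Φ) (hf : ContDiff ℝ (⊤ : ℕ∞) f) (hg : ContDiff ℝ (⊤ : ℕ∞) g)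
    (hc : HasCompactSupport g) (j : Fin n) :
    ∫ z, twDer n Φ j f z * starRingEnd ℂ (g z) * (Real.exp (-Φ z) : ℝ)
      = - ∫ z, f z * starRingEnd ℂ (wderBar n j g z) * (Real.exp (-Φ z) : ℝ) := by
  have hE : ContDiff ℝ (⊤ : ℕ∞) (fun z => ((Real.exp (-Φ z) : ℝ) : ℂ)) :=
    ContDiff.ofReal_comp (by fun_prop)
  have hcg := hg.conj_comp
  have hG : ContDiff ℝ (⊤ : ℕ∞) (fun z => starRingEnd ℂ (g z) * (Real.exp (-Φ z) : ℝ)) :=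
    hcg.mul hE
  have hcG : HasCompactSupport (fun z => starRingEnd ℂ (g z) * ((Real.exp (-Φ z) : ℝ) : ℂ)) :=
    (hc.comp_left (g := starRingEnd ℂ) (map_zero _)).mul_right
  have key := integral_mul_wder (f := f) (hG.of_le (by simp)) hcG
    (fun x _ => (hf.of_le (by simp)).contDiffAt) j
  have hpt : ∀ z, wder n j (fun z => starRingEnd ℂ (g z) * (Real.exp (-Φ z) : ℝ)) z
      = starRingEnd ℂ (wderBar n j g z) * (Real.exp (-Φ z) : ℝ)
        - starRingEnd ℂ (g z) * (Real.exp (-Φ z) : ℝ) * wder n j (fun w => (Φ w : ℂ)) z := by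
    intro z
    have hΦd : DifferentiableAt ℝ Φ z := hΦ.differentiable (by simp) z
    rw [wder_mul (hcg.differentiable (by simp) z) (hE.differentiable (by simp) z), wder_conj,
      wder_real_exp (Φ := fun z => -Φ z) hΦd.fun_neg]
    have : wder n j (fun w => ((-Φ w : ℝ) : ℂ)) z = - wder n j (fun w => (Φ w : ℂ)) z := by
      have h0 : (fun w => ((-Φ w : ℝ) : ℂ)) = fun w => 0 - (Φ w : ℂ) := by ext; simp
      rw [h0, wder_sub (by fun_prop) (hΦ.ofReal_comp.differentiable (by simp) z)]
      simp [wder]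
    rw [this]; ring
  simp only [hpt] at key
  have i1 : Integrable fun z => f z * (starRingEnd ℂ (wderBar n j g z) * (Real.exp (-Φ z) : ℝ)) :=
    (hf.continuous.mul (hg.wderBar.conj_comp.continuous.mul hE.continuous)
      ).integrable_of_hasCompactSupport
      ((hc.wderBar.comp_left (g := starRingEnd ℂ) (map_zero _)).mul_right.mul_left)
  have i2 : Integrable fun z => f z * (starRingEnd ℂ (g z) * (Real.exp (-Φ z) : ℝ)
      * wder n j (fun w => (Φ w : ℂ)) z) :=
    (hf.continuous.mul (hG.continuous.mul hΦ.ofReal_comp.wder.continuous)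
      ).integrable_of_hasCompactSupport (hcG.mul_right.mul_left)
  have i3 : Integrable fun z => wder n j f z * (starRingEnd ℂ (g z) * (Real.exp (-Φ z) : ℝ)) :=
    (hf.wder.continuous.mul hG.continuous).integrable_of_hasCompactSupport hcG.mul_left
  simp only [mul_sub] at key
  rw [integral_sub i1 i2] at key
  have e1 : ∫ z, twDer n Φ j f z * starRingEnd ℂ (g z) * (Real.exp (-Φ z) : ℝ)
      = (∫ z, wder n j f z * (starRingEnd ℂ (g z) * (Real.exp (-Φ z) : ℝ)))
        - ∫ z, f z * (starRingEnd ℂ (g z) * (Real.exp (-Φ z) : ℝ)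
      * wder n j (fun w => (Φ w : ℂ)) z) := by
    rw [← integral_sub i3 i2]
    congr 1; ext z; simp only [twDer]; ring
  rw [e1]
  simp only [mul_assoc] at key ⊢
  linear_combination key

theorem integral_twDer_mul_conj_twDer {n : ℕ} {Φ : (Fin n → ℂ) → ℝ} {f g : (Fin n → ℂ) → ℂ}
    (hΦ : ContDiff ℝ (⊤ : ℕ∞) Φ) (hf : ContDiff ℝ (⊤ : ℕ∞) f) (hg : ContDiff ℝ (⊤ : ℕ∞) g)
    (hcf : HasCompactSupport f) (hcg : HasCompactSupport g) (j k : Fin n) :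
    ∫ z, twDer n Φ j f z * starRingEnd ℂ (twDer n Φ k g z) * (Real.exp (-Φ z) : ℝ)
      = (∫ z, wderBar n k f z * starRingEnd ℂ (wderBar n j g z) * (Real.exp (-Φ z) : ℝ))
        + ∫ z, cHess n Φ z j k * f z * starRingEnd ℂ (g z) * (Real.exp (-Φ z) : ℝ) := by
  have hE : Continuous (fun z => ((Real.exp (-Φ z) : ℝ) : ℂ)) := by fun_prop
  have h1 := integral_twDer_mul_conj hΦ hg (hΦ.twDer (j := j) hf) hcf.twDer k
  have h2 := integral_twDer_mul_conj hΦ (hf.wderBar (j := k)) hg hcg j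
  have hcomm : ∀ z, wderBar n k (twDer n Φ j f) z
      = twDer n Φ j (wderBar n k f) z - cHess n Φ z j k * f z := by
    intro z
    have a1 : DifferentiableAt ℝ (wder n j f) z := hf.wder.differentiable (by simp) z
    have a2 : DifferentiableAt ℝ (wder n j (fun w => (Φ w : ℂ))) z :=
      hΦ.ofReal_comp.wder.differentiable (by simp) z
    have a3 : DifferentiableAt ℝ f z := hf.differentiable (by simp) z
    have e : twDer n Φ j f = fun w => wder n j f w - wder n j (fun w => (Φ w : ℂ)) w * f w := rfl
    rw [e, wderBar_sub a1 (a2.fun_mul a3), wderBar_mul a2 a3,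
      wderBar_wder_comm (hf.contDiffAt.of_le (WithTop.coe_le_coe.2 (le_top : ((2 : ℕ) : ℕ∞) ≤ ⊤))), twDer, cHess]
    ring
  have h1' : ∫ z, twDer n Φ j f z * starRingEnd ℂ (twDer n Φ k g z) * (Real.exp (-Φ z) : ℝ)
      = - ∫ z, wderBar n k (twDer n Φ j f) z * starRingEnd ℂ (g z) * (Real.exp (-Φ z) : ℝ) := by
    have := congrArg (starRingEnd ℂ) h1
    rw [map_neg, ← integral_conj, ← integral_conj] at this
    simp only [map_mul, conj_conj, conj_ofReal] at this
    calc _ = _ := by congr 1; ext z; ring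
      _ = _ := this
      _ = _ := by congr 2; ext z; ring
  rw [h1']
  simp only [hcomm, sub_mul]
  rw [integral_sub, h2]
  · ring
  · exact (((hΦ.twDer hf.wderBar).continuous.mul hg.conj_comp.continuous).mul hE
      ).integrable_of_hasCompactSupport
      ((hcg.comp_left (g := starRingEnd ℂ) (map_zero _)).mul_left.mul_right)
  · have : Continuous fun z => cHess n Φ z j k := hΦ.ofReal_comp.wder.wderBar.continuous
    exact (((this.mul hf.continuous).mul hg.conj_comp.continuous).mul hE
      ).integrable_of_hasCompactSupport
      ((hcg.comp_left (g := starRingEnd ℂ) (map_zero _)).mul_left.mul_right)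

theorem re_sum_mul_conj_swap_ge {n : ℕ} (a : Fin n → Fin n → ℂ) :
    -(∑ j, ∑ k, ‖a j k - a k j‖ ^ 2) / 2 ≤ (∑ j, ∑ k, a j k * starRingEnd ℂ (a k j)).re := by
  have h1 : ∀ j k, ‖a j k - a k j‖ ^ 2
      = ‖a j k‖ ^ 2 + ‖a k j‖ ^ 2 - 2 * (a j k * starRingEnd ℂ (a k j)).re := by
    intro j k
    rw [← normSq_eq_norm_sq, ← normSq_eq_norm_sq, ← normSq_eq_norm_sq, normSq_sub]
  have h3 : (∑ j, ∑ k, ‖a k j‖ ^ 2) = ∑ j, ∑ k, ‖a j k‖ ^ 2 := Finset.sum_comm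
  have h4 : (0 : ℝ) ≤ ∑ j, ∑ k, ‖a j k‖ ^ 2 := by positivity
  have h5 : (∑ j, ∑ k, ‖a j k - a k j‖ ^ 2) = (∑ j, ∑ k, ‖a j k‖ ^ 2) +
      (∑ j, ∑ k, ‖a k j‖ ^ 2) - 2 * (∑ j, ∑ k, a j k * starRingEnd ℂ (a k j)).re := by
    simp only [h1, re_sum, Finset.mul_sum, Finset.sum_sub_distrib, Finset.sum_add_distrib]
  linarith

theorem bochner_inequality {n : ℕ} {Φ : (Fin n → ℂ) → ℝ} {v : Fin n → (Fin n → ℂ) → ℂ}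
    (hΦ : ContDiff ℝ (⊤ : ℕ∞) Φ) (hv : ∀ j, ContDiff ℝ (⊤ : ℕ∞) (v j))
    (hc : ∀ j, HasCompactSupport (v j)) :
    ∫ z, hermForm n (cHess n Φ z) (fun j => v j z) (fun j => v j z) * Real.exp (-Φ z)
      ≤ (∫ z, ‖∑ j, twDer n Φ j (v j) z‖ ^ 2 * Real.exp (-Φ z))
        + ∫ z, (∑ j, ∑ k, ‖wderBar n j (v k) z - wderBar n k (v j) z‖ ^ 2) / 2
            * Real.exp (-Φ z) := by
  have hE : Continuous (fun z => ((Real.exp (-Φ z) : ℝ) : ℂ)) := by fun_prop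
  have hE' : Continuous (fun z => Real.exp (-Φ z)) := by fun_prop
  have i1 : ∀ j k, Integrable fun z =>
      twDer n Φ j (v j) z * starRingEnd ℂ (twDer n Φ k (v k) z) * (Real.exp (-Φ z) : ℝ) :=
    fun j k => (((hΦ.twDer (hv j)).continuous.mul
      (hΦ.twDer (hv k)).conj_comp.continuous).mul hE).integrable_of_hasCompactSupport
      (((hc j).twDer).mul_right.mul_right)
  have i2 : ∀ j k, Integrable fun z =>
      wderBar n k (v j) z * starRingEnd ℂ (wderBar n j (v k) z) * (Real.exp (-Φ z) : ℝ) :=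
    fun j k => (((hv j).wderBar.continuous.mul
      (hv k).wderBar.conj_comp.continuous).mul hE).integrable_of_hasCompactSupport
      (((hc j).wderBar).mul_right.mul_right)
  have i3 : ∀ j k, Integrable fun z =>
      cHess n Φ z j k * v j z * starRingEnd ℂ (v k z) * (Real.exp (-Φ z) : ℝ) := fun j k => by
    have : Continuous fun z => cHess n Φ z j k := hΦ.ofReal_comp.wder.wderBar.continuous
    exact (((this.mul (hv j).continuous).mul
      (hv k).conj_comp.continuous).mul hE).integrable_of_hasCompactSupport
      ((hc j).mul_left.mul_right.mul_right)
  have i2s := integrable_finsetSum Finset.univ fun j _ =>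
    integrable_finsetSum Finset.univ fun k _ => i2 j k
  have i3s := integrable_finsetSum Finset.univ fun j _ =>
    integrable_finsetSum Finset.univ fun k _ => i3 j k
  have key : ∫ z, ∑ j, ∑ k, twDer n Φ j (v j) z * starRingEnd ℂ (twDer n Φ k (v k) z)
        * (Real.exp (-Φ z) : ℝ)
      = (∫ z, ∑ j, ∑ k, wderBar n k (v j) z * starRingEnd ℂ (wderBar n j (v k) z)
          * (Real.exp (-Φ z) : ℝ))
        + ∫ z, ∑ j, ∑ k, cHess n Φ z j k * v j z * starRingEnd ℂ (v k z)
          * (Real.exp (-Φ z) : ℝ) := by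
    rw [integral_finsetSum _ fun j _ => integrable_finsetSum Finset.univ fun k _ => i1 j k,
      integral_finsetSum _ fun j _ => integrable_finsetSum Finset.univ fun k _ => i2 j k,
      integral_finsetSum _ fun j _ => integrable_finsetSum Finset.univ fun k _ => i3 j k,
      ← Finset.sum_add_distrib]
    refine Finset.sum_congr rfl fun j _ => ?_
    rw [integral_finsetSum _ fun k _ => i1 j k, integral_finsetSum _ fun k _ => i2 j k,
      integral_finsetSum _ fun k _ => i3 j k, ← Finset.sum_add_distrib]
    exact Finset.sum_congr rfl fun k _ =>
      integral_twDer_mul_conj_twDer hΦ (hv j) (hv k) (hc j) (hc k) j k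
  have hA : (∫ z, ‖∑ j, twDer n Φ j (v j) z‖ ^ 2 * Real.exp (-Φ z))
      = (∫ z, ∑ j, ∑ k, twDer n Φ j (v j) z * starRingEnd ℂ (twDer n Φ k (v k) z)
        * (Real.exp (-Φ z) : ℝ)).re := by
    have : ∀ z, (∑ j, ∑ k, twDer n Φ j (v j) z * starRingEnd ℂ (twDer n Φ k (v k) z)
        * (Real.exp (-Φ z) : ℝ))
        = ((‖∑ j, twDer n Φ j (v j) z‖ ^ 2 * Real.exp (-Φ z) : ℝ) : ℂ) := by
      intro z
      simp only [← Finset.sum_mul, ← Finset.mul_sum, ← map_sum]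
      rw [mul_conj, normSq_eq_norm_sq]; push_cast; ring
    simp only [this, integral_complex_ofReal, ofReal_re]
  have hC : (∫ z, hermForm n (cHess n Φ z) (fun j => v j z) (fun j => v j z) * Real.exp (-Φ z))
      = (∫ z, ∑ j, ∑ k, cHess n Φ z j k * v j z * starRingEnd ℂ (v k z)
          * (Real.exp (-Φ z) : ℝ)).re := by
    have := reCLM.integral_comp_comm i3s
    simp only [reCLM_apply] at this
    rw [← this]
    congr 1; ext z
    simp only [← Finset.sum_mul, hermForm, re_mul_ofReal]
  have hB : -(∫ z, (∑ j, ∑ k, ‖wderBar n j (v k) z - wderBar n k (v j) z‖ ^ 2) / 2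
            * Real.exp (-Φ z))
      ≤ (∫ z, ∑ j, ∑ k, wderBar n k (v j) z * starRingEnd ℂ (wderBar n j (v k) z)
          * (Real.exp (-Φ z) : ℝ)).re := by
    have := reCLM.integral_comp_comm i2s
    simp only [reCLM_apply] at this
    rw [← this, ← integral_neg]
    refine integral_mono ?_ i2s.re fun z => ?_
    · refine Integrable.neg (Continuous.integrable_of_hasCompactSupport ?_ ?_)
      · refine Continuous.mul (Continuous.div_const (continuous_finsetSum _ fun j _ =>
          continuous_finsetSum _ fun k _ => ?_) _) hE'
        exact ((hv k).wderBar.continuous.sub (hv j).wderBar.continuous).norm.pow 2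
      · refine HasCompactSupport.intro (isCompact_iUnion fun j => hc j) fun z hz => ?_
        simp only [mem_iUnion, not_exists] at hz
        simp [fun j k => wderBar_eq_zero_of_notMem_tsupport (j := j) (hz k)]
    · have h := re_sum_mul_conj_swap_ge fun j k => wderBar n k (v j) z
      have h2 : (∑ j, ∑ k, wderBar n k (v j) z * starRingEnd ℂ (wderBar n j (v k) z)
          * ((Real.exp (-Φ z) : ℝ) : ℂ)).re
          = (∑ j, ∑ k, wderBar n k (v j) z * starRingEnd ℂ (wderBar n j (v k) z)).re
            * Real.exp (-Φ z) := by
        simp only [← Finset.sum_mul, re_mul_ofReal]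
      have h3 : (∑ j, ∑ k, ‖wderBar n j (v k) z - wderBar n k (v j) z‖ ^ 2)
          = ∑ j, ∑ k, ‖wderBar n k (v j) z - wderBar n j (v k) z‖ ^ 2 := by
        simp only [norm_sub_rev]
      have h4 := mul_le_mul_of_nonneg_right h (Real.exp_pos (-Φ z)).le
      rw [← h2, ← h3, neg_div, neg_mul] at h4
      exact h4
  have := congrArg Complex.re key
  rw [add_re, ← hA, ← hC] at this
  linarith

/-! ### The Bochner inequality with a cutoff function -/

theorem norm_sum_mul_sq_le {ι : Type*} (s : Finset ι) (a b : ι → ℂ) :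
    ‖∑ j ∈ s, a j * b j‖ ^ 2 ≤ (∑ j ∈ s, ‖a j‖ ^ 2) * ∑ j ∈ s, ‖b j‖ ^ 2 := by
  refine le_trans ?_ (Finset.sum_mul_sq_le_sq_mul_sq s (fun j => ‖a j‖) fun j => ‖b j‖)
  refine pow_le_pow_left₀ (norm_nonneg _) ?_ 2
  exact (norm_sum_le _ _).trans_eq (by simp)

theorem norm_add_sq_le_two (a b : ℂ) : ‖a + b‖ ^ 2 ≤ 2 * ‖a‖ ^ 2 + 2 * ‖b‖ ^ 2 := by
  have h : ‖a + b‖ ^ 2 ≤ (‖a‖ + ‖b‖) ^ 2 := pow_le_pow_left₀ (norm_nonneg _) (norm_add_le a b) 2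
  nlinarith [sq_nonneg (‖a‖ - ‖b‖)]

theorem norm_sub_sq_le_two (a b : ℂ) : ‖a - b‖ ^ 2 ≤ 2 * ‖a‖ ^ 2 + 2 * ‖b‖ ^ 2 := by
  simpa [sub_eq_add_neg] using norm_add_sq_le_two a (-b)

theorem hermForm_real_smul {n : ℕ} (H : Fin n → Fin n → ℂ) (r : ℝ) (X : Fin n → ℂ) :
    hermForm n H (fun j => r * X j) (fun j => r * X j) = r ^ 2 * hermForm n H X X := by
  have : ∀ j k, H j k * (r * X j) * starRingEnd ℂ (r * X k)
      = ((r ^ 2 : ℝ) : ℂ) * (H j k * X j * starRingEnd ℂ (X k)) := by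
    intro j k; simp; ring
  simp only [hermForm, this, ← Finset.mul_sum, re_ofReal_mul]

set_option maxHeartbeats 1000000 in
theorem bochner_inequality_cutoff {n : ℕ} {Φ η G : (Fin n → ℂ) → ℝ}
    {w : Fin n → (Fin n → ℂ) → ℂ}
    (hΦ : ContDiff ℝ (⊤ : ℕ∞) Φ) (hw : ∀ j, ContDiff ℝ (⊤ : ℕ∞) (w j))
    (hη : ContDiff ℝ (⊤ : ℕ∞) η) (hηc : HasCompactSupport η)
    (hG : Continuous G) (hGc : HasCompactSupport G)
    (hGH : ∀ z X, G z * ∑ j, ‖X j‖ ^ 2 ≤ η z ^ 2 * hermForm n (cHess n Φ z) X X)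
    (hcl : ∀ z ∈ tsupport η, ∀ j k, wderBar n j (w k) z = wderBar n k (w j) z) :
    ∫ z, G z * (∑ j, ‖w j z‖ ^ 2) * Real.exp (-Φ z)
      ≤ 2 * (∫ z, η z ^ 2 * ‖∑ j, twDer n Φ j (w j) z‖ ^ 2 * Real.exp (-Φ z))
        + 4 * ∫ z, (∑ j, ‖wder n j (fun w => (η w : ℂ)) z‖ ^ 2) * (∑ j, ‖w j z‖ ^ 2)
            * Real.exp (-Φ z) := by
  have hE' : Continuous (fun z => Real.exp (-Φ z)) := by fun_prop
  have hηC : ContDiff ℝ (⊤ : ℕ∞) (fun z => (η z : ℂ)) := hη.ofReal_comp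
  have hηCc : HasCompactSupport (fun z => (η z : ℂ)) := hηc.comp_left ofReal_zero
  set v : Fin n → (Fin n → ℂ) → ℂ := fun j z => η z * w j z with hvdef
  have hv : ∀ j, ContDiff ℝ (⊤ : ℕ∞) (v j) := fun j => hηC.mul (hw j)
  have hvc : ∀ j, HasCompactSupport (v j) := fun j => hηCc.mul_right
  have dη : ∀ z, DifferentiableAt ℝ (fun z => (η z : ℂ)) z := fun z =>
    hηC.differentiable (by simp) z
  have dw : ∀ j z, DifferentiableAt ℝ (w j) z := fun j z => (hw j).differentiable (by simp) z
  have key := bochner_inequality hΦ hv hvc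
  have cw : ∀ j, Continuous (w j) := fun j => (hw j).continuous
  have ctw : ∀ j, Continuous (twDer n Φ j (w j)) := fun j => (hΦ.twDer (hw j)).continuous
  have cdη : ∀ j, Continuous (wder n j fun z => (η z : ℂ)) := fun j => hηC.wder.continuous
  have cη := hη.continuous
  have hN : Continuous fun z => ∑ j, ‖w j z‖ ^ 2 := by fun_prop
  have i1 : Integrable fun z => η z ^ 2 * ‖∑ j, twDer n Φ j (w j) z‖ ^ 2 * Real.exp (-Φ z) := by
    refine Continuous.integrable_of_hasCompactSupport (by fun_prop) ?_
    refine HasCompactSupport.mul_right (HasCompactSupport.mul_right ?_)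
    exact hηc.comp_left (g := fun x => x ^ 2) (by simp)
  have i2 : Integrable fun z => (∑ j, ‖wder n j (fun w => (η w : ℂ)) z‖ ^ 2)
      * (∑ j, ‖w j z‖ ^ 2) * Real.exp (-Φ z) := by
    refine Continuous.integrable_of_hasCompactSupport (by fun_prop) ?_
    refine HasCompactSupport.mul_right (HasCompactSupport.mul_right ?_)
    refine HasCompactSupport.intro hηCc fun z hz => ?_
    simp [wder_eq_zero_of_notMem_tsupport hz]
  have i3 : Integrable fun z => G z * (∑ j, ‖w j z‖ ^ 2) * Real.exp (-Φ z) :=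
    Continuous.integrable_of_hasCompactSupport (by fun_prop) hGc.mul_right.mul_right
  have i4 : Integrable fun z => hermForm n (cHess n Φ z) (fun j => v j z) (fun j => v j z)
      * Real.exp (-Φ z) := by
    have cH : ∀ j k, Continuous fun z => cHess n Φ z j k :=
      fun j k => hΦ.ofReal_comp.wder.wderBar.continuous
    have cv : ∀ j, Continuous (v j) := fun j => (hv j).continuous
    refine Continuous.integrable_of_hasCompactSupport ?_ ?_
    · simp only [hermForm]
      refine Continuous.mul (continuous_re.comp ?_) hE'
      refine continuous_finsetSum _ fun j _ => continuous_finsetSum _ fun k _ => ?_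
      exact ((cH j k).mul (cv j)).mul (continuous_conj.comp (cv k))
    · refine HasCompactSupport.intro hηc fun z hz => ?_
      simp [hermForm, hvdef, image_eq_zero_of_notMem_tsupport hz]
  have b1 : ∀ z, ‖∑ j, twDer n Φ j (v j) z‖ ^ 2 ≤ 2 * (η z ^ 2 * ‖∑ j, twDer n Φ j (w j) z‖ ^ 2)
      + 2 * ((∑ j, ‖wder n j (fun w => (η w : ℂ)) z‖ ^ 2) * (∑ j, ‖w j z‖ ^ 2)) := by
    intro z
    have e : ∑ j, twDer n Φ j (v j) z = (η z : ℂ) * (∑ j, twDer n Φ j (w j) z)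
        + ∑ j, wder n j (fun w => (η w : ℂ)) z * w j z := by
      rw [Finset.mul_sum, ← Finset.sum_add_distrib]
      refine Finset.sum_congr rfl fun j _ => ?_
      simp only [twDer, hvdef, wder_mul (dη z) (dw j z)]; ring
    rw [e]
    refine (norm_add_sq_le_two _ _).trans (add_le_add ?_ ?_)
    · rw [norm_mul, mul_pow, norm_real, Real.norm_eq_abs, sq_abs]
    · exact mul_le_mul_of_nonneg_left (norm_sum_mul_sq_le _ _ _) (by norm_num)
  have b2 : ∀ z, (∑ j, ∑ k, ‖wderBar n j (v k) z - wderBar n k (v j) z‖ ^ 2) / 2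
      ≤ 2 * ((∑ j, ‖wder n j (fun w => (η w : ℂ)) z‖ ^ 2) * (∑ j, ‖w j z‖ ^ 2)) := by
    intro z
    have e : ∀ j k, wderBar n j (v k) z - wderBar n k (v j) z
        = wderBar n j (fun w => (η w : ℂ)) z * w k z
          - wderBar n k (fun w => (η w : ℂ)) z * w j z := by
      intro j k
      simp only [hvdef, wderBar_mul (dη z) (dw _ z)]
      by_cases hz : z ∈ tsupport η
      · rw [hcl z hz j k]; ring
      · simp [image_eq_zero_of_notMem_tsupport hz]
    have hle : ∀ j k, ‖wderBar n j (v k) z - wderBar n k (v j) z‖ ^ 2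
        ≤ 2 * (‖wder n j (fun w => (η w : ℂ)) z‖ ^ 2 * ‖w k z‖ ^ 2)
          + 2 * (‖wder n k (fun w => (η w : ℂ)) z‖ ^ 2 * ‖w j z‖ ^ 2) := by
      intro j k
      rw [e]
      refine (norm_sub_sq_le_two _ _).trans_eq ?_
      simp only [norm_mul, mul_pow, wderBar_ofReal, RCLike.norm_conj]
    have h3 := Finset.sum_le_sum fun j (_ : j ∈ Finset.univ) =>
      Finset.sum_le_sum fun k (_ : k ∈ Finset.univ) => hle j k
    have h4 : ∑ j, ∑ k, (2 * (‖wder n j (fun w => (η w : ℂ)) z‖ ^ 2 * ‖w k z‖ ^ 2)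
          + 2 * (‖wder n k (fun w => (η w : ℂ)) z‖ ^ 2 * ‖w j z‖ ^ 2))
        = 4 * ((∑ j, ‖wder n j (fun w => (η w : ℂ)) z‖ ^ 2) * (∑ j, ‖w j z‖ ^ 2)) := by
      simp only [Finset.sum_add_distrib, ← Finset.mul_sum, ← Finset.sum_mul]
      ring
    linarith
  have s1 : (∫ z, ‖∑ j, twDer n Φ j (v j) z‖ ^ 2 * Real.exp (-Φ z))
      + (∫ z, (∑ j, ∑ k, ‖wderBar n j (v k) z - wderBar n k (v j) z‖ ^ 2) / 2 * Real.exp (-Φ z))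
      ≤ (∫ z, (2 * (η z ^ 2 * ‖∑ j, twDer n Φ j (w j) z‖ ^ 2 * Real.exp (-Φ z))
      + 2 * ((∑ j, ‖wder n j (fun w => (η w : ℂ)) z‖ ^ 2) * (∑ j, ‖w j z‖ ^ 2)
        * Real.exp (-Φ z)))) + ∫ z, 2 * ((∑ j, ‖wder n j (fun w => (η w : ℂ)) z‖ ^ 2)
          * (∑ j, ‖w j z‖ ^ 2) * Real.exp (-Φ z)) := by
    refine add_le_add ?_ ?_
    · refine integral_mono_of_nonneg (ae_of_all _ fun z => by positivity)
        ((i1.const_mul 2).add (i2.const_mul 2)) (ae_of_all _ fun z => ?_)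
      have := mul_le_mul_of_nonneg_right (b1 z) (Real.exp_pos (-Φ z)).le
      simp only
      linarith
    · refine integral_mono_of_nonneg (ae_of_all _ fun z => by positivity)
        (i2.const_mul 2) (ae_of_all _ fun z => ?_)
      have := mul_le_mul_of_nonneg_right (b2 z) (Real.exp_pos (-Φ z)).le
      simp only
      linarith
  rw [integral_add (i1.const_mul 2) (i2.const_mul 2), integral_const_mul, integral_const_mul] at s1
  have s2 : ∫ z, G z * (∑ j, ‖w j z‖ ^ 2) * Real.exp (-Φ z)
      ≤ ∫ z, hermForm n (cHess n Φ z) (fun j => v j z) (fun j => v j z) * Real.exp (-Φ z) := by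
    refine integral_mono i3 i4 fun z => mul_le_mul_of_nonneg_right ?_ (Real.exp_pos _).le
    simp only [hvdef]
    rw [hermForm_real_smul]
    exact hGH z fun j => w j z
  linarith

/-! ### Mollification by rotation-invariant kernels -/

/-- The squared Euclidean norm on `ℂⁿ`. -/
noncomputable def esq {n : ℕ} (z : Fin n → ℂ) : ℝ := ∑ j, ‖z j‖ ^ 2

theorem contDiff_esq {n : ℕ} {k : WithTop ℕ∞} : ContDiff ℝ k (esq (n := n)) := by
  unfold esq
  refine ContDiff.sum fun j _ => ?_
  exact (contDiff_norm_sq ℝ).comp (contDiff_apply ℝ ℂ j)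

theorem esq_nonneg {n : ℕ} (z : Fin n → ℂ) : 0 ≤ esq z := by unfold esq; positivity

theorem esq_smul {n : ℕ} (c : ℂ) (z : Fin n → ℂ) : esq (c • z) = ‖c‖ ^ 2 * esq z := by
  simp [esq, mul_pow, Finset.mul_sum]

theorem norm_sq_le_esq {n : ℕ} (z : Fin n → ℂ) : ‖z‖ ^ 2 ≤ esq z := by
  have h : ‖z‖ ≤ Real.sqrt (esq z) := by
    refine (pi_norm_le_iff_of_nonneg (Real.sqrt_nonneg _)).2 fun j => Real.le_sqrt_of_sq_le ?_
    exact Finset.single_le_sum (f := fun j => ‖z j‖ ^ 2) (fun _ _ => by positivity)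
      (Finset.mem_univ j)
  calc ‖z‖ ^ 2 ≤ Real.sqrt (esq z) ^ 2 := pow_le_pow_left₀ (norm_nonneg _) h 2
    _ = esq z := Real.sq_sqrt (esq_nonneg z)

theorem esq_le {n : ℕ} (z : Fin n → ℂ) : esq z ≤ n * ‖z‖ ^ 2 := by
  calc esq z ≤ ∑ _j : Fin n, ‖z‖ ^ 2 :=
        Finset.sum_le_sum fun j _ => pow_le_pow_left₀ (norm_nonneg _) (norm_le_pi_norm z j) 2
    _ = n * ‖z‖ ^ 2 := by simp

/-- The unnormalized radial bump of radius `ε`. -/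
noncomputable def radialBump (n : ℕ) (ε : ℝ) (z : Fin n → ℂ) : ℝ :=
  Real.smoothTransition (1 - esq ((ε⁻¹ : ℂ) • z))

/-- The normalized radial bump of radius `ε`. -/
noncomputable def mker (n : ℕ) (ε : ℝ) (z : Fin n → ℂ) : ℝ :=
  (∫ w, radialBump n ε w)⁻¹ * radialBump n ε z

theorem contDiff_radialBump {n : ℕ} {ε : ℝ} : ContDiff ℝ (⊤ : ℕ∞) (radialBump n ε) := by
  unfold radialBump
  refine Real.smoothTransition.contDiff.comp (contDiff_const.sub (contDiff_esq.comp ?_))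
  fun_prop

theorem radialBump_eq_zero {n : ℕ} {ε : ℝ} (hε : 0 < ε) {z : Fin n → ℂ} (hz : ε ≤ ‖z‖) :
    radialBump n ε z = 0 := by
  refine Real.smoothTransition.zero_of_nonpos ?_
  have h1 := norm_sq_le_esq ((ε⁻¹ : ℂ) • z)
  have h2 : 1 ≤ ‖(ε⁻¹ : ℂ) • z‖ := by
    rw [norm_smul, norm_inv, norm_real, Real.norm_eq_abs, abs_of_pos hε, inv_mul_eq_div]
    exact (one_le_div hε).2 hz
  nlinarith

theorem radialBump_nonneg {n : ℕ} {ε : ℝ} (z : Fin n → ℂ) : 0 ≤ radialBump n ε z :=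
  Real.smoothTransition.nonneg _

theorem tsupport_radialBump_subset {n : ℕ} {ε : ℝ} (hε : 0 < ε) :
    tsupport (radialBump n ε) ⊆ Metric.closedBall 0 ε :=
  closure_minimal (fun z hz => by
    by_contra h
    rw [mem_closedBall_zero_iff, not_le] at h
    exact hz (radialBump_eq_zero hε h.le)) Metric.isClosed_closedBall

theorem hasCompactSupport_radialBump {n : ℕ} {ε : ℝ} (hε : 0 < ε) :
    HasCompactSupport (radialBump n ε) :=
  (isCompact_closedBall _ _).of_isClosed_subset isClosed_closure (tsupport_radialBump_subset hε)

theorem integral_radialBump_pos {n : ℕ} {ε : ℝ} (hε : 0 < ε) : 0 < ∫ w, radialBump n ε w := by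
  refine Continuous.integral_pos_of_hasCompactSupport_nonneg_nonzero (x := 0)
    contDiff_radialBump.continuous (hasCompactSupport_radialBump hε) radialBump_nonneg ?_
  simp [radialBump, esq]

theorem contDiff_mker {n : ℕ} {ε : ℝ} : ContDiff ℝ (⊤ : ℕ∞) (mker n ε) :=
  contDiff_const.mul contDiff_radialBump

theorem mker_eq_zero {n : ℕ} {ε : ℝ} (hε : 0 < ε) {z : Fin n → ℂ} (hz : ε ≤ ‖z‖) :
    mker n ε z = 0 := by
  simp [mker, radialBump_eq_zero hε hz]

theorem mker_nonneg {n : ℕ} {ε : ℝ} (hε : 0 < ε) (z : Fin n → ℂ) : 0 ≤ mker n ε z :=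
  mul_nonneg (inv_nonneg.2 (integral_radialBump_pos hε).le) (radialBump_nonneg z)

theorem tsupport_mker_subset {n : ℕ} {ε : ℝ} (hε : 0 < ε) :
    tsupport (mker n ε) ⊆ Metric.closedBall 0 ε :=
  closure_minimal (fun z hz => by
    by_contra h
    rw [mem_closedBall_zero_iff, not_le] at h
    exact hz (mker_eq_zero hε h.le)) Metric.isClosed_closedBall

theorem hasCompactSupport_mker {n : ℕ} {ε : ℝ} (hε : 0 < ε) : HasCompactSupport (mker n ε) :=
  (isCompact_closedBall _ _).of_isClosed_subset isClosed_closure (tsupport_mker_subset hε)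

theorem integrable_mker {n : ℕ} {ε : ℝ} (hε : 0 < ε) : Integrable (mker n ε) :=
  contDiff_mker.continuous.integrable_of_hasCompactSupport (hasCompactSupport_mker hε)

theorem integral_mker {n : ℕ} {ε : ℝ} (hε : 0 < ε) : ∫ z, mker n ε z = 1 := by
  simp only [mker, integral_const_mul]
  exact inv_mul_cancel₀ (integral_radialBump_pos hε).ne'

theorem mker_smul {n : ℕ} {ε : ℝ} {c : ℂ} (hc : ‖c‖ = 1) (z : Fin n → ℂ) :
    mker n ε (c • z) = mker n ε z := by
  simp [mker, radialBump, smul_comm _ c, esq_smul, hc]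

/-- The mollification of `g` at scale `ε`. -/
noncomputable def mol (n : ℕ) (ε : ℝ) {F : Type*} [NormedAddCommGroup F] [NormedSpace ℝ F]
    (g : (Fin n → ℂ) → F) : (Fin n → ℂ) → F :=
  mker n ε ⋆[ContinuousLinearMap.lsmul ℝ ℝ, volume] g

section
variable {n : ℕ} {ε : ℝ} {F : Type*} [NormedAddCommGroup F] [NormedSpace ℝ F]
  {g : (Fin n → ℂ) → F}

theorem mol_apply (z : Fin n → ℂ) : mol n ε g z = ∫ t, mker n ε t • g (z - t) := rfl

theorem mol_apply_swap (z : Fin n → ℂ) : mol n ε g z = ∫ t, mker n ε (z - t) • g t := by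
  rw [mol, convolution_eq_swap]; rfl

theorem contDiff_mol [CompleteSpace F] (hε : 0 < ε) (hg : LocallyIntegrable g) :
    ContDiff ℝ (⊤ : ℕ∞) (mol n ε g) :=
  (hasCompactSupport_mker hε).contDiff_convolution_left _ contDiff_mker hg

theorem integrable_mker_smul (hε : 0 < ε) (hg : LocallyIntegrable g) (z : Fin n → ℂ) :
    Integrable fun t => mker n ε t • g (z - t) :=
  (hasCompactSupport_mker hε).convolutionExists_left (ContinuousLinearMap.lsmul ℝ ℝ)
    contDiff_mker.continuous hg z

theorem integrable_mker_smul_swap (hε : 0 < ε) (hg : LocallyIntegrable g) (z : Fin n → ℂ) :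
    Integrable fun t => mker n ε (z - t) • g t := by
  simpa using (integrable_mker_smul hε hg z).comp_sub_left z

theorem fderiv_mol_apply [CompleteSpace F] (hε : 0 < ε) (hg : LocallyIntegrable g)
    (z v : Fin n → ℂ) :
    fderiv ℝ (mol n ε g) z v = ∫ t, fderiv ℝ (mker n ε) (z - t) v • g t := by
  have h := (hasCompactSupport_mker hε).hasFDerivAt_convolution_left
    (ContinuousLinearMap.lsmul ℝ ℝ : ℝ →L[ℝ] F →L[ℝ] F) (contDiff_mker.of_le (by simp)) hg z
  rw [mol, h.fderiv, convolution_eq_swap]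
  have hi : Integrable fun t => ((ContinuousLinearMap.lsmul ℝ ℝ : ℝ →L[ℝ] F →L[ℝ] F).precompL
      (Fin n → ℂ)) (fderiv ℝ (mker n ε) (z - t)) (g t) := by
    have := ((hasCompactSupport_mker (n := n) hε).fderiv ℝ).convolutionExists_left
      ((ContinuousLinearMap.lsmul ℝ ℝ : ℝ →L[ℝ] F →L[ℝ] F).precompL (Fin n → ℂ))
      (contDiff_mker.continuous_fderiv (by simp)) hg z
    simpa using Integrable.comp_sub_left this z
  rw [ContinuousLinearMap.integral_apply hi]
  rfl

theorem integrable_fderiv_mker_smul (hε : 0 < ε) (hg : LocallyIntegrable g)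
    (z v : Fin n → ℂ) : Integrable fun t => fderiv ℝ (mker n ε) (z - t) v • g t := by
  have h1 : HasCompactSupport (fun t => fderiv ℝ (mker n ε) t v) :=
    (hasCompactSupport_mker (n := n) hε).fderiv_apply ℝ v
  have h2 : Continuous (fun t => fderiv ℝ (mker n ε) t v) :=
    (contDiff_mker.continuous_fderiv (by simp)).clm_apply continuous_const
  have := h1.convolutionExists_left (ContinuousLinearMap.lsmul ℝ ℝ : ℝ →L[ℝ] F →L[ℝ] F) h2 hg z
  simpa using Integrable.comp_sub_left this z

end

/-- The kernel of mollification at `z`, as a complex-valued test function. -/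
theorem isTestFun_mker_sub {n : ℕ} {ε : ℝ} (hε : 0 < ε) {z : Fin n → ℂ} {V : Set (Fin n → ℂ)}
    (h : Metric.closedBall z ε ⊆ V) : IsTestFun n (fun t => (mker n ε (z - t) : ℂ)) V := by
  have hs : tsupport (fun t => (mker n ε (z - t) : ℂ)) ⊆ Metric.closedBall z ε := by
    refine closure_minimal (fun t ht => ?_) Metric.isClosed_closedBall
    by_contra hh
    rw [Metric.mem_closedBall, not_le, dist_comm, dist_eq_norm] at hh
    exact ht (by simp [mker_eq_zero hε hh.le])
  refine ⟨?_, (isCompact_closedBall z ε).of_isClosed_subset isClosed_closure hs, hs.trans h⟩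
  exact ContDiff.ofReal_comp (contDiff_mker.comp (contDiff_const.sub contDiff_id))

theorem fderiv_mker_sub {n : ℕ} {ε : ℝ} (z t v : Fin n → ℂ) :
    fderiv ℝ (fun t => (mker n ε (z - t) : ℂ)) t v = -(fderiv ℝ (mker n ε) (z - t) v : ℂ) := by
  have h1 : HasFDerivAt (fun t => z - t) (-ContinuousLinearMap.id ℝ (Fin n → ℂ)) t := by
    simpa using (hasFDerivAt_id (𝕜 := ℝ) t).const_sub z
  have h2 : HasFDerivAt (mker n ε) (fderiv ℝ (mker n ε) (z - t)) (z - t) :=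
    (contDiff_mker.differentiable (by simp) _).hasFDerivAt
  have h3 := (ofRealCLM.hasFDerivAt (x := mker n ε (z - t))).comp t (h2.comp t h1)
  have h4 : HasFDerivAt (fun t => (mker n ε (z - t) : ℂ)) _ t := h3
  rw [h4.fderiv]; simp

theorem wder_mol {n : ℕ} {ε : ℝ} {g : (Fin n → ℂ) → ℂ} (hε : 0 < ε) (hg : LocallyIntegrable g)
    (j : Fin n) (z : Fin n → ℂ) :
    wder n j (mol n ε g) z = -∫ t, g t * wder n j (fun t => (mker n ε (z - t) : ℂ)) t := by
  have i := integrable_fderiv_mker_smul hε hg z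
  simp only [wder, fderiv_mol_apply hε hg, fderiv_mker_sub]
  rw [← integral_const_mul, ← integral_sub (i _) ((i _).const_mul _), ← integral_const_mul,
    ← integral_neg]
  congr 1; ext t; simp only [real_smul]; ring

theorem wderBar_mol {n : ℕ} {ε : ℝ} {g : (Fin n → ℂ) → ℂ} (hε : 0 < ε)
    (hg : LocallyIntegrable g) (j : Fin n) (z : Fin n → ℂ) :
    wderBar n j (mol n ε g) z = -∫ t, g t * wderBar n j (fun t => (mker n ε (z - t) : ℂ)) t := by
  have i := integrable_fderiv_mker_smul hε hg z
  simp only [wderBar, fderiv_mol_apply hε hg, fderiv_mker_sub]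
  rw [← integral_const_mul, ← integral_add (i _) ((i _).const_mul _), ← integral_const_mul,
    ← integral_neg]
  congr 1; ext t; simp only [real_smul]; ring

/-! ### Convergence of mollifications in `L²` -/

theorem tendsto_lintegral_translate_sub {n : ℕ} {g : (Fin n → ℂ) → ℂ} (hg : MemLp g 2) :
    Tendsto (fun t => ∫⁻ z, ‖g (z - t) - g z‖ₑ ^ 2) (𝓝 0) (𝓝 0) := by
  have : Fact ((1 : ℝ≥0∞) ≤ 2) := ⟨by norm_num⟩
  let τ : (Fin n → ℂ) → C(Fin n → ℂ, Fin n → ℂ) := fun t => ⟨fun z => z - t, by fun_prop⟩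
  have hτ : Continuous τ := ContinuousMap.continuous_of_continuous_uncurry _ (by
    simp only [τ, Function.uncurry_def, ContinuousMap.coe_mk]; fun_prop)
  have hm : ∀ t, MeasurePreserving (τ t) volume volume := fun t =>
    measurePreserving_sub_right volume t
  have hc := (continuous_const (y := hg.toLp g)).compMeasurePreservingLp hτ hm (by norm_num)
  have h0 := (hc.tendsto 0).edist (tendsto_const_nhds (x := hg.toLp g))
  have h1 : ∀ t, edist (Lp.compMeasurePreserving (τ t) (hm t) (hg.toLp g)) (hg.toLp g)
      = eLpNorm (fun z => g (z - t) - g z) 2 volume := by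
    intro t
    rw [Lp.toLp_compMeasurePreserving hg (hm t), Lp.edist_toLp_toLp]
    rfl
  have h2 : Lp.compMeasurePreserving (τ 0) (hm 0) (hg.toLp g) = hg.toLp g := by
    rw [Lp.toLp_compMeasurePreserving hg (hm 0)]
    congr 1; ext z; simp [τ]
  simp only [h1, h2, edist_self] at h0
  have h3 := (ENNReal.continuous_pow 2).tendsto 0 |>.comp h0
  simp only [ne_eq, OfNat.ofNat_ne_zero, not_false_eq_true, zero_pow] at h3
  refine h3.congr fun t => ?_
  simp only [Function.comp]
  rw [eLpNorm_eq_lintegral_rpow_enorm_toReal (by norm_num) (by norm_num), ← ENNReal.rpow_natCast,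
    ← ENNReal.rpow_mul]
  simp

theorem lintegral_mker {n : ℕ} {ε : ℝ} (hε : 0 < ε) : ∫⁻ z, ENNReal.ofReal (mker n ε z) = 1 := by
  rw [← ofReal_integral_eq_lintegral_ofReal (integrable_mker hε)
    (ae_of_all _ (mker_nonneg hε)), integral_mker hε, ENNReal.ofReal_one]

theorem enorm_integral_mker_smul_sq_le {n : ℕ} {ε : ℝ} (hε : 0 < ε) {G : (Fin n → ℂ) → ℂ}
    (hG : AEStronglyMeasurable G) :
    ‖∫ t, mker n ε t • G t‖ₑ ^ 2 ≤ ∫⁻ t, ENNReal.ofReal (mker n ε t) * ‖G t‖ₑ ^ 2 := by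
  have hm : Measurable fun t => ENNReal.ofReal (mker n ε t) :=
    (ENNReal.continuous_ofReal.comp contDiff_mker.continuous).measurable
  let μ := (volume : Measure (Fin n → ℂ)).withDensity fun t => ENNReal.ofReal (mker n ε t)
  have : IsProbabilityMeasure μ := ⟨by simp [μ, lintegral_mker hε]⟩
  have hGμ : AEStronglyMeasurable G μ := hG.mono_ac (withDensity_absolutelyContinuous _ _)
  have e1 : ∫ t, mker n ε t • G t = ∫ t, G t ∂μ := by
    rw [integral_withDensity_eq_integral_toReal_smul hm (by simp)]
    congr 1; ext t; rw [ENNReal.toReal_ofReal (mker_nonneg hε t)]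
  have e2 : ∫⁻ t, ENNReal.ofReal (mker n ε t) * ‖G t‖ₑ ^ 2 = eLpNorm G 2 μ ^ 2 := by
    rw [eLpNorm_eq_lintegral_rpow_enorm_toReal (by norm_num) (by norm_num),
      ← ENNReal.rpow_natCast, ← ENNReal.rpow_mul, lintegral_withDensity_eq_lintegral_mul₀
      hm.aemeasurable (by fun_prop)]
    simp
  rw [e1, e2]
  refine pow_le_pow_left₀ (by simp) ?_ 2
  refine (enorm_integral_le_lintegral_enorm _).trans ?_
  rw [← eLpNorm_one_eq_lintegral_enorm]
  exact eLpNorm_le_eLpNorm_of_exponent_le (by norm_num) hGμ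

theorem tendsto_lintegral_mol_sub {n : ℕ} {g : (Fin n → ℂ) → ℂ} (hg : MemLp g 2) :
    Tendsto (fun ε => ∫⁻ z, ‖mol n ε g z - g z‖ₑ ^ 2) (𝓝[>] 0) (𝓝 0) := by
  have hgl : LocallyIntegrable g := hg.locallyIntegrable (by norm_num)
  have hT := tendsto_lintegral_translate_sub hg
  rw [ENNReal.tendsto_nhds_zero] at hT ⊢
  intro δ hδ
  obtain ⟨r, hr, hball⟩ := Metric.eventually_nhds_iff.1 (hT δ hδ)
  filter_upwards [Ioo_mem_nhdsGT hr] with ε hε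
  have hε0 : 0 < ε := hε.1
  have hsm : AEStronglyMeasurable (fun p : (Fin n → ℂ) × (Fin n → ℂ) => g (p.1 - p.2) - g p.1)
      (volume.prod volume) := by
    refine AEStronglyMeasurable.sub ?_ hg.1.comp_fst
    exact hg.1.comp_quasiMeasurePreserving (quasiMeasurePreserving_sub_of_right_invariant _ _)
  have hpt : ∀ z, ‖mol n ε g z - g z‖ₑ ^ 2
      ≤ ∫⁻ t, ENNReal.ofReal (mker n ε t) * ‖g (z - t) - g z‖ₑ ^ 2 := by
    intro z
    have e : mol n ε g z - g z = ∫ t, mker n ε t • (g (z - t) - g z) := by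
      simp only [smul_sub]
      rw [integral_sub (integrable_mker_smul hε0 hgl z) ((integrable_mker hε0).smul_const _),
        integral_smul_const, integral_mker hε0, one_smul, mol_apply]
    rw [e]
    refine enorm_integral_mker_smul_sq_le hε0 (AEStronglyMeasurable.sub ?_ (by fun_prop))
    exact hg.1.comp_quasiMeasurePreserving (quasiMeasurePreserving_sub_left volume z)
  calc ∫⁻ z, ‖mol n ε g z - g z‖ₑ ^ 2
      ≤ ∫⁻ z, ∫⁻ t, ENNReal.ofReal (mker n ε t) * ‖g (z - t) - g z‖ₑ ^ 2 := lintegral_mono hpt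
    _ = ∫⁻ t, ∫⁻ z, ENNReal.ofReal (mker n ε t) * ‖g (z - t) - g z‖ₑ ^ 2 := by
        refine lintegral_lintegral_swap ?_
        refine AEMeasurable.mul ?_ (hsm.enorm.pow_const 2)
        exact ((ENNReal.continuous_ofReal.comp contDiff_mker.continuous).comp
          continuous_snd).aemeasurable
    _ = ∫⁻ t, ENNReal.ofReal (mker n ε t) * ∫⁻ z, ‖g (z - t) - g z‖ₑ ^ 2 := by
        congr 1; ext t; rw [lintegral_const_mul' _ _ (by simp)]
    _ ≤ ∫⁻ t, ENNReal.ofReal (mker n ε t) * δ := by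
        refine lintegral_mono fun t => ?_
        by_cases ht : ε ≤ ‖t‖
        · simp [mker_eq_zero hε0 ht]
        · refine mul_le_mul_right (hball ?_) _
          rw [dist_zero_right]; linarith [hε.2]
    _ = δ := by
        rw [lintegral_mul_const _ (contDiff_mker.continuous.measurable.ennreal_ofReal),
          lintegral_mker hε0, one_mul]

/-! ### The weighted Bochner inequality for weak solutions -/

theorem eLpNorm_two_sq {α : Type*} [MeasurableSpace α] {μ : Measure α} (f : α → ℂ) :
    eLpNorm f 2 μ ^ 2 = ∫⁻ z, ‖f z‖ₑ ^ 2 ∂μ := by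
  rw [eLpNorm_eq_lintegral_rpow_enorm_toReal (by norm_num) (by norm_num), ← ENNReal.rpow_natCast,
    ← ENNReal.rpow_mul]
  simp

theorem integral_norm_sq_eq {α : Type*} [MeasurableSpace α] {μ : Measure α} {f : α → ℂ}
    (hf : AEStronglyMeasurable f μ) : ∫ z, ‖f z‖ ^ 2 ∂μ = (eLpNorm f 2 μ ^ 2).toReal := by
  rw [eLpNorm_two_sq, integral_eq_lintegral_of_nonneg_ae (ae_of_all _ fun z => by positivity)
    (hf.norm.fun_pow 2)]
  congr 1
  refine lintegral_congr fun z => ?_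
  rw [ENNReal.ofReal_pow (norm_nonneg _), ofReal_norm]

theorem tendsto_eLpNorm_mol_sub {n : ℕ} {g : (Fin n → ℂ) → ℂ} (hg : MemLp g 2) :
    Tendsto (fun ε => eLpNorm (fun z => mol n ε g z - g z) 2) (𝓝[>] 0) (𝓝 0) := by
  have h := (ENNReal.continuous_rpow_const (y := 1 / 2)).tendsto 0 |>.comp
    (tendsto_lintegral_mol_sub hg)
  simp only [ENNReal.zero_rpow_of_pos (by norm_num : (0 : ℝ) < 1 / 2)] at h
  refine h.congr fun ε => ?_
  simp only [Function.comp, ← eLpNorm_two_sq]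
  rw [← ENNReal.rpow_natCast, ← ENNReal.rpow_mul]
  norm_num

theorem abs_norm_sq_sub_norm_sq_le {δ : ℝ} (hδ : 0 < δ) (a b : ℂ) :
    |‖a‖ ^ 2 - ‖b‖ ^ 2| ≤ δ * ‖b‖ ^ 2 + (1 + 1 / δ) * ‖a - b‖ ^ 2 := by
  have h1 : |‖a‖ - ‖b‖| ≤ ‖a - b‖ := abs_norm_sub_norm_le a b
  have h2 : |‖a‖ ^ 2 - ‖b‖ ^ 2| = |‖a‖ - ‖b‖| * (‖a‖ + ‖b‖) := by
    rw [sq_sub_sq, abs_mul, abs_of_nonneg (by positivity : 0 ≤ ‖a‖ + ‖b‖), mul_comm]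
  have h3 : ‖a‖ ≤ ‖b‖ + ‖a - b‖ := by linarith [le_abs_self (‖a‖ - ‖b‖)]
  have h4 : |‖a‖ - ‖b‖| * (‖a‖ + ‖b‖) ≤ ‖a - b‖ * (2 * ‖b‖ + ‖a - b‖) :=
    mul_le_mul h1 (by linarith) (by positivity) (norm_nonneg _)
  have h5 : 2 * (‖a - b‖ * ‖b‖) ≤ δ * ‖b‖ ^ 2 + 1 / δ * ‖a - b‖ ^ 2 := by
    have := sq_nonneg (δ * ‖b‖ - ‖a - b‖)
    rw [← sub_nonneg]
    have e : δ * ‖b‖ ^ 2 + 1 / δ * ‖a - b‖ ^ 2 - 2 * (‖a - b‖ * ‖b‖)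
        = (δ * ‖b‖ - ‖a - b‖) ^ 2 / δ := by field_simp; ring
    rw [e]; positivity
  nlinarith

theorem tendsto_integral_mul_norm_sq {α ι : Type*} [MeasurableSpace α] {μ : Measure α}
    {l : Filter ι} {F : ι → α → ℂ} {f : α → ℂ} {q : α → ℝ} {C : ℝ}
    (hF : ∀ᶠ i in l, AEStronglyMeasurable (F i) μ)
    (hf : MemLp f 2 μ) (hq : AEStronglyMeasurable q μ) (hqC : ∀ z, |q z| ≤ C)
    (h : Tendsto (fun i => eLpNorm (fun z => F i z - f z) 2 μ) l (𝓝 0)) :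
    Tendsto (fun i => ∫ z, q z * ‖F i z‖ ^ 2 ∂μ) l (𝓝 (∫ z, q z * ‖f z‖ ^ 2 ∂μ)) := by
  have hC : 0 ≤ C ∨ IsEmpty α := by
    rcases isEmpty_or_nonempty α with h | ⟨⟨a⟩⟩
    · exact Or.inr h
    · exact Or.inl ((abs_nonneg _).trans (hqC a))
  rcases hC with hC | hC
  swap
  · simp only [Measure.eq_zero_of_isEmpty, integral_zero_measure]
    exact tendsto_const_nhds
  have hqi : ∀ {g : α → ℂ}, MemLp g 2 μ → Integrable (fun z => q z * ‖g z‖ ^ 2) μ := by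
    intro g hg
    exact (hg.integrable_norm_pow (by norm_num)).bdd_mul hq (ae_of_all _ hqC)
  set I := ∫ z, ‖f z‖ ^ 2 ∂μ with hI
  have hI0 : 0 ≤ I := integral_nonneg fun z => by positivity
  have hD : Tendsto (fun i => (eLpNorm (fun z => F i z - f z) 2 μ ^ 2).toReal) l (𝓝 0) := by
    have h3 := (ENNReal.continuous_pow 2).tendsto 0 |>.comp h
    simp only [ne_eq, OfNat.ofNat_ne_zero, not_false_eq_true, zero_pow] at h3
    have h4 := (ENNReal.tendsto_toReal ENNReal.zero_ne_top).comp h3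
    rw [ENNReal.toReal_zero] at h4
    exact h4
  rw [Metric.tendsto_nhds]
  intro e he
  set δ := e / (2 * (C * I + 1)) with hδ
  have hδ0 : 0 < δ := by positivity
  have hsmall : C * (δ * I) < e / 2 + 0 := by
    have : C * (δ * I) = (e / 2) * ((C * I) / (C * I + 1)) := by
      rw [hδ]; field_simp
    rw [this, add_zero]
    have h1 : (C * I) / (C * I + 1) < 1 := (div_lt_one (by positivity)).2 (by linarith)
    nlinarith
  have hev : ∀ᶠ i in l, C * ((1 + 1 / δ) * (eLpNorm (fun z => F i z - f z) 2 μ ^ 2).toReal)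
      < e / 2 := by
    have := ((hD.const_mul (1 + 1 / δ)).const_mul C)
    simp only [mul_zero] at this
    exact (tendsto_order.1 this).2 _ (by positivity)
  have hfin : ∀ᶠ i in l, eLpNorm (fun z => F i z - f z) 2 μ < ⊤ :=
    (tendsto_order.1 h).2 _ (by simp)
  filter_upwards [hev, hF, hfin] with i hi hFi hfi
  have hsub : MemLp (fun z => F i z - f z) 2 μ := ⟨hFi.sub hf.1, hfi⟩
  have hFm : MemLp (F i) 2 μ := by
    convert hsub.add hf using 1
    ext z; simp
  rw [Real.dist_eq, ← integral_sub (hqi hFm) (hqi hf)]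
  refine (abs_integral_le_integral_abs).trans_lt ?_
  have hle : ∫ z, |q z * ‖F i z‖ ^ 2 - q z * ‖f z‖ ^ 2| ∂μ
      ≤ ∫ z, (C * δ * ‖f z‖ ^ 2 + C * (1 + 1 / δ) * ‖F i z - f z‖ ^ 2) ∂μ := by
    refine integral_mono ((hqi hFm).sub (hqi hf)).abs
      (((hf.integrable_norm_pow (by norm_num)).const_mul _).add
        ((hsub.integrable_norm_pow (by norm_num)).const_mul _)) fun z => ?_
    simp only
    rw [← mul_sub, abs_mul]
    have := abs_norm_sq_sub_norm_sq_le hδ0 (F i z) (f z)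
    calc |q z| * |‖F i z‖ ^ 2 - ‖f z‖ ^ 2|
        ≤ C * (δ * ‖f z‖ ^ 2 + (1 + 1 / δ) * ‖F i z - f z‖ ^ 2) :=
          mul_le_mul (hqC z) this (abs_nonneg _) hC
      _ = _ := by ring
  rw [integral_add ((hf.integrable_norm_pow (by norm_num)).const_mul _)
        ((hsub.integrable_norm_pow (by norm_num)).const_mul _), integral_const_mul,
        integral_const_mul, integral_norm_sq_eq hsub.1] at hle
  have : C * δ * I = C * (δ * I) := by ring
  linarith

theorem HasCompactSupport.exists_abs_le {n : ℕ} {q : (Fin n → ℂ) → ℝ} (hq : Continuous q)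
    (hc : HasCompactSupport q) : ∃ C, ∀ z, |q z| ≤ C :=
  hq.bounded_above_of_compact_support hc

theorem twDer_mol_sum_eq {n : ℕ} {Φ : (Fin n → ℂ) → ℝ} {V : Set (Fin n → ℂ)}
    {w : Fin n → (Fin n → ℂ) → ℂ} {h : (Fin n → ℂ) → ℂ} {ε : ℝ} (hε : 0 < ε)
    (hw : ∀ j, LocallyIntegrable (w j))
    (hp : ∀ j, LocallyIntegrable (V.indicator fun t => wder n j (fun w => (Φ w : ℂ)) t * w j t))
    (hth : ∀ κ, IsTestFun n κ V →
      ∫ z, ∑ j, w j z * (wder n j κ z + wder n j (fun w => (Φ w : ℂ)) z * κ z) = ∫ z, h z * κ z)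
    {z : Fin n → ℂ} (hz : Metric.closedBall z ε ⊆ V) :
    ∑ j, wder n j (mol n ε (w j)) z
      = (∑ j, mol n ε (V.indicator fun t => wder n j (fun w => (Φ w : ℂ)) t * w j t) z)
        - mol n ε h z := by
  have hκ := isTestFun_mker_sub hε hz
  have := hth _ hκ
  have hx : ∀ t, mker n ε (z - t) ≠ 0 → t ∈ V := by
    intro t ht
    refine hz ?_
    rw [Metric.mem_closedBall, dist_comm, dist_eq_norm]
    by_contra hc
    exact ht (mker_eq_zero hε (not_le.1 hc).le)
  have e1 : ∀ t, ∑ j, w j t * (wder n j (fun t => (mker n ε (z - t) : ℂ)) t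
      + wder n j (fun w => (Φ w : ℂ)) t * (mker n ε (z - t) : ℂ))
      = ∑ j, (w j t * wder n j (fun t => (mker n ε (z - t) : ℂ)) t + mker n ε (z - t) •
        (V.indicator (fun t => wder n j (fun w => (Φ w : ℂ)) t * w j t) t)) := by
    intro t
    refine Finset.sum_congr rfl fun j _ => ?_
    rw [mul_add]; congr 1
    by_cases ht : t ∈ V
    · simp only [indicator_of_mem ht, real_smul]; ring
    · have : mker n ε (z - t) = 0 := by by_contra h; exact ht (hx t h)
      simp [this]
  have i1 : ∀ j, Integrable fun t => w j t * wder n j (fun t => (mker n ε (z - t) : ℂ)) t := by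
    intro j
    simp_rw [mul_comm (w j _)]
    exact (hw j).integrable_smul_left_of_hasCompactSupport
      (hκ.1.wder.continuous) hκ.2.1.wder
  simp only [e1] at this
  rw [integral_finsetSum _ fun j _ => (i1 j).fun_add (integrable_mker_smul_swap hε (hp j) z)] at this
  simp only [integral_add (i1 _) (integrable_mker_smul_swap hε (hp _) z), ← mol_apply_swap,
    Finset.sum_add_distrib] at this
  simp only [wder_mol hε (hw _), Finset.sum_neg_distrib]
  have e2 : mol n ε h z = ∫ t, h t * (mker n ε (z - t) : ℂ) := by
    rw [mol_apply_swap]; congr 1; ext t; rw [real_smul, mul_comm]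
  rw [e2, ← this]; ring

theorem wderBar_mol_comm {n : ℕ} {V : Set (Fin n → ℂ)} {w : Fin n → (Fin n → ℂ) → ℂ} {ε : ℝ}
    (hε : 0 < ε) (hw : ∀ j, LocallyIntegrable (w j))
    (hcl : ∀ j k κ, IsTestFun n κ V → ∫ z, (w j z * wderBar n k κ z - w k z * wderBar n j κ z) = 0)
    {z : Fin n → ℂ} (hz : Metric.closedBall z ε ⊆ V) (j k : Fin n) :
    wderBar n j (mol n ε (w k)) z = wderBar n k (mol n ε (w j)) z := by
  have hκ := isTestFun_mker_sub hε hz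
  have i1 : ∀ j k, Integrable fun t =>
      w j t * wderBar n k (fun t => (mker n ε (z - t) : ℂ)) t := by
    intro j k
    simp_rw [mul_comm (w j _)]
    exact (hw j).integrable_smul_left_of_hasCompactSupport
      (hκ.1.wderBar.continuous) hκ.2.1.wderBar
  have := hcl j k _ hκ
  rw [integral_sub (i1 _ _) (i1 _ _), sub_eq_zero] at this
  rw [wderBar_mol hε (hw k), wderBar_mol hε (hw j), this]

theorem tendsto_eLpNorm_bdd_mul {α ι : Type*} [MeasurableSpace α] {μ : Measure α} {l : Filter ι}
    {F : ι → α → ℂ} {b : α → ℂ} {C : ℝ} (hb : ∀ z, ‖b z‖ ≤ C)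
    (h : Tendsto (fun i => eLpNorm (F i) 2 μ) l (𝓝 0)) :
    Tendsto (fun i => eLpNorm (fun z => b z * F i z) 2 μ) l (𝓝 0) := by
  have h1 : Tendsto (fun i => ENNReal.ofReal C * eLpNorm (F i) 2 μ) l (𝓝 0) := by
    have := ENNReal.Tendsto.const_mul (a := ENNReal.ofReal C) h (Or.inr ENNReal.ofReal_ne_top)
    rwa [mul_zero] at this
  refine tendsto_of_tendsto_of_tendsto_of_le_of_le tendsto_const_nhds h1 (fun _ => zero_le)
    fun i => ?_
  refine eLpNorm_le_mul_eLpNorm_of_ae_le_mul (ae_of_all _ fun z => ?_) _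
  rw [norm_mul]
  exact mul_le_mul_of_nonneg_right (hb z) (norm_nonneg _)

theorem tendsto_eLpNorm_sub_sum {α ι κ : Type*} [MeasurableSpace α] {μ : Measure α} {l : Filter ι}
    {s : Finset κ} {F : κ → ι → α → ℂ}
    (hm : ∀ j i, AEStronglyMeasurable (F j i) μ)
    (h : ∀ j, Tendsto (fun i => eLpNorm (F j i) 2 μ) l (𝓝 0)) :
    Tendsto (fun i => eLpNorm (fun z => ∑ j ∈ s, F j i z) 2 μ) l (𝓝 0) := by
  have h1 : Tendsto (fun i => ∑ j ∈ s, eLpNorm (F j i) 2 μ) l (𝓝 0) := by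
    simpa using tendsto_finsetSum s fun j _ => h j
  refine tendsto_of_tendsto_of_tendsto_of_le_of_le tendsto_const_nhds h1 (fun _ => zero_le)
    fun i => ?_
  have := eLpNorm_sum_le (p := 2) (μ := μ) (s := s) (f := fun j => F j i)
    (fun j _ => hm j i) (by norm_num)
  have e : (fun z => ∑ j ∈ s, F j i z) = ∑ j ∈ s, F j i := by ext z; rw [Finset.sum_apply]
  show eLpNorm (fun z => ∑ j ∈ s, F j i z) 2 μ ≤ _
  rw [e]
  exact this

theorem tendsto_integral_mul_sum_norm_sq {α ι κ : Type*} [MeasurableSpace α] {μ : Measure α}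
    {l : Filter ι} {s : Finset κ} {F : κ → ι → α → ℂ} {f : κ → α → ℂ} {q : α → ℝ} {C : ℝ}
    (hF : ∀ j i, AEStronglyMeasurable (F j i) μ)
    (hf : ∀ j, MemLp (f j) 2 μ) (hq : AEStronglyMeasurable q μ) (hqC : ∀ z, |q z| ≤ C)
    (h : ∀ j, Tendsto (fun i => eLpNorm (fun z => F j i z - f j z) 2 μ) l (𝓝 0)) :
    Tendsto (fun i => ∫ z, q z * ∑ j ∈ s, ‖F j i z‖ ^ 2 ∂μ) l
      (𝓝 (∫ z, q z * ∑ j ∈ s, ‖f j z‖ ^ 2 ∂μ)) := by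
  have hqi : ∀ {g : α → ℂ}, MemLp g 2 μ → Integrable (fun z => q z * ‖g z‖ ^ 2) μ := by
    intro g hg
    exact (hg.integrable_norm_pow (by norm_num)).bdd_mul hq (ae_of_all _ hqC)
  have hfin : ∀ᶠ i in l, ∀ j ∈ s, eLpNorm (fun z => F j i z - f j z) 2 μ < ⊤ :=
    (Filter.eventually_all_finset s).2 fun j _ => (tendsto_order.1 (h j)).2 _ (by simp)
  have hsum := tendsto_finsetSum s fun j _ =>
    tendsto_integral_mul_norm_sq (.of_forall (hF j)) (hf j) hq hqC (h j)
  simp_rw [Finset.mul_sum]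
  rw [integral_finsetSum _ fun j _ => hqi (hf j)]
  refine hsum.congr' ?_
  filter_upwards [hfin] with i hi
  refine (integral_finsetSum _ fun j hj => hqi ?_).symm
  have hsub : MemLp (fun z => F j i z - f j z) 2 μ := ⟨(hF j i).sub (hf j).1, hi j hj⟩
  convert hsub.add (hf j) using 1
  ext z; simp

theorem weak_bochner {n : ℕ} {Φ η G : (Fin n → ℂ) → ℝ} {V : Set (Fin n → ℂ)}
    {w : Fin n → (Fin n → ℂ) → ℂ} {h : (Fin n → ℂ) → ℂ}
    (hV : IsOpen V) (hVb : Bornology.IsBounded V)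
    (hΦ : ContDiff ℝ (⊤ : ℕ∞) Φ)
    (hη : ContDiff ℝ (⊤ : ℕ∞) η) (hηc : HasCompactSupport η) (hηV : tsupport η ⊆ V)
    (hG : Continuous G) (hGc : HasCompactSupport G)
    (hGH : ∀ z X, G z * ∑ j, ‖X j‖ ^ 2 ≤ η z ^ 2 * hermForm n (cHess n Φ z) X X)
    (hw : ∀ j, MemLp (w j) 2) (hh : MemLp h 2)
    (hcl : ∀ j k κ, IsTestFun n κ V → ∫ z, (w j z * wderBar n k κ z - w k z * wderBar n j κ z) = 0)
    (hth : ∀ κ, IsTestFun n κ V →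
      ∫ z, ∑ j, w j z * (wder n j κ z + wder n j (fun w => (Φ w : ℂ)) z * κ z)
        = ∫ z, h z * κ z) :
    ∫ z, G z * (∑ j, ‖w j z‖ ^ 2) * Real.exp (-Φ z)
      ≤ 2 * (∫ z, η z ^ 2 * ‖h z‖ ^ 2 * Real.exp (-Φ z))
        + 4 * ∫ z, (∑ j, ‖wder n j (fun w => (η w : ℂ)) z‖ ^ 2) * (∑ j, ‖w j z‖ ^ 2)
            * Real.exp (-Φ z) := by
  have hE : Continuous (fun z => Real.exp (-Φ z)) := by have := hΦ.continuous; fun_prop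
  have hηC : ContDiff ℝ (⊤ : ℕ∞) (fun z => (η z : ℂ)) := hη.ofReal_comp
  have hηCc : HasCompactSupport (fun z => (η z : ℂ)) := hηc.comp_left ofReal_zero
  have hΦj : ∀ j, Continuous (wder n j (fun w => (Φ w : ℂ))) := fun j =>
    hΦ.ofReal_comp.wder.continuous
  have hL : ∀ {g : (Fin n → ℂ) → ℂ}, MemLp g 2 → LocallyIntegrable g := fun hg =>
    hg.locallyIntegrable (by norm_num)
  -- the first order terms
  set p : Fin n → (Fin n → ℂ) → ℂ :=
    fun j => V.indicator fun t => wder n j (fun w => (Φ w : ℂ)) t * w j t with hp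
  have hpL : ∀ j, MemLp (p j) 2 := by
    intro j
    obtain ⟨C, hC⟩ := (hVb.isCompact_closure).exists_bound_of_continuousOn (hΦj j).continuousOn
    have e : p j = fun t => V.indicator (wder n j (fun w => (Φ w : ℂ))) t * w j t := by
      ext t
      simp only [hp, indicator]
      split_ifs <;> simp
    rw [e]
    have hCn : ∀ t, ‖V.indicator (wder n j (fun w => (Φ w : ℂ))) t‖ ≤ max C 0 := by
      intro t
      by_cases ht : t ∈ V
      · rw [indicator_of_mem ht]; exact (hC t (subset_closure ht)).trans (le_max_left _ _)
      · rw [indicator_of_notMem ht, norm_zero]; exact le_max_right _ _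
    have hm : AEStronglyMeasurable (V.indicator (wder n j (fun w => (Φ w : ℂ)))) volume :=
      (hΦj j).aestronglyMeasurable.indicator hV.measurableSet
    refine (hw j).of_le_mul (c := max C 0) (hm.mul (hw j).1) (ae_of_all _ fun t => ?_)
    rw [norm_mul]
    exact mul_le_mul_of_nonneg_right (hCn t) (norm_nonneg _)
  set l : Filter ℝ := 𝓝[>] 0 with hl
  have hmolc : ∀ {g : (Fin n → ℂ) → ℂ}, MemLp g 2 → ∀ ε, 0 < ε →
      Continuous (mol n ε g) := fun hg ε hε => (contDiff_mol hε (hL hg)).continuous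
  -- replace `mol` by a version measurable for all parameters
  let mo : ((Fin n → ℂ) → ℂ) → ℝ → (Fin n → ℂ) → ℂ := fun g ε z => if 0 < ε then mol n ε g z else g z
  have hmo : ∀ {g : (Fin n → ℂ) → ℂ} {ε}, 0 < ε → mo g ε = mol n ε g := by
    intro g ε hε; ext z; simp [mo, hε]
  have hmom : ∀ {g : (Fin n → ℂ) → ℂ}, MemLp g 2 → ∀ ε, AEStronglyMeasurable (mo g ε) volume := by
    intro g hg ε
    by_cases hε : 0 < ε
    · rw [hmo hε]; exact (hmolc hg ε hε).aestronglyMeasurable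
    · have : mo g ε = g := by ext z; simp [mo, hε]
      rw [this]; exact hg.1
  have hpos : ∀ᶠ ε in l, (0 : ℝ) < ε := self_mem_nhdsWithin
  have hmot : ∀ {g : (Fin n → ℂ) → ℂ}, MemLp g 2 →
      Tendsto (fun ε => eLpNorm (fun z => mo g ε z - g z) 2) l (𝓝 0) := by
    intro g hg
    refine (tendsto_eLpNorm_mol_sub hg).congr' ?_
    filter_upwards [hpos] with ε hε
    rw [hmo hε]
  -- smallness
  have hsmall : ∀ᶠ ε in l, ∀ z ∈ tsupport η, Metric.closedBall z ε ⊆ V := by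
    obtain ⟨δ, hδ, hδV⟩ := hηc.isCompact.exists_cthickening_subset_open hV hηV
    filter_upwards [Ioc_mem_nhdsGT hδ] with ε hε z hz
    exact (Metric.closedBall_subset_closedBall hε.2).trans
      ((Metric.closedBall_subset_cthickening hz δ).trans hδV)
  have hηc' : ∃ C, ∀ z, ‖(η z : ℂ)‖ ≤ C :=
    hηC.continuous.bounded_above_of_compact_support hηCc
  obtain ⟨Cη, hCη⟩ := hηc'
  have hηΦ : ∀ j, ∃ C, ∀ z, ‖(η z : ℂ) * wder n j (fun w => (Φ w : ℂ)) z‖ ≤ C := fun j =>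
    (hηC.continuous.mul (hΦj j)).bounded_above_of_compact_support hηCc.mul_right
  choose CΦ hCΦ using hηΦ
  let A : ℝ → (Fin n → ℂ) → ℂ := fun ε z =>
    η z * ((∑ j, (mo (p j) ε z - wder n j (fun w => (Φ w : ℂ)) z * mo (w j) ε z)) - mo h ε z)
  have hA : Tendsto (fun ε => eLpNorm (fun z => A ε z - (-(η z * h z))) 2) l (𝓝 0) := by
    let T : Option (Fin n) → ℝ → (Fin n → ℂ) → ℂ := fun o ε z => match o with
      | none => -(η z : ℂ) * (mo h ε z - h z)
      | some j => η z * (mo (p j) ε z - p j z)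
        + (-(η z * wder n j (fun w => (Φ w : ℂ)) z)) * (mo (w j) ε z - w j z)
    have hT : ∀ ε z, A ε z - (-(η z * h z)) = ∑ o, T o ε z := by
      intro ε z
      simp only [T, Fintype.sum_option, A]
      have e1 : ∀ j, η z * (mo (p j) ε z - p j z)
        + (-(η z * wder n j (fun w => (Φ w : ℂ)) z)) * (mo (w j) ε z - w j z)
        = η z * (mo (p j) ε z - wder n j (fun w => (Φ w : ℂ)) z * mo (w j) ε z) := by
        intro j
        by_cases hz : η z = 0
        · simp [hz]
        · have : z ∈ V := hηV (subset_tsupport _ hz)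
          simp only [hp, indicator_of_mem this]; ring
      simp only [e1, ← Finset.mul_sum]
      ring
    simp only [hT]
    have mη := hηC.continuous.aestronglyMeasurable (μ := volume)
    have h1 : ∀ j, Tendsto (fun ε => eLpNorm (fun z => η z * (mo (p j) ε z - p j z)) 2) l (𝓝 0) :=
      fun j => tendsto_eLpNorm_bdd_mul hCη (hmot (hpL j))
    have h2 : ∀ j, Tendsto (fun ε => eLpNorm (fun z =>
        (-(η z * wder n j (fun w => (Φ w : ℂ)) z)) * (mo (w j) ε z - w j z)) 2) l (𝓝 0) :=
      fun j => tendsto_eLpNorm_bdd_mul (C := CΦ j) (fun z => by rw [norm_neg]; exact hCΦ j z)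
        (hmot (hw j))
    have m1 : ∀ j ε, AEStronglyMeasurable (fun z => η z * (mo (p j) ε z - p j z)) volume :=
      fun j ε => mη.mul ((hmom (hpL j) ε).sub (hpL j).1)
    have m2 : ∀ j ε, AEStronglyMeasurable (fun z =>
        (-(η z * wder n j (fun w => (Φ w : ℂ)) z)) * (mo (w j) ε z - w j z)) volume :=
      fun j ε => (mη.mul (hΦj j).aestronglyMeasurable).neg.mul ((hmom (hw j) ε).sub (hw j).1)
    refine tendsto_eLpNorm_sub_sum ?_ ?_
    · rintro (_ | j) ε
      · exact mη.neg.mul ((hmom hh ε).sub hh.1)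
      · exact (m1 j ε).add (m2 j ε)
    · rintro (_ | j)
      · exact tendsto_eLpNorm_bdd_mul (C := Cη) (fun z => by rw [norm_neg]; exact hCη z) (hmot hh)
      · have h3 := (h1 j).add (h2 j)
        rw [add_zero] at h3
        exact tendsto_of_tendsto_of_tendsto_of_le_of_le tendsto_const_nhds h3 (fun _ => zero_le)
          fun ε => eLpNorm_add_le (m1 j ε) (m2 j ε) (by norm_num)
  have hAm : ∀ ε, AEStronglyMeasurable (A ε) volume := by
    intro ε
    refine hηC.continuous.aestronglyMeasurable.mul (AEStronglyMeasurable.sub ?_ (hmom hh ε))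
    refine Finset.aestronglyMeasurable_fun_sum _ fun j _ => ?_
    exact (hmom (hpL j) ε).sub ((hΦj j).aestronglyMeasurable.mul (hmom (hw j) ε))
  have hηh : MemLp (fun z => -(η z * h z)) 2 := by
    refine hh.of_le_mul (c := Cη) (hηC.continuous.aestronglyMeasurable.mul hh.1).neg
      (ae_of_all _ fun t => ?_)
    rw [norm_neg, norm_mul]
    exact mul_le_mul_of_nonneg_right (hCη t) (norm_nonneg _)
  -- weights
  set q : (Fin n → ℂ) → ℝ := (tsupport η).indicator fun z => Real.exp (-Φ z) with hq
  obtain ⟨Cq, hCq⟩ : ∃ C, ∀ z, |q z| ≤ C := by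
    obtain ⟨C, hC⟩ := hηc.isCompact.exists_bound_of_continuousOn hE.continuousOn
    refine ⟨max C 0, fun z => ?_⟩
    by_cases hz : z ∈ tsupport η
    · rw [hq, indicator_of_mem hz]; exact (hC z hz).trans (le_max_left _ _)
    · rw [hq, indicator_of_notMem hz, abs_zero]; exact le_max_right _ _
  have hqm : AEStronglyMeasurable q volume :=
    hE.aestronglyMeasurable.indicator (isClosed_tsupport _).measurableSet
  have L2 := tendsto_integral_mul_norm_sq (.of_forall hAm) hηh hqm hCq hA
  have hGE : Continuous fun z => G z * Real.exp (-Φ z) := hG.mul hE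
  obtain ⟨CG, hCG⟩ := HasCompactSupport.exists_abs_le hGE hGc.mul_right
  have L1 := tendsto_integral_mul_sum_norm_sq (s := Finset.univ) (F := fun j => mo (w j))
    (fun j => hmom (hw j)) hw hGE.aestronglyMeasurable hCG fun j => hmot (hw j)
  have hdE : Continuous fun z => (∑ j, ‖wder n j (fun w => (η w : ℂ)) z‖ ^ 2) * Real.exp (-Φ z) :=
    (continuous_finsetSum _ fun j _ => (hηC.wder.continuous.norm.pow 2)).mul hE
  obtain ⟨Cd, hCd⟩ := HasCompactSupport.exists_abs_le hdE (by
    refine HasCompactSupport.mul_right (HasCompactSupport.intro hηCc.isCompact fun z hz => ?_)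
    simp [wder_eq_zero_of_notMem_tsupport hz])
  have L3 := tendsto_integral_mul_sum_norm_sq (s := Finset.univ) (F := fun j => mo (w j))
    (fun j => hmom (hw j)) hw hdE.aestronglyMeasurable hCd fun j => hmot (hw j)
  have key := le_of_tendsto_of_tendsto L1 ((L2.const_mul 2).add (L3.const_mul 4)) ?_
  · have e1 : (fun z => G z * (∑ j, ‖w j z‖ ^ 2) * Real.exp (-Φ z))
        = fun z => G z * Real.exp (-Φ z) * ∑ j, ‖w j z‖ ^ 2 := by ext z; ring
    have e2 : (fun z => η z ^ 2 * ‖h z‖ ^ 2 * Real.exp (-Φ z))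
        = fun z => q z * ‖-(η z * h z)‖ ^ 2 := by
      ext z
      rw [norm_neg, norm_mul, norm_real, mul_pow, Real.norm_eq_abs, sq_abs]
      by_cases hz : z ∈ tsupport η
      · rw [hq, indicator_of_mem hz]; ring
      · simp [image_eq_zero_of_notMem_tsupport hz]
    have e3 : (fun z => (∑ j, ‖wder n j (fun w => (η w : ℂ)) z‖ ^ 2) * (∑ j, ‖w j z‖ ^ 2)
          * Real.exp (-Φ z))
        = fun z => (∑ j, ‖wder n j (fun w => (η w : ℂ)) z‖ ^ 2) * Real.exp (-Φ z)
          * ∑ j, ‖w j z‖ ^ 2 := by ext z; ring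
    rw [e1, e2, e3]
    exact key
  · filter_upwards [hpos, hsmall] with ε hε hεV
    have := bochner_inequality_cutoff hΦ (w := fun j => mol n ε (w j))
      (fun j => contDiff_mol hε (hL (hw j))) hη hηc hG hGc hGH
      (fun z hz j k => wderBar_mol_comm hε (fun j => hL (hw j)) hcl (hεV z hz) j k)
    have e1 : (fun z => G z * (∑ j, ‖mol n ε (w j) z‖ ^ 2) * Real.exp (-Φ z))
        = fun z => G z * Real.exp (-Φ z) * ∑ j, ‖mo (w j) ε z‖ ^ 2 := by
      ext z; simp only [hmo hε]; ring
    have e2 : (fun z => η z ^ 2 * ‖∑ j, twDer n Φ j (mol n ε (w j)) z‖ ^ 2 * Real.exp (-Φ z))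
        = fun z => q z * ‖A ε z‖ ^ 2 := by
      ext z
      by_cases hz : z ∈ tsupport η
      · have h1 := twDer_mol_sum_eq hε (fun j => hL (hw j)) (fun j => hL (hpL j)) hth (hεV z hz)
        simp only [A, hmo hε, twDer, Finset.sum_sub_distrib, norm_mul, mul_pow, norm_real,
          Real.norm_eq_abs, sq_abs]
        rw [h1, hq, indicator_of_mem hz, sub_right_comm]
        ring
      · simp [A, image_eq_zero_of_notMem_tsupport hz]
    have e3 : (fun z => (∑ j, ‖wder n j (fun w => (η w : ℂ)) z‖ ^ 2)
          * (∑ j, ‖mol n ε (w j) z‖ ^ 2) * Real.exp (-Φ z))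
        = fun z => (∑ j, ‖wder n j (fun w => (η w : ℂ)) z‖ ^ 2) * Real.exp (-Φ z)
          * ∑ j, ‖mo (w j) ε z‖ ^ 2 := by ext z; simp only [hmo hε]; ring
    rw [e1, e2, e3] at this
    exact this

/-! ### Chain rule for complex Hessians -/

theorem differentiableAt_ofReal_comp {n : ℕ} {S : (Fin n → ℂ) → ℝ} {z : Fin n → ℂ}
    (hS : DifferentiableAt ℝ S z) : DifferentiableAt ℝ (fun v => (S v : ℂ)) z :=
  ofRealCLM.differentiableAt.comp z hS

theorem wder_ofReal_comp {n : ℕ} {j : Fin n} {g : ℝ → ℝ} {S : (Fin n → ℂ) → ℝ} {z : Fin n → ℂ}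
    (hg : DifferentiableAt ℝ g (S z)) (hS : DifferentiableAt ℝ S z) :
    wder n j (fun v => (g (S v) : ℂ)) z
      = ((deriv g (S z) : ℝ) : ℂ) * wder n j (fun v => (S v : ℂ)) z := by
  have h1 : HasFDerivAt (fun v => (S v : ℂ)) (ofRealCLM.comp (fderiv ℝ S z)) z :=
    ofRealCLM.hasFDerivAt.comp z hS.hasFDerivAt
  have h2 : HasFDerivAt (fun v => (g (S v) : ℂ)) (ofRealCLM.comp (deriv g (S z) • fderiv ℝ S z)) z :=
    ofRealCLM.hasFDerivAt.comp z (hg.hasDerivAt.comp_hasFDerivAt z hS.hasFDerivAt)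
  rw [wder, wder, h1.fderiv, h2.fderiv]
  simp only [ContinuousLinearMap.comp_apply, _root_.smul_apply, ofRealCLM_apply,
    smul_eq_mul, ofReal_mul]
  ring

theorem differentiableAt_wder {n : ℕ} {j : Fin n} {f : (Fin n → ℂ) → ℂ} {z : Fin n → ℂ}
    (hf : ContDiffAt ℝ 2 f z) : DifferentiableAt ℝ (wder n j f) z := by
  have h1 : ContDiffAt ℝ 1 (fderiv ℝ f) z := hf.fderiv_right (by norm_num)
  have h2 : ∀ v, DifferentiableAt ℝ (fun y => fderiv ℝ f y v) z := fun v =>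
    (h1.differentiableAt (by norm_num)).clm_apply (differentiableAt_const v)
  unfold wder
  exact ((h2 _).sub ((h2 _).const_mul _)).const_mul _

theorem ContDiffAt.ofReal_comp {n : ℕ} {k : WithTop ℕ∞} {Φ : (Fin n → ℂ) → ℝ} {z : Fin n → ℂ}
    (hΦ : ContDiffAt ℝ k Φ z) : ContDiffAt ℝ k (fun w => (Φ w : ℂ)) z :=
  ofRealCLM.contDiff.contDiffAt.comp z hΦ

theorem cHess_add {n : ℕ} {f g : (Fin n → ℂ) → ℝ} {z : Fin n → ℂ} (hf : ContDiffAt ℝ 2 f z)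
    (hg : ContDiffAt ℝ 2 g z) (j k : Fin n) :
    cHess n (fun v => f v + g v) z j k = cHess n f z j k + cHess n g z j k := by
  unfold cHess
  rw [← wderBar_add (differentiableAt_wder hf.ofReal_comp) (differentiableAt_wder hg.ofReal_comp)]
  refine wderBar_congr ?_
  filter_upwards [hf.eventually (by simp), hg.eventually (by simp)] with y hy hy'
  rw [← wder_add (hy.ofReal_comp.differentiableAt (by simp))
    (hy'.ofReal_comp.differentiableAt (by simp))]
  simp

theorem hermForm_add {n : ℕ} (H K : Fin n → Fin n → ℂ) (X : Fin n → ℂ) :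
    hermForm n (fun j k => H j k + K j k) X X = hermForm n H X X + hermForm n K X X := by
  simp only [hermForm, add_mul, Finset.sum_add_distrib, add_re]

theorem hermForm_cHess_add {n : ℕ} {f g : (Fin n → ℂ) → ℝ} {z : Fin n → ℂ}
    (hf : ContDiffAt ℝ 2 f z) (hg : ContDiffAt ℝ 2 g z) (X : Fin n → ℂ) :
    hermForm n (cHess n (fun v => f v + g v) z) X X
      = hermForm n (cHess n f z) X X + hermForm n (cHess n g z) X X := by
  rw [← hermForm_add]
  congr 1
  ext j k
  exact cHess_add hf hg j k

theorem hermForm_cHess_comp {n : ℕ} {g : ℝ → ℝ} {S : (Fin n → ℂ) → ℝ} {z : Fin n → ℂ}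
    (hg : ContDiffAt ℝ 2 g (S z)) (hS : ContDiffAt ℝ 2 S z) (X : Fin n → ℂ) :
    hermForm n (cHess n (fun v => g (S v)) z) X X
      = deriv g (S z) * hermForm n (cHess n S z) X X
        + deriv (deriv g) (S z) * ‖∑ j, wder n j (fun v => (S v : ℂ)) z * X j‖ ^ 2 := by
  have hgd : DifferentiableAt ℝ (deriv g) (S z) := by
    have h1 : ContDiffAt ℝ 1 (fderiv ℝ g) (S z) := hg.fderiv_right (by norm_num)
    have : deriv g = fun x => fderiv ℝ g x 1 := by ext x; simp
    rw [this]
    exact (h1.differentiableAt (by norm_num)).clm_apply (differentiableAt_const _)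
  have hSd : DifferentiableAt ℝ S z := hS.differentiableAt (by norm_num)
  have key : ∀ j k, cHess n (fun v => g (S v)) z j k
      = ((deriv g (S z) : ℝ) : ℂ) * cHess n S z j k + ((deriv (deriv g) (S z) : ℝ) : ℂ) *
        (wder n j (fun v => (S v : ℂ)) z * starRingEnd ℂ (wder n k (fun v => (S v : ℂ)) z)) := by
    intro j k
    have e : (fun w => wder n j (fun v => (g (S v) : ℂ)) w) =ᶠ[𝓝 z]
        fun w => ((deriv g (S w) : ℝ) : ℂ) * wder n j (fun v => (S v : ℂ)) w := by
      filter_upwards [hS.eventually (by simp),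
        hS.continuousAt.eventually (hg.eventually (by simp))] with y hy hy'
      exact wder_ofReal_comp (hy'.differentiableAt (by norm_num)) (hy.differentiableAt (by norm_num))
    rw [cHess, wderBar_congr e, wderBar_mul
      (differentiableAt_ofReal_comp (S := fun w => deriv g (S w)) (hgd.comp z hSd))
      (differentiableAt_wder hS.ofReal_comp), wderBar_ofReal k (fun w => deriv g (S w)), wder_ofReal_comp hgd hSd, cHess]
    simp only [map_mul, conj_ofReal]
    ring
  have e2 : (∑ j, wder n j (fun v => (S v : ℂ)) z * X j)
      * starRingEnd ℂ (∑ j, wder n j (fun v => (S v : ℂ)) z * X j)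
      = ∑ j, ∑ k, (wder n j (fun v => (S v : ℂ)) z * starRingEnd ℂ (wder n k (fun v => (S v : ℂ)) z))
        * X j * starRingEnd ℂ (X k) := by
    rw [map_sum, Finset.sum_mul_sum]
    refine Finset.sum_congr rfl fun j _ => Finset.sum_congr rfl fun k _ => ?_
    rw [map_mul]; ring
  have e3 : (((deriv g (S z)) * hermForm n (cHess n S z) X X
        + deriv (deriv g) (S z) * ‖∑ j, wder n j (fun v => (S v : ℂ)) z * X j‖ ^ 2 : ℝ))
      = (((deriv g (S z) : ℝ) : ℂ) * (∑ j, ∑ k, cHess n S z j k * X j * starRingEnd ℂ (X k))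
        + ((deriv (deriv g) (S z) : ℝ) : ℂ) * ((∑ j, wder n j (fun v => (S v : ℂ)) z * X j)
      * starRingEnd ℂ (∑ j, wder n j (fun v => (S v : ℂ)) z * X j))).re := by
    rw [add_re, re_ofReal_mul, re_ofReal_mul, hermForm, mul_conj, ofReal_re, normSq_eq_norm_sq]
  rw [e3, e2, hermForm]
  congr 1
  simp only [Finset.mul_sum, ← Finset.sum_add_distrib]
  refine Finset.sum_congr rfl fun j _ => Finset.sum_congr rfl fun k _ => ?_
  rw [key]; ring

theorem cHess_neg {n : ℕ} (f : (Fin n → ℂ) → ℝ) (z : Fin n → ℂ) (X : Fin n → ℂ) :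
    hermForm n (cHess n (fun v => -f v) z) X X = -hermForm n (cHess n f z) X X := by
  have h : ∀ j k, cHess n (fun v => -f v) z j k = - cHess n f z j k := by
    intro j k
    have e : ∀ j, (fun w => wder n j (fun v => ((-f v : ℝ) : ℂ)) w)
        = fun w => - wder n j (fun v => (f v : ℂ)) w := by
      intro j; ext w
      have : (fun v => ((-f v : ℝ) : ℂ)) = fun v => -(f v : ℂ) := by ext; simp
      simp only [wder, this, fderiv_fun_neg, _root_.neg_apply]; ring
    simp only [cHess, e, wderBar, fderiv_fun_neg, _root_.neg_apply]; ring
  simp only [hermForm, h, neg_mul, Finset.sum_neg_distrib, neg_re]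

theorem wder_coord {n : ℕ} (j k : Fin n) (p z : Fin n → ℂ) :
    wder n j (fun v => v k - p k) z = if j = k then 1 else 0 := by
  have : HasFDerivAt (fun v : Fin n → ℂ => v k - p k)
      (ContinuousLinearMap.proj (R := ℝ) (φ := fun _ : Fin n => ℂ) k) z :=
    (ContinuousLinearMap.proj (R := ℝ) (φ := fun _ : Fin n => ℂ) k).hasFDerivAt.sub_const _
  rw [wder, this.fderiv]
  by_cases h : j = k
  · subst h; simp; norm_num
  · simp [h, Ne.symm h]

theorem wderBar_coord {n : ℕ} (j k : Fin n) (p z : Fin n → ℂ) :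
    wderBar n j (fun v => v k - p k) z = 0 := by
  have : HasFDerivAt (fun v : Fin n → ℂ => v k - p k)
      (ContinuousLinearMap.proj (R := ℝ) (φ := fun _ : Fin n => ℂ) k) z :=
    (ContinuousLinearMap.proj (R := ℝ) (φ := fun _ : Fin n => ℂ) k).hasFDerivAt.sub_const _
  rw [wderBar, this.fderiv]
  by_cases h : j = k
  · subst h; simp
  · simp [Ne.symm h]

theorem wder_esq {n : ℕ} (j : Fin n) (p z : Fin n → ℂ) :
    wder n j (fun v => (esq (v - p) : ℂ)) z = starRingEnd ℂ (z j - p j) := by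
  have e : (fun v => (esq (v - p) : ℂ))
      = fun v => ∑ k, (v k - p k) * starRingEnd ℂ (v k - p k) := by
    ext v
    rw [esq, ofReal_sum]
    refine Finset.sum_congr rfl fun k _ => ?_
    rw [mul_conj, normSq_eq_norm_sq, Pi.sub_apply]
  have d1 : ∀ k, DifferentiableAt ℝ (fun v : Fin n → ℂ => v k - p k) z := fun k => by fun_prop
  have d2 : ∀ k, DifferentiableAt ℝ (fun v : Fin n → ℂ => starRingEnd ℂ (v k - p k)) z := fun k =>
    (conjCLE : ℂ →L[ℝ] ℂ).differentiableAt.comp z (d1 k)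
  rw [e, wder_sum fun k _ => (d1 k).fun_mul (d2 k)]
  simp only [wder_mul (d1 _) (d2 _), wder_coord, wder_conj, wderBar_coord]
  simp

theorem hermForm_cHess_esq {n : ℕ} (p z X : Fin n → ℂ) :
    hermForm n (cHess n (fun v => esq (v - p)) z) X X = ∑ j, ‖X j‖ ^ 2 := by
  have h : ∀ j k, cHess n (fun v => esq (v - p)) z j k = if k = j then 1 else 0 := by
    intro j k
    simp only [cHess, wder_esq]
    rw [wderBar_conj, wder_coord]
    split_ifs <;> simp
  simp only [hermForm, h, ite_mul, one_mul, zero_mul, Finset.sum_ite_eq', Finset.mem_univ, if_true,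
    mul_conj, normSq_eq_norm_sq, ← ofReal_sum, ofReal_re]

/-! ### The a priori estimate with a barrier weight -/

theorem continuous_indicator_of_compact {n : ℕ} {f : (Fin n → ℂ) → ℝ} {V K : Set (Fin n → ℂ)}
    (hf : Continuous f) (hV : IsOpen V) (hK : IsCompact K) (hKV : K ⊆ V)
    (h0 : ∀ z ∈ V, z ∉ K → f z = 0) : Continuous (V.indicator f) := by
  rw [continuous_iff_continuousAt]
  intro z
  by_cases hz : z ∈ V
  · exact hf.continuousAt.congr ((eqOn_indicator.eventuallyEq_of_mem (hV.mem_nhds hz)).symm)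
  · have : V.indicator f =ᶠ[𝓝 z] fun _ => 0 := by
      filter_upwards [hK.isClosed.isOpen_compl.mem_nhds fun h => hz (hKV h)] with y hy
      by_cases hyV : y ∈ V
      · rw [indicator_of_mem hyV, h0 y hyV hy]
      · exact indicator_of_notMem hyV _
    exact continuousAt_const.congr this.symm

theorem contDiff_indicator_of_compact {n : ℕ} {f : (Fin n → ℂ) → ℝ} {V K : Set (Fin n → ℂ)}
    (hf : ContDiff ℝ (⊤ : ℕ∞) f) (hV : IsOpen V) (hK : IsCompact K) (hKV : K ⊆ V)
    (h0 : ∀ z ∈ V, z ∉ K → f z = 0) : ContDiff ℝ (⊤ : ℕ∞) (V.indicator f) := by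
  rw [contDiff_iff_contDiffAt]
  intro z
  by_cases hz : z ∈ V
  · exact hf.contDiffAt.congr_of_eventuallyEq (eqOn_indicator.eventuallyEq_of_mem (hV.mem_nhds hz))
  · have : V.indicator f =ᶠ[𝓝 z] fun _ => 0 := by
      filter_upwards [hK.isClosed.isOpen_compl.mem_nhds fun h => hz (hKV h)] with y hy
      by_cases hyV : y ∈ V
      · rw [indicator_of_mem hyV, h0 y hyV hy]
      · exact indicator_of_notMem hyV _
    exact contDiffAt_const.congr_of_eventuallyEq this

theorem tsupport_indicator_subset {n : ℕ} {f : (Fin n → ℂ) → ℝ} {V K : Set (Fin n → ℂ)}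
    (hK : IsCompact K) (h0 : ∀ z ∈ V, z ∉ K → f z = 0) : tsupport (V.indicator f) ⊆ K := by
  refine closure_minimal (fun z hz => ?_) hK.isClosed
  by_contra hc
  refine hz ?_
  by_cases hzV : z ∈ V
  · rw [indicator_of_mem hzV, h0 z hzV hc]
  · exact indicator_of_notMem hzV _

theorem weak_bochner_local {n : ℕ} {Φ Φ' η G : (Fin n → ℂ) → ℝ} {V V' : Set (Fin n → ℂ)}
    {w : Fin n → (Fin n → ℂ) → ℂ} {d : (Fin n → ℂ) → ℂ}
    (hV' : IsOpen V') (hVV : V' ⊆ V) (hVb : Bornology.IsBounded V)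
    (hΦ : ContDiff ℝ (⊤ : ℕ∞) Φ') (hΦΦ : ∀ z ∈ V', Φ z = Φ' z)
    (hη : ContDiff ℝ (⊤ : ℕ∞) η) (hηc : HasCompactSupport η) (hηV : tsupport η ⊆ V')
    (hG : Continuous G) (hGc : HasCompactSupport G) (hGV : tsupport G ⊆ V')
    (hGH : ∀ z X, G z * ∑ j, ‖X j‖ ^ 2 ≤ η z ^ 2 * hermForm n (cHess n Φ' z) X X)
    (hw : ∀ j, MemLp (w j) 2 (volume.restrict V)) (hd : Continuous d)
    (hcl : ∀ j k κ, IsTestFun n κ V → ∫ z in V, (Real.exp (Φ z / 2) : ℂ) *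
      (w j z * wderBar n k κ z - w k z * wderBar n j κ z) = 0)
    (hth : ∀ κ, IsTestFun n κ V → ∫ z in V, (Real.exp (Φ z / 2) : ℂ) *
      ∑ j, w j z * (wder n j κ z + wder n j (fun w => (Φ w : ℂ)) z * κ z)
        = ∫ z in V, (Real.exp (Φ z) : ℂ) * d z * κ z) :
    ∫ z in V, G z * (∑ j, ‖w j z‖ ^ 2)
      ≤ 2 * (∫ z in V, η z ^ 2 * (‖d z‖ ^ 2 * Real.exp (Φ z)))
        + 4 * ∫ z in V, (∑ j, ‖wder n j (fun w => (η w : ℂ)) z‖ ^ 2) * (∑ j, ‖w j z‖ ^ 2) := by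
  have hV'b : Bornology.IsBounded V' := hVb.subset hVV
  have cΦ := hΦ.continuous
  -- multiplication by continuous functions preserves local square integrability
  have hbd : ∀ {b : (Fin n → ℂ) → ℝ} {g : (Fin n → ℂ) → ℂ}, Continuous b →
      MemLp g 2 (volume.restrict V') → MemLp (V'.indicator fun z => (b z : ℂ) * g z) 2 := by
    intro b g hb hg
    rw [memLp_indicator_iff_restrict hV'.measurableSet]
    obtain ⟨C, hC⟩ := (hV'b.isCompact_closure).exists_bound_of_continuousOn hb.continuousOn
    refine hg.of_le_mul (c := C)
      ((continuous_ofReal.comp hb).aestronglyMeasurable.mul hg.1) ?_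
    filter_upwards [ae_restrict_mem hV'.measurableSet] with z hz
    rw [norm_mul, norm_real]
    exact mul_le_mul_of_nonneg_right (hC z (subset_closure hz)) (norm_nonneg _)
  have hdm : MemLp d 2 (volume.restrict V') := by
    obtain ⟨C, hC⟩ := (hV'b.isCompact_closure).exists_bound_of_continuousOn hd.continuousOn
    have : IsFiniteMeasure (volume.restrict V') := ⟨by
      rw [Measure.restrict_apply_univ]; exact hV'b.measure_lt_top⟩
    refine MemLp.of_bound hd.aestronglyMeasurable C ?_
    filter_upwards [ae_restrict_mem hV'.measurableSet] with z hz using hC z (subset_closure hz)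
  set w' : Fin n → (Fin n → ℂ) → ℂ :=
    fun j => V'.indicator fun z => (Real.exp (Φ' z / 2) : ℂ) * w j z with hw'
  set h' : (Fin n → ℂ) → ℂ := V'.indicator fun z => (Real.exp (Φ' z) : ℂ) * d z with hh'
  have hw'm : ∀ j, MemLp (w' j) 2 := fun j =>
    hbd (by fun_prop) ((hw j).mono_measure (Measure.restrict_mono hVV le_rfl))
  have hh'm : MemLp h' 2 := hbd (by fun_prop) hdm
  have restr : ∀ {F F' : (Fin n → ℂ) → ℂ}, (∀ z ∈ V', F z = F' z) → (∀ z ∉ V', F z = 0) →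
      (∀ z ∉ V', F' z = 0) → ∫ z, F z = ∫ z in V, F' z := by
    intro F F' h1 h2 h3
    rw [← setIntegral_eq_integral_of_forall_compl_eq_zero
      (s := V) (f := F) fun z hz => h2 z fun h => hz (hVV h)]
    congr 1
    ext z
    by_cases hz : z ∈ V'
    · exact h1 z hz
    · rw [h2 z hz, h3 z hz]
  have restrR : ∀ {F F' : (Fin n → ℂ) → ℝ}, (∀ z ∈ V', F z = F' z) → (∀ z ∉ V', F z = 0) →
      (∀ z ∉ V', F' z = 0) → ∫ z, F z = ∫ z in V, F' z := by
    intro F F' h1 h2 h3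
    rw [← setIntegral_eq_integral_of_forall_compl_eq_zero
      (s := V) (f := F) fun z hz => h2 z fun h => hz (hVV h)]
    congr 1
    ext z
    by_cases hz : z ∈ V'
    · exact h1 z hz
    · rw [h2 z hz, h3 z hz]
  have key := weak_bochner hV' hV'b hΦ hη hηc hηV hG hGc hGH hw'm hh'm ?_ ?_
  · have ex : ∀ z, Real.exp (Φ' z / 2) ^ 2 * Real.exp (-Φ' z) = 1 := by
      intro z; rw [← Real.exp_nat_mul, ← Real.exp_add]; norm_num; ring
    have ex2 : ∀ z, Real.exp (Φ' z) ^ 2 * Real.exp (-Φ' z) = Real.exp (Φ' z) := by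
      intro z; rw [← Real.exp_nat_mul, ← Real.exp_add]; norm_num; ring
    have ew : ∀ z ∈ V', (∑ j, ‖w' j z‖ ^ 2) * Real.exp (-Φ' z) = ∑ j, ‖w j z‖ ^ 2 := by
      intro z hz
      simp only [hw', indicator_of_mem hz, norm_mul, mul_pow, norm_real, Real.norm_eq_abs, sq_abs,
        ← Finset.mul_sum]
      rw [mul_right_comm, ex, one_mul]
    have e1 := restrR (F := fun z => G z * (∑ j, ‖w' j z‖ ^ 2) * Real.exp (-Φ' z))
      (F' := fun z => G z * (∑ j, ‖w j z‖ ^ 2))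
      (fun z hz => by simp only [mul_assoc, ew z hz])
      (fun z hz => by simp [image_eq_zero_of_notMem_tsupport fun h => hz (hGV h)])
      (fun z hz => by simp [image_eq_zero_of_notMem_tsupport fun h => hz (hGV h)])
    have e2 := restrR (F := fun z => η z ^ 2 * ‖h' z‖ ^ 2 * Real.exp (-Φ' z))
      (F' := fun z => η z ^ 2 * (‖d z‖ ^ 2 * Real.exp (Φ z)))
      (fun z hz => by
        simp only [hh', indicator_of_mem hz, norm_mul, mul_pow, norm_real, Real.norm_eq_abs,
          sq_abs, hΦΦ z hz]
        rw [mul_assoc, mul_right_comm, ex2, mul_comm (Real.exp _)])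
      (fun z hz => by simp [image_eq_zero_of_notMem_tsupport fun h => hz (hηV h)])
      (fun z hz => by simp [image_eq_zero_of_notMem_tsupport fun h => hz (hηV h)])
    have hdη : ∀ z ∉ V', ∀ j, wder n j (fun w => (η w : ℂ)) z = 0 := fun z hz j =>
      wder_eq_zero_of_notMem_tsupport fun h =>
        hz (hηV (tsupport_comp_subset ofReal_zero (f := η) h))
    have e3 := restrR (F := fun z => (∑ j, ‖wder n j (fun w => (η w : ℂ)) z‖ ^ 2)
        * (∑ j, ‖w' j z‖ ^ 2) * Real.exp (-Φ' z))
      (F' := fun z => (∑ j, ‖wder n j (fun w => (η w : ℂ)) z‖ ^ 2) * (∑ j, ‖w j z‖ ^ 2))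
      (fun z hz => by simp only [mul_assoc, ew z hz])
      (fun z hz => by simp [hdη z hz])
      (fun z hz => by simp [hdη z hz])
    rw [← e1, ← e2, ← e3]
    exact key
  · intro j k κ hκ
    rw [← hcl j k κ ⟨hκ.1, hκ.2.1, hκ.2.2.trans hVV⟩]
    have hz0 : ∀ z ∉ V', ∀ j, wderBar n j κ z = 0 := fun z hz j =>
      wderBar_eq_zero_of_notMem_tsupport fun h => hz (hκ.2.2 h)
    refine restr (fun z hz => ?_) (fun z hz => ?_) (fun z hz => ?_)
    · simp only [hw', indicator_of_mem hz, hΦΦ z hz]; ring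
    · simp [hz0 z hz]
    · simp [hz0 z hz]
  · intro κ hκ
    have hz0 : ∀ z ∉ V', ∀ j, wder n j κ z = 0 := fun z hz j =>
      wder_eq_zero_of_notMem_tsupport fun h => hz (hκ.2.2 h)
    have hz1 : ∀ z ∉ V', κ z = 0 := fun z hz => image_eq_zero_of_notMem_tsupport
      fun h => hz (hκ.2.2 h)
    have e1 := hth κ ⟨hκ.1, hκ.2.1, hκ.2.2.trans hVV⟩
    have e2 := restr (F := fun z => h' z * κ z)
      (F' := fun z => (Real.exp (Φ z) : ℂ) * d z * κ z)
      (fun z hz => by simp only [hh', indicator_of_mem hz, hΦΦ z hz])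
      (fun z hz => by simp [hz1 z hz]) (fun z hz => by simp [hz1 z hz])
    rw [e2, ← e1]
    refine restr (fun z hz => ?_) (fun z hz => ?_) (fun z hz => ?_)
    · have : (fun w => (Φ w : ℂ)) =ᶠ[𝓝 z] fun w => (Φ' w : ℂ) := by
        filter_upwards [hV'.mem_nhds hz] with y hy
        rw [hΦΦ y hy]
      simp only [hw', indicator_of_mem hz, hΦΦ z hz, Finset.mul_sum, wder_congr this, mul_assoc]
    · simp [hz0 z hz, hz1 z hz]
    · simp [hz0 z hz, hz1 z hz]

/-! ### Profile functions -/

theorem exists_deriv_smoothTransition_bound : ∃ L, 0 ≤ L ∧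
    ∀ x, |deriv Real.smoothTransition x| ≤ L := by
  have hc : Continuous (deriv Real.smoothTransition) :=
    (Real.smoothTransition.contDiff (n := 1)).continuous_deriv le_rfl
  obtain ⟨C, hC⟩ := (isCompact_Icc (a := (0 : ℝ)) (b := 1)).exists_bound_of_continuousOn
    hc.continuousOn
  refine ⟨max C 0, le_max_right _ _, fun x => ?_⟩
  by_cases hx : x ∈ Icc (0 : ℝ) 1
  · exact (hC x hx).trans (le_max_left _ _)
  · have : deriv Real.smoothTransition x = 0 := by
      rcases not_and_or.1 hx with h | h
      · have : Real.smoothTransition =ᶠ[𝓝 x] fun _ => 0 := by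
          filter_upwards [Iio_mem_nhds (not_le.1 h)] with y hy
          exact Real.smoothTransition.zero_of_nonpos hy.le
        rw [this.deriv_eq]; simp
      · have : Real.smoothTransition =ᶠ[𝓝 x] fun _ => 1 := by
          filter_upwards [Ioi_mem_nhds (not_le.1 h)] with y hy
          exact Real.smoothTransition.one_of_one_le hy.le
        rw [this.deriv_eq]; simp
    rw [this, abs_zero]; exact le_max_right _ _

theorem deriv_smoothTransition_of_one_lt {x : ℝ} (h : 1 < x) :
    deriv Real.smoothTransition x = 0 := by
  have : Real.smoothTransition =ᶠ[𝓝 x] fun _ => 1 := by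
    filter_upwards [Ioi_mem_nhds h] with y hy
    exact Real.smoothTransition.one_of_one_le (le_of_lt hy)
  rw [this.deriv_eq]; simp

theorem exists_profile : ∃ P : ℝ → ℝ, ∃ L : ℝ, 0 ≤ L ∧ ContDiff ℝ (⊤ : ℕ∞) P ∧
    (∀ x, 1 ≤ x → P x = 1) ∧ (∀ x, 0 ≤ x → x ≤ 1 → x ≤ P x) ∧ (∀ x, 0 ≤ x → 0 ≤ P x) ∧
    (∀ x, 0 ≤ x → P x ≤ 2 * x) ∧ (∀ x, 0 ≤ x → P x ≤ 1) ∧ (∀ x, 0 ≤ x → |deriv P x| ≤ L) ∧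
    ∀ x, 1 < x → deriv P x = 0 := by
  set T := Real.smoothTransition with hT
  have hTs : ContDiff ℝ (⊤ : ℕ∞) T := Real.smoothTransition.contDiff
  set P : ℝ → ℝ := fun x => x + (1 - x) * T (2 * x - 1) with hP
  have hPs : ContDiff ℝ (⊤ : ℕ∞) P := by
    rw [hP]
    exact contDiff_id.add ((contDiff_const.sub contDiff_id).mul
      (hTs.comp ((contDiff_const.mul contDiff_id).sub contDiff_const)))
  have T0 : ∀ x, 0 ≤ T x := Real.smoothTransition.nonneg
  have T1 : ∀ x, T x ≤ 1 := Real.smoothTransition.le_one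
  have P1 : ∀ x, 1 ≤ x → P x = 1 := by
    intro x hx
    simp only [hP, hT, Real.smoothTransition.one_of_one_le (by linarith : 1 ≤ 2 * x - 1)]; ring
  have Pd : ∀ x, 1 < x → deriv P x = 0 := by
    intro x hx
    have : P =ᶠ[𝓝 x] fun _ => 1 := by
      filter_upwards [Ioi_mem_nhds hx] with y hy using P1 y (le_of_lt hy)
    rw [this.deriv_eq]; simp
  have P0 : ∀ x, 0 ≤ x → x ≤ 1 → x ≤ P x := fun x _ h1 =>
    le_add_of_nonneg_right (mul_nonneg (by linarith) (T0 _))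
  have Ple : ∀ x, 0 ≤ x → P x ≤ 1 := by
    intro x hx
    rcases le_total x 1 with h | h
    · have := mul_le_mul_of_nonneg_left (T1 (2 * x - 1)) (by linarith : 0 ≤ 1 - x)
      simp only [hP]; linarith
    · exact (P1 x h).le
  have hc : Continuous (deriv P) := (hPs.of_le (by simp : (1 : WithTop ℕ∞) ≤ _)).continuous_deriv le_rfl
  obtain ⟨C, hC⟩ := (isCompact_Icc (a := (0 : ℝ)) (b := 1)).exists_bound_of_continuousOn
    hc.continuousOn
  refine ⟨P, max C 0, le_max_right _ _, hPs, P1, P0, ?_, ?_, Ple, ?_, Pd⟩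
  · intro x hx
    rcases le_total x 1 with h | h
    · exact hx.trans (P0 x hx h)
    · rw [P1 x h]; norm_num
  · intro x hx
    rcases le_total x (1 / 2) with h | h
    · simp only [hP, hT, Real.smoothTransition.zero_of_nonpos (by linarith : 2 * x - 1 ≤ 0)]
      linarith
    · linarith [Ple x hx]
  · intro x hx
    rcases le_or_gt x 1 with h | h
    · exact (hC x ⟨hx, h⟩).trans (le_max_left _ _)
    · rw [Pd x h, abs_zero]; exact le_max_right _ _

theorem hasDerivAt_div_pow {a x : ℝ} (m : ℕ) (hx : 0 < x) :
    HasDerivAt (fun y => (a / y) ^ m) (-(m * (a / x) ^ m / x)) x := by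
  have h1 : HasDerivAt (fun y => a / y) (-a / x ^ 2) x := by
    have := (hasDerivAt_const x a).fun_div (hasDerivAt_id x) hx.ne'
    simpa using this
  have h2 := h1.fun_pow m
  refine h2.congr_deriv ?_
  rcases m with _ | m
  · simp
  · simp only [Nat.add_sub_cancel, pow_succ]
    field_simp

theorem deriv_deriv_div_pow {a x : ℝ} (m : ℕ) (hx : 0 < x) :
    deriv (deriv fun y => (a / y) ^ m) x = m * (m + 1) * (a / x) ^ m / x ^ 2 := by
  have e : deriv (fun y => (a / y) ^ m) =ᶠ[𝓝 x] fun y => -(m * (a / y) ^ m / y) := by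
    filter_upwards [lt_mem_nhds hx] with y hy using (hasDerivAt_div_pow m hy).deriv
  rw [e.deriv_eq]
  have h := (((hasDerivAt_div_pow (a := a) m hx).const_mul (m : ℝ)).fun_div
    (hasDerivAt_id x) hx.ne').fun_neg
  simp only [id] at h
  rw [h.deriv]
  field_simp
  ring

theorem exists_barrier {a t : ℝ} (m : ℕ) (ht : 0 < t) :
    ∃ g : ℝ → ℝ, ContDiff ℝ (⊤ : ℕ∞) g ∧ ∀ x, t / 2 < x → g x = (a / x) ^ m := by
  refine ⟨fun x => Real.smoothTransition (4 * x / t - 1) * (a / x) ^ m, ?_, fun x hx => ?_⟩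
  · rw [contDiff_iff_contDiffAt]
    intro x
    rcases lt_or_ge x (t / 4) with h | h
    · refine (contDiffAt_const (c := (0 : ℝ))).congr_of_eventuallyEq ?_
      filter_upwards [Iio_mem_nhds h] with y hy
      rw [Real.smoothTransition.zero_of_nonpos, zero_mul]
      rw [sub_nonpos, div_le_one ht]
      linarith [mem_Iio.1 hy]
    · refine (Real.smoothTransition.contDiff.contDiffAt.comp x (by fun_prop)).mul ?_
      exact (contDiffAt_const.div contDiffAt_id (by simp; linarith)).pow m
  · dsimp only
    rw [Real.smoothTransition.one_of_one_le, one_mul]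
    rw [le_sub_iff_add_le, le_div_iff₀ ht]
    linarith

theorem hermForm_cHess_barrier_ge {n m : ℕ} {a t c0 : ℝ} {g : ℝ → ℝ} {s φ : (Fin n → ℂ) → ℝ}
    {z X : Fin n → ℂ} (ha : 0 < a) (ht : 0 < t) (hg : ContDiff ℝ (⊤ : ℕ∞) g)
    (hgx : ∀ x, t / 2 < x → g x = (a / x) ^ m) (hs : ContDiff ℝ (⊤ : ℕ∞) s)
    (hφ : ContDiff ℝ (⊤ : ℕ∞) φ) (hz : t / 2 < s z)
    (hsH : c0 * ∑ j, ‖X j‖ ^ 2 ≤ -hermForm n (cHess n s z) X X)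
    (hφH : ∑ j, ‖X j‖ ^ 2 ≤ hermForm n (cHess n φ z) X X) :
    (1 + m * (a / s z) ^ m / s z * c0) * ∑ j, ‖X j‖ ^ 2
      ≤ hermForm n (cHess n (fun v => φ v + g (s v)) z) X X := by
  have hsz : 0 < s z := lt_trans (by positivity) hz
  have h2 : (2 : WithTop ℕ∞) ≤ ((⊤ : ℕ∞) : WithTop ℕ∞) :=
    WithTop.coe_le_coe.2 (le_top : ((2 : ℕ) : ℕ∞) ≤ ⊤)
  have hgs : ContDiff ℝ (⊤ : ℕ∞) fun v => g (s v) := hg.comp hs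
  rw [hermForm_cHess_add (hφ.of_le h2).contDiffAt (hgs.of_le h2).contDiffAt,
    hermForm_cHess_comp (hg.of_le h2).contDiffAt (hs.of_le h2).contDiffAt]
  have e : g =ᶠ[𝓝 (s z)] fun y => (a / y) ^ m := by
    filter_upwards [lt_mem_nhds hz] with y hy using hgx y hy
  rw [e.deriv_eq, e.deriv.deriv_eq, (hasDerivAt_div_pow m hsz).deriv, deriv_deriv_div_pow m hsz]
  have h3 : 0 ≤ m * (m + 1) * (a / s z) ^ m / s z ^ 2
      * ‖∑ j, wder n j (fun v => (s v : ℂ)) z * X j‖ ^ 2 := by positivity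
  have h4 : 0 ≤ m * (a / s z) ^ m / s z := by positivity
  nlinarith [mul_le_mul_of_nonneg_left hsH h4]

theorem barrier_weight_ge {m : ℕ} {a c0 x L B D P' P : ℝ} (ha : 0 < a) (hc0 : 0 ≤ c0) (hx : 0 < x)
    (hm : 1 ≤ m) (hmL : 4 * L ^ 2 * B / a ^ 2 + 1 ≤ c0 * m / a) (hD0 : 0 ≤ D) (hD : D ≤ B)
    (hPL : |P'| ≤ L)
    (hP0 : x ≤ a → x / a ≤ P) (hP1 : a < x → P = 1 ∧ P' = 0) :
    4 * ((P' / a) ^ 2 * D) + 1 ≤ (1 + m * (a / x) ^ m / x * c0) * P ^ 2 := by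
  rcases le_or_gt x a with h | h
  · have h1 : (x / a) ^ 2 ≤ P ^ 2 := pow_le_pow_left₀ (by positivity) (hP0 h) 2
    have h0 : 0 ≤ m * (a / x) ^ m / x * c0 := by positivity
    have h2 : a / x ≤ (a / x) ^ m := by
      have := pow_le_pow_right₀ ((one_le_div hx).2 h) hm
      simpa using this
    have h3 : c0 * m / a ≤ m * (a / x) ^ m / x * c0 * (x / a) ^ 2 := by
      have : m * (a / x) / x * c0 * (x / a) ^ 2 = c0 * m / a := by field_simp
      rw [← this]; gcongr
    have h4 : P' ^ 2 ≤ L ^ 2 := by rw [← sq_abs]; exact pow_le_pow_left₀ (abs_nonneg _) hPL 2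
    have h5 : 4 * ((P' / a) ^ 2 * D) ≤ 4 * L ^ 2 * B / a ^ 2 := by
      rw [div_pow]
      have : P' ^ 2 * D ≤ L ^ 2 * B := mul_le_mul h4 hD hD0 (sq_nonneg _)
      rw [show 4 * (P' ^ 2 / a ^ 2 * D) = 4 * (P' ^ 2 * D) / a ^ 2 by ring, mul_assoc]
      gcongr
    have h6 := mul_le_mul_of_nonneg_left h1 h0
    nlinarith [sq_nonneg P]
  · obtain ⟨rfl, rfl⟩ := hP1 h
    have : 0 ≤ m * (a / x) ^ m / x * c0 := by positivity
    simpa using this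

theorem cutoff_deriv_bound {a t x L LT : ℝ} {P : ℝ → ℝ} (ha : 0 < a) (ht : 0 < t) (hx : 0 ≤ x)
    (hPd : Differentiable ℝ P)
    (hP0 : ∀ x, 0 ≤ x → 0 ≤ P x) (hP2 : ∀ x, 0 ≤ x → P x ≤ 2 * x)
    (hPL : ∀ x, 0 ≤ x → |deriv P x| ≤ L) (hT : ∀ x, |deriv Real.smoothTransition x| ≤ LT) :
    |deriv (fun x => P (x / a) * Real.smoothTransition (x / t - 1)) x| ≤ L / a + 4 * LT / a := by
  have hTd : Differentiable ℝ Real.smoothTransition :=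
    (Real.smoothTransition.contDiff (n := 1)).differentiable (by simp)
  have h1 : HasDerivAt (fun x => P (x / a)) (deriv P (x / a) * (1 / a)) x :=
    (hPd (x / a)).hasDerivAt.comp x ((hasDerivAt_id x).div_const a)
  have h2 : HasDerivAt (fun x => Real.smoothTransition (x / t - 1))
      (deriv Real.smoothTransition (x / t - 1) * (1 / t)) x :=
    HasDerivAt.comp x (h₂ := Real.smoothTransition) (h := fun x => x / t - 1)
      (hTd (x / t - 1)).hasDerivAt (((hasDerivAt_id x).div_const t).sub_const 1)
  rw [(h1.fun_mul h2).deriv]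
  have hxa : 0 ≤ x / a := by positivity
  have hLT0 : 0 ≤ LT := (abs_nonneg _).trans (hT 0)
  have hL0 : 0 ≤ L := (abs_nonneg _).trans (hPL 0 le_rfl)
  refine (abs_add_le _ _).trans (add_le_add ?_ ?_)
  · rw [abs_mul, abs_mul, abs_of_nonneg (Real.smoothTransition.nonneg _),
      abs_of_pos (by positivity : 0 < 1 / a)]
    calc _ ≤ L * (1 / a) * 1 := by
          gcongr
          · exact Real.smoothTransition.nonneg _
          · exact hPL _ hxa
          · exact Real.smoothTransition.le_one _
      _ = L / a := by ring
  · rcases le_or_gt x (2 * t) with h | h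
    · rw [abs_mul, abs_mul, abs_of_nonneg (hP0 _ hxa), abs_of_pos (by positivity : 0 < 1 / t)]
      calc _ ≤ (2 * (x / a)) * (LT * (1 / t)) := by
            gcongr
            · exact hP2 _ hxa
            · exact hT _
        _ ≤ (2 * (2 * t / a)) * (LT * (1 / t)) := by gcongr
        _ = 4 * LT / a := by field_simp; ring
    · rw [deriv_smoothTransition_of_one_lt]
      · simp; positivity
      · rw [lt_sub_iff_add_lt, lt_div_iff₀ ht]; linarith

/-- The Bochner estimate for the cut-off at level `t` of the exhaustion `s`. -/
theorem barrier_estimate_level {n m : ℕ} {V : Set (Fin n → ℂ)} {s φ : (Fin n → ℂ) → ℝ}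
    {P : ℝ → ℝ} {a c0 t L B : ℝ} (hV : IsOpen V) (hVb : Bornology.IsBounded V)
    (hs : ContDiff ℝ (⊤ : ℕ∞) s) (hspos : ∀ z ∈ V, 0 < s z)
    (hK : ∀ t, 0 < t → IsCompact {z ∈ V | t ≤ s z})
    (ha : 0 < a) (hc0 : 0 ≤ c0) (ht : 0 < t)
    (hsH : ∀ z ∈ V, ∀ X, c0 * ∑ j, ‖X j‖ ^ 2 ≤ -hermForm n (cHess n s z) X X)
    (hφ : ContDiff ℝ (⊤ : ℕ∞) φ)
    (hφH : ∀ z ∈ V, ∀ X, ∑ j, ‖X j‖ ^ 2 ≤ hermForm n (cHess n φ z) X X)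
    (hB : ∀ z ∈ V, ∑ j, ‖wder n j (fun w => (s w : ℂ)) z‖ ^ 2 ≤ B)
    (hP : ContDiff ℝ (⊤ : ℕ∞) P) (hP1 : ∀ x, 1 < x → P x = 1)
    (hP0 : ∀ x, 0 ≤ x → x ≤ 1 → x ≤ P x) (hPL : ∀ x, 0 ≤ x → |deriv P x| ≤ L)
    (hPd : ∀ x, 1 < x → deriv P x = 0)
    (hm : 1 ≤ m) (hmL : 4 * L ^ 2 * B / a ^ 2 + 1 ≤ c0 * m / a)
    {w : Fin n → (Fin n → ℂ) → ℂ} {d : (Fin n → ℂ) → ℂ} {Φ : (Fin n → ℂ) → ℝ}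
    (hΦ : ∀ z, Φ z = φ z + (a / s z) ^ m)
    (hw : ∀ j, MemLp (w j) 2 (volume.restrict V)) (hd : Continuous d)
    (hcl : ∀ j k κ, IsTestFun n κ V → ∫ z in V, (Real.exp (Φ z / 2) : ℂ) *
      (w j z * wderBar n k κ z - w k z * wderBar n j κ z) = 0)
    (hth : ∀ κ, IsTestFun n κ V → ∫ z in V, (Real.exp (Φ z / 2) : ℂ) *
      ∑ j, w j z * (wder n j κ z + wder n j (fun w => (Φ w : ℂ)) z * κ z)
        = ∫ z in V, (Real.exp (Φ z) : ℂ) * d z * κ z) :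
    ∫ z in V, Real.smoothTransition (s z / t - 1) ^ 2 *
        (4 * ((deriv P (s z / a) / a) ^ 2 * ∑ j, ‖wder n j (fun w => (s w : ℂ)) z‖ ^ 2) + 1) *
        (∑ j, ‖w j z‖ ^ 2)
      ≤ 2 * (∫ z in V, (P (s z / a) * Real.smoothTransition (s z / t - 1)) ^ 2 *
          (‖d z‖ ^ 2 * Real.exp (Φ z)))
        + 4 * ∫ z in V, ((deriv (fun x => P (x / a) * Real.smoothTransition (x / t - 1)) (s z)) ^ 2 *
          ∑ j, ‖wder n j (fun w => (s w : ℂ)) z‖ ^ 2) * (∑ j, ‖w j z‖ ^ 2) := by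
  have hPc : Continuous (deriv P) :=
    (hP.of_le (by simp : (1 : WithTop ℕ∞) ≤ _)).continuous_deriv le_rfl
  set ζ : ℝ → ℝ := fun x => P (x / a) * Real.smoothTransition (x / t - 1) with hζ
  have hζs : ContDiff ℝ (⊤ : ℕ∞) ζ :=
    (hP.comp (contDiff_id.div_const a)).mul
      (Real.smoothTransition.contDiff.comp ((contDiff_id.div_const t).sub contDiff_const))
  set D : (Fin n → ℂ) → ℝ := fun z => ∑ j, ‖wder n j (fun w => (s w : ℂ)) z‖ ^ 2 with hD
  have hsc := hs.continuous
  have hDc : Continuous D := continuous_finsetSum _ fun j _ =>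
    ((ContDiff.wder (j := j) hs.ofReal_comp).continuous.norm.pow 2)
  set G : (Fin n → ℂ) → ℝ := fun z => Real.smoothTransition (s z / t - 1) ^ 2 *
    (4 * ((deriv P (s z / a) / a) ^ 2 * D z) + 1) with hG
  have hGc : Continuous G := by
    have h1 : Continuous fun z => Real.smoothTransition (s z / t - 1) :=
      Real.smoothTransition.continuous.comp (by fun_prop)
    have h2 : Continuous fun z => deriv P (s z / a) := hPc.comp (by fun_prop)
    exact (h1.pow 2).mul ((((h2.div_const a).pow 2).mul hDc).const_mul 4 |>.add continuous_const)
  set K : Set (Fin n → ℂ) := {z ∈ V | t ≤ s z} with hKdef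
  have hKc : IsCompact K := hK t ht
  have hKV : K ⊆ V := fun z hz => hz.1
  set V' : Set (Fin n → ℂ) := V ∩ s ⁻¹' Ioi (t / 2) with hV'
  have hV'o : IsOpen V' := hV.inter (isOpen_Ioi.preimage hsc)
  have hKV' : K ⊆ V' := fun z hz => ⟨hz.1, by have := hz.2; simp; linarith⟩
  have T0 : ∀ z ∈ V, z ∉ K → Real.smoothTransition (s z / t - 1) = 0 := by
    intro z hz hzK
    apply Real.smoothTransition.zero_of_nonpos
    have : s z < t := not_le.1 fun h => hzK ⟨hz, h⟩
    rw [sub_nonpos, div_le_one ht]; exact this.le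
  have hη0 : ∀ z ∈ V, z ∉ K → (ζ ∘ s) z = 0 := by
    intro z hz hzK; simp [hζ, T0 z hz hzK]
  have hG0 : ∀ z ∈ V, z ∉ K → G z = 0 := by
    intro z hz hzK; simp [hG, T0 z hz hzK]
  obtain ⟨g, hg, hgx⟩ := exists_barrier (a := a) m ht
  have key := weak_bochner_local (Φ := Φ) (Φ' := fun v => φ v + g (s v))
    (η := V.indicator (ζ ∘ s)) (G := V.indicator G) hV'o inter_subset_left hVb
    (hφ.add (hg.comp hs)) (fun z hz => by rw [hΦ, hgx _ hz.2])
    (contDiff_indicator_of_compact (hζs.comp hs) hV hKc hKV hη0)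
    (hKc.of_isClosed_subset (isClosed_tsupport _) (tsupport_indicator_subset hKc hη0))
    ((tsupport_indicator_subset hKc hη0).trans hKV')
    (continuous_indicator_of_compact hGc hV hKc hKV hG0)
    (hKc.of_isClosed_subset (isClosed_tsupport _) (tsupport_indicator_subset hKc hG0))
    ((tsupport_indicator_subset hKc hG0).trans hKV') ?_ hw hd hcl hth
  · have e1 : ∫ z in V, V.indicator G z * (∑ j, ‖w j z‖ ^ 2)
        = ∫ z in V, G z * (∑ j, ‖w j z‖ ^ 2) :=
      setIntegral_congr_fun hV.measurableSet fun z hz => by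
        simp only [indicator_of_mem hz]
    have e2 : ∫ z in V, V.indicator (ζ ∘ s) z ^ 2 * (‖d z‖ ^ 2 * Real.exp (Φ z))
        = ∫ z in V, (ζ (s z)) ^ 2 * (‖d z‖ ^ 2 * Real.exp (Φ z)) :=
      setIntegral_congr_fun hV.measurableSet fun z hz => by
        simp only [indicator_of_mem hz, Function.comp]
    have e3 : ∫ z in V, (∑ j, ‖wder n j (fun w => ((V.indicator (ζ ∘ s) w : ℝ) : ℂ)) z‖ ^ 2)
          * (∑ j, ‖w j z‖ ^ 2)
        = ∫ z in V, ((deriv ζ (s z)) ^ 2 * D z) * (∑ j, ‖w j z‖ ^ 2) :=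
      setIntegral_congr_fun hV.measurableSet fun z hz => by
        have : ∀ j, wder n j (fun w => ((V.indicator (ζ ∘ s) w : ℝ) : ℂ)) z
            = ((deriv ζ (s z) : ℝ) : ℂ) * wder n j (fun v => (s v : ℂ)) z := by
          intro j
          rw [← wder_ofReal_comp ((hζs.differentiable (by simp)) _)
            ((hs.differentiable (by simp)) _)]
          refine wder_congr ?_
          filter_upwards [hV.mem_nhds hz] with y hy
          rw [indicator_of_mem hy, Function.comp]
        simp only [this, norm_mul, mul_pow, norm_real, Real.norm_eq_abs, sq_abs, ← Finset.mul_sum,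
          hD]
    rw [e1, e2, e3] at key
    exact key
  · intro z X
    by_cases hzK : z ∈ K
    · have hz : z ∈ V := hKV hzK
      have hsz : 0 < s z := hspos z hz
      rw [indicator_of_mem hz, indicator_of_mem hz]
      have h1 := hermForm_cHess_barrier_ge (m := m) (X := X) ha ht hg hgx hs hφ (hKV' hzK).2
        (hsH z hz X) (hφH z hz X)
      have h2 := barrier_weight_ge (m := m) (L := L) (B := B) (D := D z) (P' := deriv P (s z / a))
        (P := P (s z / a)) ha hc0 hsz hm hmL (Finset.sum_nonneg fun j _ => by positivity) (hB z hz)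
        (hPL _ (by positivity)) (fun h => hP0 _ (by positivity) ((div_le_one ha).2 h))
        (fun h => ⟨hP1 _ ((one_lt_div ha).2 h), hPd _ ((one_lt_div ha).2 h)⟩)
      have hX : 0 ≤ ∑ j, ‖X j‖ ^ 2 := Finset.sum_nonneg fun j _ => by positivity
      set Tz := Real.smoothTransition (s z / t - 1)
      calc G z * ∑ j, ‖X j‖ ^ 2
          = Tz ^ 2 * ((4 * ((deriv P (s z / a) / a) ^ 2 * D z) + 1) * ∑ j, ‖X j‖ ^ 2) := by
            simp only [hG]; ring
        _ ≤ Tz ^ 2 * (((1 + m * (a / s z) ^ m / s z * c0) * P (s z / a) ^ 2)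
              * ∑ j, ‖X j‖ ^ 2) := by gcongr
        _ = (ζ ∘ s) z ^ 2 * ((1 + m * (a / s z) ^ m / s z * c0) * ∑ j, ‖X j‖ ^ 2) := by
            simp only [hζ, Function.comp]; ring
        _ ≤ _ := by gcongr
    · have h1 : V.indicator G z = 0 := image_eq_zero_of_notMem_tsupport fun h =>
        hzK (tsupport_indicator_subset hKc hG0 h)
      have h2 : V.indicator (ζ ∘ s) z = 0 := image_eq_zero_of_notMem_tsupport fun h =>
        hzK (tsupport_indicator_subset hKc hη0 h)
      rw [h1, h2]; simp

theorem tendsto_setIntegral_of_eventually_eq {n : ℕ} {V : Set (Fin n → ℂ)}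
    {F : ℕ → (Fin n → ℂ) → ℝ} {f W : (Fin n → ℂ) → ℝ} {C : ℝ} (hV : MeasurableSet V)
    (hF : ∀ k, Measurable (F k)) (hW : Integrable W (volume.restrict V)) (hW0 : ∀ z, 0 ≤ W z)
    (hC : ∀ k, ∀ z ∈ V, |F k z| ≤ C) (hf : ∀ z ∈ V, ∀ᶠ k in atTop, F k z = f z) :
    Tendsto (fun k => ∫ z in V, F k z * W z) atTop (𝓝 (∫ z in V, f z * W z)) := by
  refine tendsto_integral_of_dominated_convergence (fun z => C * W z)
    (fun k => (hF k).aestronglyMeasurable.mul hW.1) (hW.const_mul C) (fun k => ?_) ?_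
  · filter_upwards [ae_restrict_mem hV] with z hz
    rw [Real.norm_eq_abs, abs_mul, abs_of_nonneg (hW0 z)]
    exact mul_le_mul_of_nonneg_right (hC k z hz) (hW0 z)
  · filter_upwards [ae_restrict_mem hV] with z hz
    refine tendsto_const_nhds.congr' ?_
    filter_upwards [hf z hz] with k hk
    rw [hk]

theorem barrier_estimate {n : ℕ} {V : Set (Fin n → ℂ)} {s φ : (Fin n → ℂ) → ℝ} {a c0 : ℝ}
    (hV : IsOpen V) (hVb : Bornology.IsBounded V)
    (hs : ContDiff ℝ (⊤ : ℕ∞) s) (hspos : ∀ z ∈ V, 0 < s z)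
    (hK : ∀ t, 0 < t → IsCompact {z ∈ V | t ≤ s z}) (ha : 0 < a) (hc0 : 0 < c0)
    (hsH : ∀ z ∈ V, ∀ X, c0 * ∑ j, ‖X j‖ ^ 2 ≤ -hermForm n (cHess n s z) X X)
    (hφ : ContDiff ℝ (⊤ : ℕ∞) φ)
    (hφH : ∀ z ∈ V, ∀ X, ∑ j, ‖X j‖ ^ 2 ≤ hermForm n (cHess n φ z) X X) :
    ∃ m : ℕ, ∀ (Φ : (Fin n → ℂ) → ℝ), (∀ z, Φ z = φ z + (a / s z) ^ m) →
      ∀ (w : Fin n → (Fin n → ℂ) → ℂ) (d : (Fin n → ℂ) → ℂ),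
      (∀ j, MemLp (w j) 2 (volume.restrict V)) → Continuous d → HasCompactSupport d →
      tsupport d ⊆ V →
      (∀ j k κ, IsTestFun n κ V → ∫ z in V, (Real.exp (Φ z / 2) : ℂ) *
        (w j z * wderBar n k κ z - w k z * wderBar n j κ z) = 0) →
      (∀ κ, IsTestFun n κ V → ∫ z in V, (Real.exp (Φ z / 2) : ℂ) *
        ∑ j, w j z * (wder n j κ z + wder n j (fun w => (Φ w : ℂ)) z * κ z)
          = ∫ z in V, (Real.exp (Φ z) : ℂ) * d z * κ z) →
      ∫ z in V, ∑ j, ‖w j z‖ ^ 2 ≤ 2 * ∫ z in V, ‖d z‖ ^ 2 * Real.exp (Φ z) := by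
  obtain ⟨P, L, hL, hP, hP1, hP01, hPnn, hP2, hPle, hPL, hPd⟩ := exists_profile
  obtain ⟨LT, hLT, hT⟩ := exists_deriv_smoothTransition_bound
  have hPc : Continuous (deriv P) :=
    (hP.of_le (by simp : (1 : WithTop ℕ∞) ≤ _)).continuous_deriv le_rfl
  have hsc := hs.continuous
  set D : (Fin n → ℂ) → ℝ := fun z => ∑ j, ‖wder n j (fun w => (s w : ℂ)) z‖ ^ 2 with hD
  have hDc : Continuous D := continuous_finsetSum _ fun j _ =>
    ((ContDiff.wder (j := j) hs.ofReal_comp).continuous.norm.pow 2)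
  have hD0 : ∀ z, 0 ≤ D z := fun z => Finset.sum_nonneg fun j _ => by positivity
  obtain ⟨B, hB⟩ := (hVb.isCompact_closure).exists_bound_of_continuousOn hDc.continuousOn
  replace hB : ∀ z ∈ V, D z ≤ B := fun z hz => (le_abs_self _).trans (hB z (subset_closure hz))
  rcases V.eq_empty_or_nonempty with rfl | ⟨z1, hz1⟩
  · exact ⟨0, fun _ _ _ _ _ _ _ _ _ _ => by simp⟩
  have hB0 : 0 ≤ B := (hD0 z1).trans (hB z1 hz1)
  obtain ⟨m, hm⟩ := exists_nat_ge (max 1 ((4 * L ^ 2 * B / a ^ 2 + 1) * a / c0))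
  have hm1 : 1 ≤ m := by exact_mod_cast (le_max_left _ _).trans hm
  have hmL : 4 * L ^ 2 * B / a ^ 2 + 1 ≤ c0 * m / a := by
    have := (le_max_right _ _).trans hm
    rw [div_le_iff₀ hc0] at this
    rw [le_div_iff₀ ha]; linarith
  refine ⟨m, fun Φ hΦ w d hw hd hdc hdV hcl hth => ?_⟩
  set W : (Fin n → ℂ) → ℝ := fun z => ∑ j, ‖w j z‖ ^ 2 with hWdef
  have hWi : Integrable W (volume.restrict V) := integrable_finsetSum _ fun j _ =>
    (hw j).norm.integrable_sq
  have hW0 : ∀ z, 0 ≤ W z := fun z => Finset.sum_nonneg fun j _ => by positivity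
  -- integrability of the right-hand side
  have hsm := hsc.measurable
  have hΦm : Measurable Φ := by
    have : Φ = fun z => φ z + (a / s z) ^ m := funext hΦ
    rw [this]
    exact hφ.continuous.measurable.add ((measurable_const.div hsm).pow_const m)
  have hRi : Integrable (fun z => ‖d z‖ ^ 2 * Real.exp (Φ z)) (volume.restrict V) := by
    have h1 : ContinuousOn (fun z => ‖d z‖ ^ 2 * Real.exp (Φ z)) (tsupport d) := by
      have : Φ = fun z => φ z + (a / s z) ^ m := funext hΦ
      rw [this]
      refine (hd.norm.pow 2).continuousOn.mul (Real.continuous_exp.comp_continuousOn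
        (hφ.continuous.continuousOn.add ((continuousOn_const.div hsc.continuousOn ?_).pow m)))
      exact fun z hz => (hspos z (hdV hz)).ne'
    have h2 := h1.integrableOn_compact hdc (μ := volume)
    rw [integrableOn_iff_integrable_of_support_subset] at h2
    · exact h2.integrableOn
    · intro z hz
      by_contra h
      exact hz (by simp [image_eq_zero_of_notMem_tsupport h])
  have hRR : ∀ t : ℝ, 0 < t → ∫ z in V, (P (s z / a) * Real.smoothTransition (s z / t - 1)) ^ 2 *
      (‖d z‖ ^ 2 * Real.exp (Φ z)) ≤ ∫ z in V, ‖d z‖ ^ 2 * Real.exp (Φ z) := by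
    intro t ht
    refine integral_mono_of_nonneg (ae_of_all _ fun z => by positivity) hRi ?_
    filter_upwards [ae_restrict_mem hV.measurableSet] with z hz
    have hsa : 0 ≤ s z / a := div_nonneg (hspos z hz).le ha.le
    have h0 : 0 ≤ P (s z / a) * Real.smoothTransition (s z / t - 1) :=
      mul_nonneg (hPnn _ hsa) (Real.smoothTransition.nonneg _)
    have h1 : P (s z / a) * Real.smoothTransition (s z / t - 1) ≤ 1 :=
      mul_le_one₀ (hPle _ hsa) (Real.smoothTransition.nonneg _) (Real.smoothTransition.le_one _)
    exact mul_le_of_le_one_left (by positivity) (pow_le_one₀ h0 h1)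
  have est := fun t ht => barrier_estimate_level (t := t) hV hVb hs hspos hK ha hc0.le ht hsH hφ
    hφH hB hP (fun x hx => hP1 x hx.le) hP01 hPL hPd hm1 hmL hΦ hw hd hcl hth
  set τ : ℕ → ℝ := fun k => 1 / ((k : ℝ) + 1) with hτ
  have hτ0 : ∀ k, 0 < τ k := fun k => by positivity
  have hτt : Tendsto τ atTop (𝓝 0) := tendsto_one_div_add_atTop_nhds_zero_nat
  have hev : ∀ z ∈ V, ∀ᶠ k in atTop, 2 * τ k < s z := by
    intro z hz
    have := hτt.const_mul 2
    rw [mul_zero] at this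
    exact this.eventually (gt_mem_nhds (hspos z hz))
  have hT1 : ∀ t x, 0 < t → 2 * t < x → Real.smoothTransition (x / t - 1) = 1 := by
    intro t x ht hx
    apply Real.smoothTransition.one_of_one_le
    rw [le_sub_iff_add_le, le_div_iff₀ ht]; linarith
  have hPm : Measurable fun z => deriv P (s z / a) := hPc.measurable.comp (hsm.div_const a)
  set R : (Fin n → ℂ) → ℝ := fun z => (deriv P (s z / a) / a) ^ 2 * D z with hR
  have hRm : Measurable R := ((hPm.div_const a).pow_const 2).mul hDc.measurable
  have hR0 : ∀ z, 0 ≤ R z := fun z => mul_nonneg (sq_nonneg _) (hD0 z)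
  have hRB : ∀ z ∈ V, R z ≤ (L / a) ^ 2 * B := by
    intro z hz
    refine mul_le_mul ?_ (hB z hz) (hD0 z) (sq_nonneg _)
    rw [← sq_abs, abs_div, abs_of_pos ha]
    have := hPL (s z / a) (div_nonneg (hspos z hz).le ha.le)
    gcongr
  have lim1 : Tendsto (fun k => ∫ z in V, Real.smoothTransition (s z / τ k - 1) ^ 2 *
        (4 * R z + 1) * W z) atTop (𝓝 (∫ z in V, (4 * R z + 1) * W z)) := by
    refine tendsto_setIntegral_of_eventually_eq (C := 4 * ((L / a) ^ 2 * B) + 1) hV.measurableSet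
      (fun k => ?_) hWi hW0 ?_ ?_
    · exact ((Real.smoothTransition.continuous.measurable.comp
        ((hsm.div_const _).sub_const 1)).pow_const 2).mul ((hRm.const_mul 4).add_const 1)
    · intro k z hz
      have h1 := hR0 z
      rw [abs_of_nonneg (by positivity)]
      refine (mul_le_of_le_one_left (by positivity) (pow_le_one₀
        (Real.smoothTransition.nonneg _) (Real.smoothTransition.le_one _))).trans ?_
      linarith [hRB z hz]
    · intro z hz
      filter_upwards [hev z hz] with k hk
      rw [hT1 _ _ (hτ0 k) hk]; ring
  have lim2 : Tendsto (fun k => ∫ z in V,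
        ((deriv (fun x => P (x / a) * Real.smoothTransition (x / τ k - 1)) (s z)) ^ 2 * D z) * W z)
      atTop (𝓝 (∫ z in V, R z * W z)) := by
    refine tendsto_setIntegral_of_eventually_eq (C := (L / a + 4 * LT / a) ^ 2 * B)
      hV.measurableSet (fun k => ?_) hWi hW0 ?_ ?_
    · exact (((measurable_deriv _).comp hsm).pow_const 2).mul hDc.measurable
    · intro k z hz
      rw [abs_of_nonneg (mul_nonneg (sq_nonneg _) (hD0 z))]
      refine mul_le_mul ?_ (hB z hz) (hD0 z) (sq_nonneg _)
      rw [← sq_abs]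
      exact pow_le_pow_left₀ (abs_nonneg _) (cutoff_deriv_bound ha (hτ0 k) (hspos z hz).le
        (hP.differentiable (by simp)) hPnn hP2 hPL hT) 2
    · intro z hz
      filter_upwards [hev z hz] with k hk
      have e : (fun x => P (x / a) * Real.smoothTransition (x / τ k - 1))
          =ᶠ[𝓝 (s z)] fun x => P (x / a) := by
        filter_upwards [lt_mem_nhds hk] with x hx
        rw [hT1 _ _ (hτ0 k) hx, mul_one]
      have h1 : HasDerivAt (fun x => P (x / a)) (deriv P (s z / a) * (1 / a)) (s z) :=
        HasDerivAt.comp (s z) (h₂ := P) (h := fun x => x / a)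
          ((hP.differentiable (by simp)) (s z / a)).hasDerivAt
          ((hasDerivAt_id (s z)).div_const a)
      rw [e.deriv_eq, h1.deriv, hR]
      simp only [mul_one_div]
  have fin := le_of_tendsto_of_tendsto' lim1
    ((lim2.const_mul 4).const_add (2 * ∫ z in V, ‖d z‖ ^ 2 * Real.exp (Φ z)))
    fun k => (est _ (hτ0 k)).trans (add_le_add_left (mul_le_mul_of_nonneg_left (hRR _ (hτ0 k))
      zero_le_two) _)
  have hRWi : Integrable (fun z => R z * W z) (volume.restrict V) := by
    refine (hWi.const_mul ((L / a) ^ 2 * B)).mono' (hRm.aestronglyMeasurable.mul hWi.1) ?_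
    filter_upwards [ae_restrict_mem hV.measurableSet] with z hz
    rw [Real.norm_eq_abs, abs_of_nonneg (mul_nonneg (hR0 z) (hW0 z))]
    exact mul_le_mul_of_nonneg_right (hRB z hz) (hW0 z)
  have e : ∫ z in V, (4 * R z + 1) * W z = 4 * (∫ z in V, R z * W z) + ∫ z in V, W z := by
    rw [← integral_const_mul, ← integral_add (hRWi.const_mul 4) hWi]
    congr 1; ext z; ring
  linarith

/-! ### Hilbert space tools in concrete form -/

theorem exists_inner_orthogonal_part {H : Type*} [NormedAddCommGroup H] [InnerProductSpace ℂ H]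
    [CompleteSpace H] (S : Set H) (b : H) :
    ∃ w : H, (∀ s ∈ S, inner ℂ s w = 0) ∧
      ∀ α, (∀ s ∈ S, inner ℂ s α = 0) → inner ℂ α w = inner ℂ α b := by
  let M : Submodule ℂ H := Submodule.span ℂ S
  have mem : ∀ α, (∀ s ∈ S, inner ℂ s α = 0) → α ∈ Mᗮ := by
    intro α h
    rw [Submodule.mem_orthogonal]
    intro u hu
    induction hu using Submodule.span_induction with
    | mem x hx => exact h x hx
    | zero => simp
    | add x y _ _ hx hy => rw [inner_add_left, hx, hy, add_zero]
    | smul a x _ hx => rw [inner_smul_left, hx, mul_zero]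
  refine ⟨(Mᗮ).starProjection b, fun s hs => ?_, fun α h => ?_⟩
  · exact (Submodule.mem_orthogonal _ _).1 (Submodule.starProjection_apply_mem _ _) _
      (Submodule.subset_span hs)
  · rw [← sub_eq_zero, ← inner_sub_right]
    have h1 : (Mᗮ).starProjection b - b ∈ (Mᗮ)ᗮ := by
      have := Submodule.sub_starProjection_mem_orthogonal (K := Mᗮ) b
      rw [← neg_sub]
      exact neg_mem this
    exact (Submodule.mem_orthogonal _ _).1 h1 _ (mem α h)

section

variable {n : ℕ} {X : Type*} [MeasurableSpace X] {μ : Measure X}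

/-- The element of the direct sum of `n` copies of `L²` given by square integrable functions. -/
noncomputable def toPiLp {f : Fin n → X → ℂ} (hf : ∀ j, MemLp (f j) 2 μ) :
    PiLp 2 (fun _ : Fin n => Lp ℂ 2 μ) :=
  WithLp.toLp 2 fun j => (hf j).toLp (f j)

theorem inner_toPiLp {f g : Fin n → X → ℂ} (hf : ∀ j, MemLp (f j) 2 μ)
    (hg : ∀ j, MemLp (g j) 2 μ) :
    inner ℂ (toPiLp hf) (toPiLp hg) = ∫ x, ∑ j, starRingEnd ℂ (f j x) * g j x ∂μ := by
  have e : ∀ j, (fun x => inner ℂ (((hf j).toLp (f j) : X → ℂ) x) (((hg j).toLp (g j) : X → ℂ) x))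
      =ᵐ[μ] fun x => starRingEnd ℂ (f j x) * g j x := by
    intro j
    filter_upwards [(hf j).coeFn_toLp, (hg j).coeFn_toLp] with x h1 h2
    rw [h1, h2, RCLike.inner_apply, mul_comm]
  rw [PiLp.inner_apply, integral_finsetSum _ fun j _ =>
    (L2.integrable_inner ((hf j).toLp (f j)) ((hg j).toLp (g j))).congr (e j)]
  refine Finset.sum_congr rfl fun j _ => ?_
  rw [← integral_congr_ae (e j), ← L2.inner_def]
  rfl

theorem norm_toPiLp_sq {f : Fin n → X → ℂ} (hf : ∀ j, MemLp (f j) 2 μ) :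
    ‖toPiLp hf‖ ^ 2 = ∫ x, ∑ j, ‖f j x‖ ^ 2 ∂μ := by
  have h := inner_toPiLp hf hf
  rw [inner_self_eq_norm_sq_to_K] at h
  have e : (fun x => ∑ j, starRingEnd ℂ (f j x) * f j x)
      = fun x => ((∑ j, ‖f j x‖ ^ 2 : ℝ) : ℂ) := by
    ext x
    rw [ofReal_sum]
    refine Finset.sum_congr rfl fun j _ => ?_
    rw [mul_comm, mul_conj, normSq_eq_norm_sq]
  rw [e, integral_complex_ofReal] at h
  exact ofReal_injective (by rw [← h]; push_cast; rfl)

theorem norm_integral_sum_conj_mul_sq_le {f g : Fin n → X → ℂ} (hf : ∀ j, MemLp (f j) 2 μ)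
    (hg : ∀ j, MemLp (g j) 2 μ) :
    ‖∫ x, ∑ j, starRingEnd ℂ (f j x) * g j x ∂μ‖ ^ 2
      ≤ (∫ x, ∑ j, ‖f j x‖ ^ 2 ∂μ) * ∫ x, ∑ j, ‖g j x‖ ^ 2 ∂μ := by
  rw [← inner_toPiLp hf hg, ← norm_toPiLp_sq hf, ← norm_toPiLp_sq hg, ← mul_pow]
  exact pow_le_pow_left₀ (norm_nonneg _) (norm_inner_le_norm _ _) 2

theorem exists_toPiLp (x : PiLp 2 (fun _ : Fin n => Lp ℂ 2 μ)) :
    ∃ f : Fin n → X → ℂ, ∃ hf : ∀ j, MemLp (f j) 2 μ, toPiLp hf = x :=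
  ⟨fun j => x j, fun j => Lp.memLp (x j), by
    ext1 j; exact Lp.toLp_coeFn (x j) (Lp.memLp (x j))⟩

theorem exists_orthogonal_part (S : Set (Fin n → X → ℂ)) (hS : ∀ f ∈ S, ∀ j, MemLp (f j) 2 μ)
    {b : Fin n → X → ℂ} (hb : ∀ j, MemLp (b j) 2 μ) :
    ∃ w : Fin n → X → ℂ, (∀ j, MemLp (w j) 2 μ) ∧
      (∀ f ∈ S, ∫ x, ∑ j, starRingEnd ℂ (f j x) * w j x ∂μ = 0) ∧
      ∀ α : Fin n → X → ℂ, (∀ j, MemLp (α j) 2 μ) →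
        (∀ f ∈ S, ∫ x, ∑ j, starRingEnd ℂ (f j x) * α j x ∂μ = 0) →
        ∫ x, ∑ j, starRingEnd ℂ (α j x) * w j x ∂μ
          = ∫ x, ∑ j, starRingEnd ℂ (α j x) * b j x ∂μ := by
  obtain ⟨w', h1, h2⟩ := exists_inner_orthogonal_part
    {x | ∃ f, ∃ h : f ∈ S, x = toPiLp (hS f h)} (toPiLp hb)
  obtain ⟨w, hw, rfl⟩ := exists_toPiLp w'
  refine ⟨w, hw, fun f hf => ?_, fun α hα h => ?_⟩
  · rw [← inner_toPiLp (hS f hf) hw]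
    exact h1 _ ⟨f, hf, rfl⟩
  · rw [← inner_toPiLp hα hw, ← inner_toPiLp hα hb]
    refine h2 _ ?_
    rintro _ ⟨f, hf, rfl⟩
    rw [inner_toPiLp, h f hf]

end

theorem continuous_mul_of_tsupport {n : ℕ} {V : Set (Fin n → ℂ)} {b g : (Fin n → ℂ) → ℂ}
    (hV : IsOpen V) (hb : ContinuousOn b V) (hg : Continuous g) (hgV : tsupport g ⊆ V) :
    Continuous fun z => b z * g z := by
  rw [continuous_iff_continuousAt]
  intro z
  by_cases hz : z ∈ tsupport g
  · exact (hb.continuousAt (hV.mem_nhds (hgV hz))).mul hg.continuousAt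
  · refine (continuousAt_const (y := (0 : ℂ))).congr ?_
    filter_upwards [(isClosed_tsupport g).isOpen_compl.mem_nhds hz] with y hy
    rw [image_eq_zero_of_notMem_tsupport hy, mul_zero]

theorem memLp_mul_of_tsupport {n : ℕ} {V : Set (Fin n → ℂ)} {b g : (Fin n → ℂ) → ℂ}
    (hV : IsOpen V) (hb : ContinuousOn b V) (hg : Continuous g) (hgc : HasCompactSupport g)
    (hgV : tsupport g ⊆ V) {μ : Measure (Fin n → ℂ)} [IsFiniteMeasureOnCompacts μ] :
    MemLp (fun z => b z * g z) 2 μ :=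
  (continuous_mul_of_tsupport hV hb hg hgV).memLp_of_hasCompactSupport hgc.mul_left

theorem dual_estimate {n : ℕ} {V : Set (Fin n → ℂ)} {s φ : (Fin n → ℂ) → ℝ} {a c0 : ℝ}
    (hV : IsOpen V) (hVb : Bornology.IsBounded V)
    (hs : ContDiff ℝ (⊤ : ℕ∞) s) (hspos : ∀ z ∈ V, 0 < s z)
    (hK : ∀ t, 0 < t → IsCompact {z ∈ V | t ≤ s z}) (ha : 0 < a) (hc0 : 0 < c0)
    (hsH : ∀ z ∈ V, ∀ X, c0 * ∑ j, ‖X j‖ ^ 2 ≤ -hermForm n (cHess n s z) X X)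
    (hφ : ContDiff ℝ (⊤ : ℕ∞) φ)
    (hφH : ∀ z ∈ V, ∀ X, ∑ j, ‖X j‖ ^ 2 ≤ hermForm n (cHess n φ z) X X)
    {α γ : Fin n → (Fin n → ℂ) → ℂ} (hα : ∀ j, MemLp (α j) 2 (volume.restrict V))
    (hαcl : ∀ j k κ, IsTestFun n κ V →
      ∫ z in V, (α j z * wderBar n k κ z - α k z * wderBar n j κ z) = 0)
    (hγ : ∀ j, IsTestFun n (γ j) V) (hγa : ∀ j, ∀ z ∈ tsupport (γ j), a ≤ s z) :
    ‖∫ z in V, ∑ j, α j z * γ j z‖ ^ 2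
      ≤ 2 * Real.exp 1 * (∫ z in V, (∑ j, ‖α j z‖ ^ 2) * Real.exp (-φ z))
        * ∫ z in V, ‖∑ j, wderBar n j (γ j) z‖ ^ 2 * Real.exp (φ z) := by
  obtain ⟨m, hm⟩ := barrier_estimate hV hVb hs hspos hK ha hc0 hsH hφ hφH
  set Φ : (Fin n → ℂ) → ℝ := fun z => φ z + (a / s z) ^ m with hΦdef
  have hΦV : ∀ z ∈ V, ContDiffAt ℝ (⊤ : ℕ∞) Φ z := fun z hz =>
    hφ.contDiffAt.add ((contDiffAt_const.div hs.contDiffAt (hspos z hz).ne').pow m)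
  have hΦc : ContinuousOn Φ V := fun z hz => (hΦV z hz).continuousAt.continuousWithinAt
  have hΦm : Measurable Φ := hφ.continuous.measurable.add
    ((measurable_const.div hs.continuous.measurable).pow_const m)
  have hΦφ : ∀ z ∈ V, φ z ≤ Φ z := fun z hz =>
    le_add_of_nonneg_right (pow_nonneg (div_nonneg ha.le (hspos z hz).le) m)
  have hEc : ContinuousOn (fun z => (Real.exp (Φ z / 2) : ℂ)) V :=
    continuous_ofReal.comp_continuousOn (Real.continuous_exp.comp_continuousOn (hΦc.div_const 2))
  have ee : ∀ x : ℝ, (Real.exp (x / 2) : ℂ) * (Real.exp (-(x / 2)) : ℂ) = 1 := fun x => by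
    rw [← ofReal_mul, ← Real.exp_add, add_neg_cancel, Real.exp_zero, ofReal_one]
  have eE : ∀ x : ℝ, (Real.exp (x / 2) : ℂ) * (Real.exp (x / 2) : ℂ) = (Real.exp x : ℂ) := fun x => by
    rw [← ofReal_mul, ← Real.exp_add, add_halves]
  have cts : ∀ {f : (Fin n → ℂ) → ℂ}, tsupport (fun z => starRingEnd ℂ (f z)) ⊆ tsupport f := fun {f} =>
    tsupport_comp_subset (map_zero (starRingEnd ℂ)) f
  -- the orthogonal complement of the weakly closed forms
  set S : Set (Fin n → (Fin n → ℂ) → ℂ) := {f | ∃ j k κ, IsTestFun n κ V ∧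
    f = fun i z => (Real.exp (Φ z / 2) : ℂ) * ((if i = j then starRingEnd ℂ (wderBar n k κ z) else 0)
      - if i = k then starRingEnd ℂ (wderBar n j κ z) else 0)} with hS
  have mulm : ∀ {g : (Fin n → ℂ) → ℂ}, Continuous g → HasCompactSupport g → tsupport g ⊆ V →
      MemLp (fun z => (Real.exp (Φ z / 2) : ℂ) * g z) 2 (volume.restrict V) :=
    fun h1 h2 h3 => memLp_mul_of_tsupport hV hEc h1 h2 h3
  have hSm : ∀ f ∈ S, ∀ i, MemLp (f i) 2 (volume.restrict V) := by
    rintro f ⟨j, k, κ, hκ, rfl⟩ i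
    have aux : ∀ (l l' : Fin n), MemLp (fun z => (Real.exp (Φ z / 2) : ℂ) *
        (if i = l then starRingEnd ℂ (wderBar n l' κ z) else 0)) 2 (volume.restrict V) := by
      intro l l'
      split_ifs
      · exact mulm hκ.1.wderBar.conj_comp.continuous (hκ.2.1.wderBar.comp_left (map_zero (starRingEnd ℂ)))
          ((cts.trans (tsupport_wderBar_subset _ _)).trans hκ.2.2)
      · simp
    have := (aux j k).sub (aux k j)
    refine this.congr_norm (this.1.congr (ae_of_all _ fun z => ?_)) (ae_of_all _ fun z => ?_)
    · simp only [Pi.sub_apply, mul_sub]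
    · simp only [Pi.sub_apply, mul_sub]
  have pair : ∀ (v : Fin n → (Fin n → ℂ) → ℂ) j k κ z, ∑ i, starRingEnd ℂ ((Real.exp (Φ z / 2) : ℂ) *
      ((if i = j then starRingEnd ℂ (wderBar n k κ z) else 0)
        - if i = k then starRingEnd ℂ (wderBar n j κ z) else 0)) * v i z
      = (Real.exp (Φ z / 2) : ℂ) * (v j z * wderBar n k κ z - v k z * wderBar n j κ z) := by
    intro v j k κ z
    have : ∀ i, starRingEnd ℂ ((Real.exp (Φ z / 2) : ℂ) * ((if i = j then starRingEnd ℂ (wderBar n k κ z) else 0)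
        - if i = k then starRingEnd ℂ (wderBar n j κ z) else 0)) * v i z
        = (if i = j then (Real.exp (Φ z / 2) : ℂ) * (wderBar n k κ z * v i z) else 0)
          - if i = k then (Real.exp (Φ z / 2) : ℂ) * (wderBar n j κ z * v i z) else 0 := by
      intro i
      rw [map_mul, conj_ofReal, map_sub]
      split_ifs <;> simp <;> ring
    simp only [this, Finset.sum_sub_distrib, Finset.sum_ite_eq', Finset.mem_univ, if_true]
    ring
  have hbm : ∀ j, MemLp (fun z => (Real.exp (Φ z / 2) : ℂ) * starRingEnd ℂ (γ j z)) 2 (volume.restrict V) :=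
    fun j => mulm (hγ j).1.conj_comp.continuous ((hγ j).2.1.comp_left (map_zero (starRingEnd ℂ)))
      (cts.trans (hγ j).2.2)
  obtain ⟨w, hw, hwS, hwp⟩ := exists_orthogonal_part S hSm hbm
  have hcl : ∀ j k κ, IsTestFun n κ V → ∫ z in V, (Real.exp (Φ z / 2) : ℂ) *
        (w j z * wderBar n k κ z - w k z * wderBar n j κ z) = 0 := by
    intro j k κ hκ
    have := hwS _ ⟨j, k, κ, hκ, rfl⟩
    simp only [pair] at this
    exact this
  set d : (Fin n → ℂ) → ℂ := fun z => -∑ j, starRingEnd ℂ (wderBar n j (γ j) z) with hd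
  have hdc : Continuous d := (continuous_finsetSum _ fun j _ =>
    (hγ j).1.wderBar.conj_comp.continuous).neg
  have hd0 : ∀ z, (∀ j, z ∉ tsupport (γ j)) → d z = 0 := by
    intro z hz
    simp [hd, fun j => wderBar_eq_zero_of_notMem_tsupport (j := j) (hz j)]
  have hKγ : IsCompact (⋃ j, tsupport (γ j)) := isCompact_iUnion fun j => (hγ j).2.1
  have hdK : tsupport d ⊆ ⋃ j, tsupport (γ j) := by
    refine closure_minimal (fun z hz => ?_) hKγ.isClosed
    by_contra hc
    exact hz (hd0 z fun j h => hc (mem_iUnion.2 ⟨j, h⟩))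
  have hKV : (⋃ j, tsupport (γ j)) ⊆ V := iUnion_subset fun j => (hγ j).2.2
  have hth : ∀ κ, IsTestFun n κ V → ∫ z in V, (Real.exp (Φ z / 2) : ℂ) *
        ∑ j, w j z * (wder n j κ z + wder n j (fun w => (Φ w : ℂ)) z * κ z)
          = ∫ z in V, (Real.exp (Φ z) : ℂ) * d z * κ z := by
    intro κ hκ
    set h : (Fin n → ℂ) → ℂ := fun z => ((Real.exp (Φ z) : ℝ) : ℂ) * κ z with hh
    have hEd : ∀ z ∈ V, ContDiffAt ℝ (⊤ : ℕ∞) (fun z => ((Real.exp (Φ z) : ℝ) : ℂ)) z :=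
      fun z hz => ofRealCLM.contDiff.contDiffAt.comp z (hΦV z hz).exp
    have hhd : ContDiff ℝ (⊤ : ℕ∞) h :=
      hκ.1.mul_of_contDiffAt_tsupport fun z hz => hEd z (hκ.2.2 hz)
    have hhc : HasCompactSupport h := hκ.2.1.mul_left
    have hhV : tsupport h ⊆ V := (tsupport_mul_subset_right).trans hκ.2.2
    have hwh : ∀ j, ∀ z ∈ V, wder n j h z = (Real.exp (Φ z) : ℂ) *
        (wder n j κ z + wder n j (fun w => (Φ w : ℂ)) z * κ z) := by
      intro j z hz
      rw [hh, wder_mul ((hEd z hz).differentiableAt (by simp))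
        (hκ.1.differentiable (by simp) z),
        wder_real_exp ((hΦV z hz).differentiableAt (by simp))]
      push_cast; ring
    have hb : ∀ j, MemLp (fun z => (Real.exp (-(Φ z / 2)) : ℂ) * starRingEnd ℂ (wder n j h z)) 2
        (volume.restrict V) := fun j =>
      memLp_mul_of_tsupport hV (continuous_ofReal.comp_continuousOn
        (Real.continuous_exp.comp_continuousOn (hΦc.div_const 2).neg)) hhd.wder.conj_comp.continuous
        (hhc.wder.comp_left (map_zero _)) ((cts.trans (tsupport_wder_subset _ _)).trans hhV)
    have horth : ∀ f ∈ S, ∫ z in V, ∑ j, starRingEnd ℂ (f j z) *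
        ((Real.exp (-(Φ z / 2)) : ℂ) * starRingEnd ℂ (wder n j h z)) = 0 := by
      rintro f ⟨j, k, κ', hκ', rfl⟩
      have hG := hhd.conj_comp
      have hGc : HasCompactSupport fun z => starRingEnd ℂ (h z) := hhc.comp_left (map_zero _)
      have ibp : ∀ j k, ∫ z, wderBar n k κ' z * starRingEnd ℂ (wder n j h z)
          = -∫ z, wderBar n j (wderBar n k κ') z * starRingEnd ℂ (h z) := fun j k => by
        simp only [← wderBar_conj]
        exact integral_mul_wderBar (hG.of_le (by simp)) hGc
          (fun x _ => (hκ'.1.wderBar.of_le (by simp)).contDiffAt) j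
      have hinteg : ∀ j k, Integrable
          (fun z => wderBar n k κ' z * starRingEnd ℂ (wder n j h z)) := fun j k =>
        (hκ'.1.wderBar.continuous.mul hhd.wder.conj_comp.continuous).integrable_of_hasCompactSupport
          hκ'.2.1.wderBar.mul_right
      have e1 : ∀ z, ∑ i, starRingEnd ℂ ((Real.exp (Φ z / 2) : ℂ) *
          ((if i = j then starRingEnd ℂ (wderBar n k κ' z) else 0)
            - if i = k then starRingEnd ℂ (wderBar n j κ' z) else 0)) *
            ((Real.exp (-(Φ z / 2)) : ℂ) * starRingEnd ℂ (wder n i h z))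
          = wderBar n k κ' z * starRingEnd ℂ (wder n j h z)
            - wderBar n j κ' z * starRingEnd ℂ (wder n k h z) := by
        intro z
        rw [pair (fun i z => (Real.exp (-(Φ z / 2)) : ℂ) * starRingEnd ℂ (wder n i h z))]
        linear_combination (wderBar n k κ' z * starRingEnd ℂ (wder n j h z)
            - wderBar n j κ' z * starRingEnd ℂ (wder n k h z)) * ee (Φ z)
      simp only [e1]
      rw [setIntegral_eq_integral_of_forall_compl_eq_zero, integral_sub (hinteg _ _) (hinteg _ _),
        ibp, ibp]
      · simp only [wderBar_wderBar_comm (j := j) (k := k)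
          (hκ'.1.contDiffAt.of_le (WithTop.coe_le_coe.2 (le_top : ((2 : ℕ) : ℕ∞) ≤ ⊤)))]
        ring
      · intro z hz
        have hz' : z ∉ tsupport κ' := fun h => hz (hκ'.2.2 h)
        simp [wderBar_eq_zero_of_notMem_tsupport hz']
    have key := hwp _ hb horth
    have l1 : ∫ z in V, ∑ j, starRingEnd ℂ
          ((Real.exp (-(Φ z / 2)) : ℂ) * starRingEnd ℂ (wder n j h z)) * w j z
        = ∫ z in V, (Real.exp (Φ z / 2) : ℂ) *
          ∑ j, w j z * (wder n j κ z + wder n j (fun w => (Φ w : ℂ)) z * κ z) := by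
      refine setIntegral_congr_fun hV.measurableSet fun z hz => ?_
      simp only [Finset.mul_sum]
      refine Finset.sum_congr rfl fun j _ => ?_
      rw [map_mul, conj_ofReal, conj_conj, hwh j z hz, ← eE (Φ z)]
      linear_combination ((Real.exp (Φ z / 2) : ℂ) * (wder n j κ z +
        wder n j (fun w => (Φ w : ℂ)) z * κ z) * w j z) * ee (Φ z)
    have l2 : ∫ z in V, ∑ j, starRingEnd ℂ
          ((Real.exp (-(Φ z / 2)) : ℂ) * starRingEnd ℂ (wder n j h z)) *
            ((Real.exp (Φ z / 2) : ℂ) * starRingEnd ℂ (γ j z))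
        = ∫ z in V, ∑ j, starRingEnd ℂ (γ j z) * wder n j h z := by
      refine setIntegral_congr_fun hV.measurableSet fun z hz => ?_
      refine Finset.sum_congr rfl fun j _ => ?_
      rw [map_mul, conj_ofReal, conj_conj]
      linear_combination (starRingEnd ℂ (γ j z) * wder n j h z) * ee (Φ z)
    rw [← l1, key, l2, setIntegral_eq_integral_of_forall_compl_eq_zero,
      setIntegral_eq_integral_of_forall_compl_eq_zero, integral_finsetSum]
    · have ibp : ∀ j, ∫ z, starRingEnd ℂ (γ j z) * wder n j h z
          = -∫ z, starRingEnd ℂ (wderBar n j (γ j) z) * h z := fun j => by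
        simp only [← wder_conj]
        exact integral_mul_wder (hhd.of_le (by simp)) hhc
          (fun x _ => ((hγ j).1.conj_comp.of_le (by simp)).contDiffAt) j
      simp only [ibp]
      rw [Finset.sum_neg_distrib, ← integral_finsetSum, ← integral_neg]
      · refine integral_congr_ae (ae_of_all _ fun z => ?_)
        simp only [hd, hh, ← Finset.sum_mul]
        ring
      · exact fun j _ => ((hγ j).1.wderBar.conj_comp.continuous.mul
          hhd.continuous).integrable_of_hasCompactSupport hhc.mul_left
    · exact fun j _ => ((hγ j).1.conj_comp.continuous.mul
          hhd.wder.continuous).integrable_of_hasCompactSupport hhc.wder.mul_left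
    · intro z hz
      rw [image_eq_zero_of_notMem_tsupport fun h => hz (hκ.2.2 h), mul_zero]
    · intro z hz
      exact Finset.sum_eq_zero fun j _ => by
        rw [wder_eq_zero_of_notMem_tsupport fun h => hz (hhV h), mul_zero]
  have est := hm Φ (fun z => rfl) w d hw hdc (hKγ.of_isClosed_subset (isClosed_tsupport _) hdK)
    (hdK.trans hKV) hcl hth
  obtain ⟨M, hM⟩ := hVb.isCompact_closure.exists_bound_of_continuousOn
    (f := fun z => Real.exp (-φ z)) (Real.continuous_exp.comp hφ.continuous.neg).continuousOn
  have hM' : ∀ z ∈ V, Real.exp (-φ z) ≤ M := fun z hz =>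
    (le_abs_self _).trans (hM z (subset_closure hz))
  have hn : ∀ x : ℝ, ‖(Real.exp (-(x / 2)) : ℂ)‖ ^ 2 = Real.exp (-x) := fun x => by
    rw [norm_real, Real.norm_eq_abs, sq_abs, sq, ← Real.exp_add]; congr 1; ring
  have hα' : ∀ j, MemLp (fun z => (Real.exp (-(Φ z / 2)) : ℂ) * α j z) 2 (volume.restrict V) := by
    intro j
    refine (hα j).of_le_mul (c := Real.sqrt M) ?_ ?_
    · exact ((continuous_ofReal.measurable.comp (Real.continuous_exp.measurable.comp
        (hΦm.div_const 2).neg)).aestronglyMeasurable).mul (hα j).1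
    · filter_upwards [ae_restrict_mem hV.measurableSet] with z hz
      rw [norm_mul]
      gcongr
      refine Real.le_sqrt_of_sq_le ?_
      rw [hn]
      exact (Real.exp_le_exp.2 (neg_le_neg (hΦφ z hz))).trans (hM' z hz)
  have horth : ∀ f ∈ S, ∫ z in V, ∑ j, starRingEnd ℂ (f j z) *
      ((Real.exp (-(Φ z / 2)) : ℂ) * α j z) = 0 := by
    rintro f ⟨j, k, κ, hκ, rfl⟩
    refine Eq.trans ?_ (hαcl j k κ hκ)
    refine integral_congr_ae (ae_of_all _ fun z => ?_)
    simp only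
    rw [pair (fun i z => (Real.exp (-(Φ z / 2)) : ℂ) * α i z)]
    linear_combination (α j z * wderBar n k κ z - α k z * wderBar n j κ z) * ee (Φ z)
  have key := hwp _ hα' horth
  have l2 : ∫ z in V, ∑ j, starRingEnd ℂ ((Real.exp (-(Φ z / 2)) : ℂ) * α j z) *
            ((Real.exp (Φ z / 2) : ℂ) * starRingEnd ℂ (γ j z))
        = starRingEnd ℂ (∫ z in V, ∑ j, α j z * γ j z) := by
    rw [← integral_conj]
    refine integral_congr_ae (ae_of_all _ fun z => ?_)
    simp only [map_sum, map_mul]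
    refine Finset.sum_congr rfl fun j _ => ?_
    rw [conj_ofReal]
    linear_combination (starRingEnd ℂ (α j z) * starRingEnd ℂ (γ j z)) * ee (Φ z)
  have cs := norm_integral_sum_conj_mul_sq_le hα' hw
  rw [key, l2, RCLike.norm_conj] at cs
  have hI1 : Integrable (fun z => (∑ j, ‖α j z‖ ^ 2) * Real.exp (-φ z)) (volume.restrict V) := by
    refine Integrable.mul_bdd (c := M) (integrable_finsetSum _ fun j _ => (hα j).integrable_norm_pow
      (by norm_num)) (Real.continuous_exp.comp hφ.continuous.neg).aestronglyMeasurable ?_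
    filter_upwards [ae_restrict_mem hV.measurableSet] with z hz
    exact hM z (subset_closure hz)
  have b1 : ∫ z in V, ∑ j, ‖(Real.exp (-(Φ z / 2)) : ℂ) * α j z‖ ^ 2
      ≤ ∫ z in V, (∑ j, ‖α j z‖ ^ 2) * Real.exp (-φ z) := by
    refine integral_mono_ae (integrable_finsetSum _ fun j _ => (hα' j).integrable_norm_pow
      (by norm_num)) hI1 ?_
    filter_upwards [ae_restrict_mem hV.measurableSet] with z hz
    simp only [norm_mul, mul_pow, hn, ← Finset.mul_sum]
    rw [mul_comm]
    gcongr
    exact hΦφ z hz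
  have hφE : Continuous fun z => Real.exp (φ z) := Real.continuous_exp.comp hφ.continuous
  have hdcs : HasCompactSupport d := hKγ.of_isClosed_subset (isClosed_tsupport _) hdK
  have b2 : ∫ z in V, ‖d z‖ ^ 2 * Real.exp (Φ z)
      ≤ Real.exp 1 * ∫ z in V, ‖∑ j, wderBar n j (γ j) z‖ ^ 2 * Real.exp (φ z) := by
    rw [← integral_const_mul]
    have hdn : ∀ z, ‖d z‖ = ‖∑ j, wderBar n j (γ j) z‖ := fun z => by
      rw [hd, norm_neg, ← map_sum, RCLike.norm_conj]
    refine integral_mono_of_nonneg (ae_of_all _ fun z => by positivity) ?_ ?_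
    · simp only [← hdn]
      refine (Integrable.const_mul ?_ _).integrableOn
      refine ((hdc.norm.pow 2).mul hφE).integrable_of_hasCompactSupport (hdcs.mono' ?_)
      intro z hz
      by_contra hc
      simp [image_eq_zero_of_notMem_tsupport hc] at hz
    · filter_upwards [ae_restrict_mem hV.measurableSet] with z hz
      simp only [← hdn]
      by_cases hzs : z ∈ ⋃ j, tsupport (γ j)
      · obtain ⟨j, hj⟩ := mem_iUnion.1 hzs
        have h1 : (a / s z) ^ m ≤ 1 := pow_le_one₀ (div_nonneg ha.le (hspos z hz).le)
          ((div_le_one (hspos z hz)).2 (hγa j z hj))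
        have h2 : Real.exp (Φ z) ≤ Real.exp 1 * Real.exp (φ z) := by
          rw [← Real.exp_add]
          refine Real.exp_le_exp.2 ?_
          simp only [hΦdef]; linarith
        calc _ ≤ ‖d z‖ ^ 2 * (Real.exp 1 * Real.exp (φ z)) := by gcongr
          _ = _ := by ring
      · rw [hd0 z fun j h => hzs (mem_iUnion.2 ⟨j, h⟩)]; simp
  have n1 : 0 ≤ ∫ z in V, (∑ j, ‖α j z‖ ^ 2) * Real.exp (-φ z) :=
    integral_nonneg fun z => by positivity
  have n2 : 0 ≤ ∫ z in V, ∑ j, ‖w j z‖ ^ 2 := integral_nonneg fun z => by positivity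
  calc _ ≤ _ := cs
    _ ≤ (∫ z in V, (∑ j, ‖α j z‖ ^ 2) * Real.exp (-φ z)) * (2 * (Real.exp 1 *
        ∫ z in V, ‖∑ j, wderBar n j (γ j) z‖ ^ 2 * Real.exp (φ z))) :=
      mul_le_mul b1 (est.trans (by gcongr)) n2 n1
    _ = _ := by ring

/-! ### Smooth strictly plurisubharmonic exhaustions -/

theorem bilin_sum_apply {E ι : Type*} [NormedAddCommGroup E] [NormedSpace ℝ E] [Fintype ι]
    (B : E →L[ℝ] E →L[ℝ] ℝ) (e f : ι → E) (a b : ι → ℝ) :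
    B (∑ j, (a j • e j + b j • f j)) (∑ j, (a j • e j + b j • f j))
      = ∑ j, ∑ k, (a k * a j * B (e k) (e j) + a k * b j * B (e k) (f j)
        + b k * a j * B (f k) (e j) + b k * b j * B (f k) (f j)) := by
  rw [map_sum]
  refine Finset.sum_congr rfl fun j _ => ?_
  rw [map_sum, _root_.sum_apply]
  refine Finset.sum_congr rfl fun k _ => ?_
  simp only [map_add, map_smul, _root_.add_apply, _root_.smul_apply, smul_eq_mul]
  ring

theorem hermForm_cHess_eq {n : ℕ} {g : (Fin n → ℂ) → ℝ} {z : Fin n → ℂ} (hg : ContDiffAt ℝ 2 g z)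
    (X : Fin n → ℂ) :
    hermForm n (cHess n g z) X X = (1 / 4) * (fderiv ℝ (fderiv ℝ g) z X X
      + fderiv ℝ (fderiv ℝ g) z (I • X) (I • X)) := by
  set B := fderiv ℝ (fderiv ℝ g) z with hB
  have hd : HasFDerivAt (fderiv ℝ g) B z :=
    ((hg.fderiv_right (m := 1) (by norm_num)).differentiableAt (by norm_num)).hasFDerivAt
  have hev : ∀ j, (fun w => wder n j (fun v => (g v : ℂ)) w) =ᶠ[𝓝 z]
      fun w => (1 / 2) * ((fderiv ℝ g w (Pi.single j 1) : ℂ)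
        - I * (fderiv ℝ g w (Pi.single j I) : ℂ)) := by
    intro j
    filter_upwards [hg.eventually (by simp)] with y hy
    have h1 : HasFDerivAt (fun v => (g v : ℂ)) (ofRealCLM.comp (fderiv ℝ g y)) y :=
      ofRealCLM.hasFDerivAt.comp y (hy.differentiableAt (by norm_num)).hasFDerivAt
    simp [wder, h1.fderiv]
  have hfd : ∀ j v, fderiv ℝ (fun w => wder n j (fun v => (g v : ℂ)) w) z v
      = (1 / 2) * ((B v (Pi.single j 1) : ℂ) - I * (B v (Pi.single j I) : ℂ)) := by
    intro j v
    have h2 : ∀ w, HasFDerivAt (fun y => (fderiv ℝ g y w : ℂ)) (ofRealCLM.comp (B.flip w)) z :=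
      fun w =>
      ofRealCLM.hasFDerivAt.comp z (((ContinuousLinearMap.apply ℝ ℝ w).hasFDerivAt.comp z hd).congr_fderiv
        (by ext; simp))
    have h3 := ((h2 (Pi.single j 1)).sub ((h2 (Pi.single j I)).const_mul I)).const_mul (1 / 2)
    rw [((hev j).hasFDerivAt_iff.2 h3).fderiv]
    simp
  have hX : X = ∑ j, ((X j).re • (Pi.single j 1 : Fin n → ℂ) + (X j).im • (Pi.single j I : Fin n → ℂ)) := by
    ext i
    simp [Finset.sum_apply, Pi.single_apply, Finset.sum_add_distrib]
  have hIX : I • X = ∑ j, ((-(X j).im) • (Pi.single j 1 : Fin n → ℂ)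
      + (X j).re • (Pi.single j I : Fin n → ℂ)) := by
    ext i
    simp [Finset.sum_apply, Pi.single_apply, Finset.sum_add_distrib]
    apply Complex.ext <;> simp
  have e1 := bilin_sum_apply B (fun j => (Pi.single j 1 : Fin n → ℂ)) (fun j => (Pi.single j I : Fin n → ℂ))
    (fun j => (X j).re) (fun j => (X j).im)
  have e2 := bilin_sum_apply B (fun j => (Pi.single j 1 : Fin n → ℂ)) (fun j => (Pi.single j I : Fin n → ℂ))
    (fun j => -(X j).im) (fun j => (X j).re)
  rw [← hX] at e1
  rw [← hIX] at e2
  rw [e1, e2, hermForm, re_sum, ← Finset.sum_add_distrib, Finset.mul_sum]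
  refine Finset.sum_congr rfl fun j _ => ?_
  rw [re_sum, ← Finset.sum_add_distrib, Finset.mul_sum]
  refine Finset.sum_congr rfl fun k _ => ?_
  simp only [cHess, wderBar, hfd]
  simp
  ring

theorem second_order_taylor {E : Type*} [NormedAddCommGroup E] [NormedSpace ℝ E] {g : E → ℝ} {z : E}
    (hg : ContDiffAt ℝ 2 g z) {η : ℝ} (hη : 0 < η) :
    ∃ r > 0, ∀ h : E, ‖h‖ ≤ r →
      g (z + h) ≤ g z + fderiv ℝ g z h + (1 / 2) * fderiv ℝ (fderiv ℝ g) z h h + η * ‖h‖ ^ 2 := by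
  set B := fderiv ℝ (fderiv ℝ g) z with hB
  have hd : HasFDerivAt (fderiv ℝ g) B z :=
    ((hg.fderiv_right (m := 1) (by norm_num)).differentiableAt (by norm_num)).hasFDerivAt
  have hs : IsSymmSndFDerivAt ℝ g z := hg.isSymmSndFDerivAt (by simp)
  have h1 : ∀ᶠ h in 𝓝 (0 : E), ‖fderiv ℝ g (z + h) - fderiv ℝ g z - B h‖ ≤ η * ‖h‖ :=
    (hasFDerivAt_iff_isLittleO_nhds_zero.1 hd).def hη
  have h2 : ∀ᶠ h in 𝓝 (0 : E), DifferentiableAt ℝ g (z + h) := by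
    have ht : Tendsto (fun h : E => z + h) (𝓝 0) (𝓝 z) := by
      simpa using (continuous_const_add z).tendsto 0
    filter_upwards [ht.eventually (hg.eventually (by simp))] with h hh
    exact hh.differentiableAt (by norm_num)
  obtain ⟨r, hr, hball⟩ := Metric.eventually_nhds_iff.1 (h1.and h2)
  refine ⟨r / 2, by positivity, fun h hh => ?_⟩
  set R : E → ℝ := fun y => g (z + y) - fderiv ℝ g z y - (1 / 2) * B y y with hR
  have hRd : ∀ y ∈ Metric.closedBall (0 : E) ‖h‖,
      HasFDerivAt R (fderiv ℝ g (z + y) - fderiv ℝ g z - B y) y := by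
    intro y hy
    have hy' : dist y 0 < r := by
      rw [Metric.mem_closedBall] at hy; linarith [hy.trans hh]
    have a1 : HasFDerivAt (fun y => g (z + y)) (fderiv ℝ g (z + y)) y := by
      exact (hasFDerivAt_comp_add_left z).2 (hball hy').2.hasFDerivAt
    have a2 : HasFDerivAt (fun y => (1 / 2) * B y y) (B y) y := by
      have := ((B.hasFDerivAt (x := y)).clm_apply (hasFDerivAt_id y)).const_mul (1 / 2)
      refine this.congr_fderiv ?_
      ext v
      simp [hs v y, hB]
      ring
    exact (a1.sub (fderiv ℝ g z).hasFDerivAt).sub a2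
  have hmv := (convex_closedBall (0 : E) ‖h‖).norm_image_sub_le_of_norm_hasFDerivWithin_le
    (f := R) (C := η * ‖h‖) (x := 0) (y := h) (fun y hy => (hRd y hy).hasFDerivWithinAt) (fun y hy => ?_)
    (by simp) (by simp)
  · have := (le_abs_self _).trans hmv
    simp only [hR, add_zero, map_zero, sub_zero, mul_zero] at this
    nlinarith [this]
  · have hy' : dist y 0 < r := by
      rw [Metric.mem_closedBall] at hy; linarith [hy.trans hh]
    refine (hball hy').1.trans ?_
    rw [mem_closedBall_zero_iff] at hy
    gcongr

theorem circleInt_quadratic {E : Type*} [NormedAddCommGroup E] [NormedSpace ℝ E] (L : E →L[ℝ] ℝ)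
    (B : E →L[ℝ] E →L[ℝ] ℝ) (x y : E) (c r : ℝ) :
    ∫ θ in (0 : ℝ)..(2 * Real.pi), (c + L (r • (Real.cos θ • x + Real.sin θ • y))
        + (1 / 2) * B (r • (Real.cos θ • x + Real.sin θ • y)) (r • (Real.cos θ • x + Real.sin θ • y)))
      = 2 * Real.pi * c + r ^ 2 * (Real.pi / 2) * (B x x + B y y) := by
  have e : ∀ θ, c + L (r • (Real.cos θ • x + Real.sin θ • y))
        + (1 / 2) * B (r • (Real.cos θ • x + Real.sin θ • y)) (r • (Real.cos θ • x + Real.sin θ • y))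
      = c + (r * L x * Real.cos θ + r * L y * Real.sin θ
        + (1 / 2 * r ^ 2 * B x x * Real.cos θ ^ 2 + 1 / 2 * r ^ 2 * B y y * Real.sin θ ^ 2
        + 1 / 2 * r ^ 2 * (B x y + B y x) * (Real.sin θ * Real.cos θ))) := by
    intro θ
    simp only [map_add, map_smul, _root_.add_apply, _root_.smul_apply, smul_eq_mul]
    ring
  simp only [e]
  have i1 : ∀ f : ℝ → ℝ, Continuous f → IntervalIntegrable f volume 0 (2 * Real.pi) :=
    fun f hf => hf.intervalIntegrable _ _
  rw [intervalIntegral.integral_add (i1 _ (by fun_prop)) (i1 _ (by fun_prop)),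
    intervalIntegral.integral_add (i1 _ (by fun_prop)) (i1 _ (by fun_prop)),
    intervalIntegral.integral_add (i1 _ (by fun_prop)) (i1 _ (by fun_prop)),
    intervalIntegral.integral_add (i1 _ (by fun_prop)) (i1 _ (by fun_prop)),
    intervalIntegral.integral_add (i1 _ (by fun_prop)) (i1 _ (by fun_prop))]
  simp only [intervalIntegral.integral_const_mul, integral_cos, integral_sin, integral_cos_sq,
    integral_sin_sq, integral_sin_mul_cos₁, intervalIntegral.integral_const]
  simp
  ring

theorem nonneg_of_submean {n : ℕ} {g : (Fin n → ℂ) → ℝ} {z w : Fin n → ℂ} (hg : ContDiff ℝ 2 g)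
    (hm : ∀ᶠ r : ℝ in 𝓝[>] (0 : ℝ), g z ≤ (1 / (2 * Real.pi)) *
      ∫ θ in (0:ℝ)..(2 * Real.pi), g (z + ((r : ℂ) * Complex.exp ((θ : ℂ) * Complex.I)) • w)) :
    0 ≤ fderiv ℝ (fderiv ℝ g) z w w + fderiv ℝ (fderiv ℝ g) z (I • w) (I • w) := by
  set B := fderiv ℝ (fderiv ℝ g) z with hB
  have hv : ∀ r θ : ℝ, ((r : ℂ) * Complex.exp ((θ : ℂ) * Complex.I)) • w
      = r • (Real.cos θ • w + Real.sin θ • (I • w)) := by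
    intro r θ
    rw [exp_mul_I, ← ofReal_cos, ← ofReal_sin]
    ext i
    simp
    ring
  have hvn : ∀ r θ : ℝ, 0 ≤ r → ‖((r : ℂ) * Complex.exp ((θ : ℂ) * Complex.I)) • w‖ = r * ‖w‖ := by
    intro r θ hr
    rw [norm_smul, norm_mul, norm_exp_ofReal_mul_I, norm_real, Real.norm_of_nonneg hr, mul_one]
  have key : ∀ η : ℝ, 0 < η → 0 ≤ B w w + B (I • w) (I • w) + 4 * η * ‖w‖ ^ 2 := by
    intro η hη
    obtain ⟨r₀, hr₀, ht⟩ := second_order_taylor (hg.contDiffAt (x := z)) hη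
    have hsm : ∀ᶠ r in 𝓝[>] (0 : ℝ), r * ‖w‖ ≤ r₀ := by
      have : Tendsto (fun r : ℝ => r * ‖w‖) (𝓝[>] 0) (𝓝 0) := by
        refine (Continuous.tendsto' (by fun_prop) 0 0 (by simp)).mono_left nhdsWithin_le_nhds
      exact this.eventually (ge_mem_nhds hr₀)
    obtain ⟨r, ⟨hr1, hr2⟩, hr3⟩ := ((hm.and hsm).and self_mem_nhdsWithin).exists
    have hr : 0 < r := hr3
    have hle : ∫ θ in (0:ℝ)..(2 * Real.pi),
          g (z + ((r : ℂ) * Complex.exp ((θ : ℂ) * Complex.I)) • w)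
        ≤ ∫ θ in (0:ℝ)..(2 * Real.pi), ((g z + η * (r * ‖w‖) ^ 2)
          + fderiv ℝ g z (r • (Real.cos θ • w + Real.sin θ • (I • w)))
          + (1 / 2) * B (r • (Real.cos θ • w + Real.sin θ • (I • w)))
            (r • (Real.cos θ • w + Real.sin θ • (I • w)))) := by
      refine intervalIntegral.integral_mono_on (by positivity) ?_ ?_ fun θ _ => ?_
      · exact (hg.continuous.comp (by fun_prop)).intervalIntegrable _ _
      · refine Continuous.intervalIntegrable ?_ _ _
        fun_prop
      · have h1 := hvn r θ hr.le
        have h2 := ht _ (h1.le.trans hr2)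
        rw [h1] at h2
        rw [hv] at h2 ⊢
        linarith
    rw [circleInt_quadratic] at hle
    have hpi := Real.pi_pos
    have h3 : 2 * Real.pi * g z ≤ _ := (le_div_iff₀' (by positivity)).1
      (hr1.trans_eq (one_div_mul_eq_div _ _))
    have h4 := h3.trans hle
    have h5 : 0 ≤ (Real.pi / 2 * r ^ 2) * (B w w + B (I • w) (I • w) + 4 * η * ‖w‖ ^ 2) := by
      linarith
    exact nonneg_of_mul_nonneg_right h5 (by positivity)
  refine le_of_forall_pos_le_add fun ε hε => ?_
  have := key (ε / (4 * (‖w‖ ^ 2 + 1))) (by positivity)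
  have h6 : 4 * (ε / (4 * (‖w‖ ^ 2 + 1))) * ‖w‖ ^ 2 ≤ ε := by
    rw [show 4 * (ε / (4 * (‖w‖ ^ 2 + 1))) * ‖w‖ ^ 2 = ε * ‖w‖ ^ 2 / (‖w‖ ^ 2 + 1) by field_simp,
      div_le_iff₀ (by positivity)]
    nlinarith [sq_nonneg ‖w‖]
  linarith

theorem mol_le_circle_average {n : ℕ} {ε r M : ℝ} {U : (Fin n → ℂ) → ℝ} {z w : Fin n → ℂ}
    (hε : 0 < ε) (hU : Measurable U) (hUb : ∀ z, |U z| ≤ M)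
    (h : ∀ t, ‖t‖ < ε → U (z - t) ≤ (1 / (2 * Real.pi)) *
      ∫ θ in (0:ℝ)..(2 * Real.pi), U (z - t + ((r : ℂ) * Complex.exp ((θ : ℂ) * Complex.I)) • w)) :
    mol n ε U z ≤ (1 / (2 * Real.pi)) *
      ∫ θ in (0:ℝ)..(2 * Real.pi),
        mol n ε U (z + ((r : ℂ) * Complex.exp ((θ : ℂ) * Complex.I)) • w) := by
  have hpi := Real.pi_pos
  set c : ℝ → (Fin n → ℂ) := fun θ => ((r : ℂ) * Complex.exp ((θ : ℂ) * Complex.I)) • w with hc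
  have hcc : Continuous c := by fun_prop
  set ν := (volume : Measure ℝ).restrict (Ioc 0 (2 * Real.pi)) with hν
  have hinteg : Integrable (Function.uncurry fun (t : Fin n → ℂ) (θ : ℝ) =>
      mker n ε t * U (z - t + c θ)) (volume.prod ν) := by
    refine Integrable.mul_bdd (c := M) ((integrable_mker hε).comp_fst ν) ?_
      (ae_of_all _ fun p => hUb _)
    exact (hU.comp (by fun_prop : Measurable fun p : (Fin n → ℂ) × ℝ =>
      z - p.1 + c p.2)).aestronglyMeasurable
  have hm : ∀ t, mker n ε t * U (z - t) ≤ (1 / (2 * Real.pi)) *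
      ∫ θ, mker n ε t * U (z - t + c θ) ∂ν := by
    intro t
    rw [integral_const_mul]
    by_cases ht : ‖t‖ < ε
    · have := mul_le_mul_of_nonneg_left (h t ht) (mker_nonneg hε t)
      rw [intervalIntegral.integral_of_le (by positivity)] at this
      linarith
    · rw [mker_eq_zero hε (not_lt.1 ht)]; simp
  have hUl : LocallyIntegrable U := by
    have h1 : LocallyIntegrable (fun _ : Fin n → ℂ => M) := locallyIntegrable_const M
    exact h1.mono hU.aestronglyMeasurable (ae_of_all _ fun z => by
      rw [Real.norm_eq_abs]; exact (hUb z).trans (le_abs_self M))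
  calc mol n ε U z = ∫ t, mker n ε t * U (z - t) := by simp [mol_apply]
    _ ≤ ∫ t, (1 / (2 * Real.pi)) * ∫ θ, mker n ε t * U (z - t + c θ) ∂ν :=
      integral_mono (integrable_mker_smul hε hUl z) (hinteg.integral_prod_left.const_mul _) hm
    _ = (1 / (2 * Real.pi)) * ∫ θ, (∫ t, mker n ε t * U (z - t + c θ)) ∂ν := by
      rw [integral_const_mul, integral_integral_swap hinteg]
    _ = _ := by
      rw [intervalIntegral.integral_of_le (by positivity)]
      congr 1
      refine integral_congr_ae (ae_of_all _ fun θ => ?_)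
      simp only [mol_apply, smul_eq_mul]
      refine integral_congr_ae (ae_of_all _ fun t => ?_)
      simp only [hc, sub_add_eq_add_sub]

theorem PseudoconvexExh.exists_exhaustion {n : ℕ} {Ω K : Set (Fin n → ℂ)} (hΩ : IsOpen Ω)
    (h : PseudoconvexExh n Ω) (hK : IsCompact K) (hKΩ : K ⊆ Ω) :
    ∃ (V : Set (Fin n → ℂ)) (s : (Fin n → ℂ) → ℝ) (c0 : ℝ), IsOpen V ∧ V ⊆ Ω ∧ K ⊆ V ∧
      ContDiff ℝ (⊤ : ℕ∞) s ∧ (∀ z ∈ V, 0 < s z) ∧ (∀ t, 0 < t → IsCompact {z ∈ V | t ≤ s z}) ∧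
      0 < c0 ∧ (∀ z ∈ V, ∀ X, c0 * ∑ j, ‖X j‖ ^ 2 ≤ -hermForm n (cHess n s z) X X) ∧
      ∀ z ∈ K, 1 / 2 ≤ s z := by
  obtain ⟨u, huc, ⟨-, hup⟩, hex⟩ := h
  obtain ⟨c, hc⟩ : ∃ c, ∀ z ∈ K, u z ≤ c := by
    obtain ⟨c, hc⟩ := hK.exists_bound_of_continuousOn (huc.mono hKΩ)
    exact ⟨c, fun z hz => (le_abs_self _).trans (hc z hz)⟩
  obtain ⟨L, hL, hLΩ, hLu⟩ := hex (c + 3)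
  obtain ⟨δ, hδ, hδΩ⟩ := hL.exists_cthickening_subset_open hΩ hLΩ
  set L' := Metric.cthickening δ L with hL'
  have hL'c : IsCompact L' := hL.cthickening
  obtain ⟨M, hM⟩ := hL'c.exists_bound_of_continuousOn (huc.mono hδΩ)
  have hM0 : ∀ x ∈ L', |u x| ≤ |M| := fun x hx => (hM x hx).trans (le_abs_self _)
  set U : (Fin n → ℂ) → ℝ := L'.indicator u with hU
  have hUm : Measurable U := by
    classical
    rw [hU, ← piecewise_eq_indicator]
    exact (huc.mono hδΩ).measurable_piecewise continuousOn_const hL'c.measurableSet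
  have hUb : ∀ z, |U z| ≤ |M| := fun z => by
    by_cases hz : z ∈ L'
    · rw [hU, indicator_of_mem hz]; exact hM0 z hz
    · rw [hU, indicator_of_notMem hz, abs_zero]; positivity
  have hUl : LocallyIntegrable U := by
    have h1 : LocallyIntegrable (fun _ : Fin n → ℂ => |M|) := locallyIntegrable_const _
    exact h1.mono hUm.aestronglyMeasurable (ae_of_all _ fun z => by
      rw [Real.norm_eq_abs, Real.norm_eq_abs, abs_abs]; exact hUb z)
  have near : ∀ z ∈ L, ∀ y, ‖y - z‖ ≤ δ → y ∈ L' := fun z hz y hy =>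
    Metric.mem_cthickening_of_dist_le y z δ L hz (by rwa [dist_eq_norm])
  obtain ⟨η, hη, hηu⟩ := Metric.uniformContinuousOn_iff.1
    (hL'c.uniformContinuousOn_of_continuous (huc.mono hδΩ)) (1 / 4) (by norm_num)
  set ε := min η (δ / 2) with hε
  have hε0 : 0 < ε := lt_min hη (by positivity)
  have hεδ : ε ≤ δ / 2 := min_le_right _ _
  set g := mol n ε U with hg
  have hgs : ContDiff ℝ (⊤ : ℕ∞) g := contDiff_mol hε0 hUl
  have hgu : ∀ z ∈ L, |g z - u z| ≤ 1 / 4 := by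
    intro z hz
    have e1 : g z - u z = ∫ t, mker n ε t * (U (z - t) - u z) := by
      have i1 : Integrable fun t => mker n ε t * U (z - t) := integrable_mker_smul hε0 hUl z
      simp only [mul_sub]
      rw [integral_sub i1 ((integrable_mker hε0).mul_const _),
        integral_mul_const, integral_mker hε0, one_mul]
      rfl
    rw [e1, ← Real.norm_eq_abs]
    refine (norm_integral_le_of_norm_le ((integrable_mker hε0).mul_const (1 / 4))
      (ae_of_all _ fun t => ?_)).trans_eq (by rw [integral_mul_const, integral_mker hε0, one_mul])
    rw [norm_mul, Real.norm_of_nonneg (mker_nonneg hε0 t)]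
    by_cases ht : ‖t‖ < ε
    · refine mul_le_mul_of_nonneg_left ?_ (mker_nonneg hε0 t)
      have hm : z - t ∈ L' := near z hz _ (by
        rw [sub_sub_cancel_left, norm_neg]; linarith)
      rw [hU, indicator_of_mem hm, ← dist_eq_norm]
      exact (hηu _ hm _ (near z hz z (by simp [hδ.le])) (by
        rw [dist_eq_norm, sub_sub_cancel_left, norm_neg]
        exact ht.trans_le (min_le_left _ _))).le
    · rw [mker_eq_zero hε0 (not_lt.1 ht)]; simp
  have hgp : ∀ z ∈ L, ∀ X, 0 ≤ hermForm n (cHess n g z) X X := by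
    intro z hz X
    have h2 : ContDiff ℝ 2 g := hgs.of_le (WithTop.coe_le_coe.2 (le_top : ((2 : ℕ) : ℕ∞) ≤ ⊤))
    rw [hermForm_cHess_eq h2.contDiffAt]
    refine mul_nonneg (by norm_num) (nonneg_of_submean h2 ?_)
    have hsm : ∀ᶠ r in 𝓝[>] (0 : ℝ), r * ‖X‖ ≤ δ / 2 := by
      have : Tendsto (fun r : ℝ => r * ‖X‖) (𝓝[>] 0) (𝓝 0) :=
        (Continuous.tendsto' (by fun_prop) 0 0 (by simp)).mono_left nhdsWithin_le_nhds
      exact this.eventually (ge_mem_nhds (by positivity))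
    filter_upwards [hsm, self_mem_nhdsWithin] with r hr hr0
    replace hr0 : 0 < r := hr0
    refine mol_le_circle_average hε0 hUm hUb fun t ht => ?_
    have hin : ∀ a : ℂ, ‖a‖ ≤ r → z - t + a • X ∈ L' := fun a ha => near z hz _ (by
      calc ‖z - t + a • X - z‖ = ‖a • X - t‖ := by congr 1; abel
        _ ≤ ‖a‖ * ‖X‖ + ‖t‖ := (norm_sub_le _ _).trans_eq (by rw [norm_smul])
        _ ≤ r * ‖X‖ + ‖t‖ := by gcongr
        _ ≤ δ := by linarith)
    have h3 := hup (z - t) (hδΩ (by simpa using hin 0 (by simpa using hr0.le))) X r hr0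
      fun a ha => hδΩ (hin a ha)
    have e1 : U (z - t) = u (z - t) :=
      indicator_of_mem (by simpa using hin 0 (by simpa using hr0.le)) _
    have e2 : ∀ θ : ℝ, U (z - t + ((r : ℂ) * Complex.exp ((θ : ℂ) * Complex.I)) • X)
        = u (z - t + ((r : ℂ) * Complex.exp ((θ : ℂ) * Complex.I)) • X) := fun θ =>
      indicator_of_mem (hin _ (by
        rw [norm_mul, norm_exp_ofReal_mul_I, norm_real, Real.norm_of_nonneg hr0.le, mul_one])) _
    simp only [e1, e2]
    exact h3
  obtain ⟨R, hR⟩ := hL.exists_bound_of_continuousOn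
    (contDiff_esq (n := n) (k := 0)).continuous.continuousOn
  have hR' : ∀ z ∈ L, esq z ≤ |R| := fun z hz => (le_abs_self _).trans ((hR z hz).trans
    (le_abs_self _))
  set κ : ℝ := 1 / (4 * (|R| + 1)) with hκ
  have hκ0 : 0 < κ := by positivity
  have hκR : ∀ z ∈ L, κ * esq z ≤ 1 / 4 := by
    intro z hz
    rw [hκ, div_mul_eq_mul_div, div_le_div_iff₀ (by positivity) (by norm_num)]
    nlinarith [hR' z hz]
  set ρ : (Fin n → ℂ) → ℝ := fun z => g z + (κ * esq (z - 0) + -(c + 1)) with hρ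
  have hρz : ∀ z, ρ z = g z + κ * esq z - (c + 1) := fun z => by simp only [hρ, sub_zero]; ring
  have hρs : ContDiff ℝ (⊤ : ℕ∞) ρ := by
    have := contDiff_esq (n := n) (k := (⊤ : ℕ∞))
    exact hgs.add ((contDiff_const.mul (this.comp (contDiff_id.sub contDiff_const))).add
      contDiff_const)
  have hsub : ∀ z ∈ Ω, u z < c + 3 → z ∈ L := fun z hz hu => hLu ⟨hz, hu.le⟩
  refine ⟨{z ∈ Ω | u z < c + 3} ∩ {z | ρ z < 0}, fun z => -ρ z, κ, ?_, ?_, ?_, hρs.neg, ?_, ?_,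
    hκ0, ?_, ?_⟩
  · exact (huc.isOpen_inter_preimage hΩ isOpen_Iio).inter
      (isOpen_lt hρs.continuous continuous_const)
  · exact fun z hz => hz.1.1
  · intro z hz
    have hzL := hsub z (hKΩ hz) (by linarith [hc z hz])
    refine ⟨⟨hKΩ hz, by linarith [hc z hz]⟩, ?_⟩
    have := abs_le.1 (hgu z hzL)
    simp only [mem_ofPred_eq, hρz]
    linarith [hc z hz, hκR z hzL]
  · exact fun z hz => neg_pos.2 hz.2
  · intro t ht
    have e : {z | z ∈ {z ∈ Ω | u z < c + 3} ∩ {z | ρ z < 0} ∧ t ≤ -ρ z}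
        = (L ∩ u ⁻¹' Iic (c + 2)) ∩ {z | t ≤ -ρ z} := by
      ext z
      constructor
      · rintro ⟨⟨⟨h1, h2⟩, h3⟩, h4⟩
        have hzL := hsub z h1 h2
        refine ⟨⟨hzL, ?_⟩, h4⟩
        have := abs_le.1 (hgu z hzL)
        simp only [mem_ofPred_eq, hρz] at h3
        simp only [mem_preimage, mem_Iic]
        have := mul_nonneg hκ0.le (esq_nonneg z)
        linarith
      · rintro ⟨⟨h1, h2⟩, h3⟩
        simp only [mem_preimage, mem_Iic] at h2
        simp only [mem_ofPred_eq] at h3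
        exact ⟨⟨⟨hLΩ h1, by linarith⟩, by simp only [mem_ofPred_eq]; linarith⟩, h3⟩
    rw [e]
    refine IsCompact.inter_right ?_ (isClosed_le continuous_const hρs.continuous.neg)
    exact hL.of_isClosed_subset ((huc.mono hLΩ).preimage_isClosed_of_isClosed hL.isClosed
      isClosed_Iic) inter_subset_left
  · intro z hz X
    have hzL := hsub z hz.1.1 hz.1.2
    have h2 : ∀ {f : (Fin n → ℂ) → ℝ}, ContDiff ℝ (⊤ : ℕ∞) f → ContDiffAt ℝ 2 f z := fun hf =>
      (hf.of_le (WithTop.coe_le_coe.2 (le_top : ((2 : ℕ) : ℕ∞) ≤ ⊤))).contDiffAt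
    have he : ContDiff ℝ (⊤ : ℕ∞) fun z : Fin n → ℂ => esq (z - 0) :=
      contDiff_esq.comp (contDiff_id.sub contDiff_const)
    have hq : ContDiff ℝ 2 fun x : ℝ => κ * x + -(c + 1) := by fun_prop
    have hqd : (deriv fun x : ℝ => κ * x + -(c + 1)) = fun _ => κ := by
      ext x
      simp
    rw [cHess_neg, neg_neg, hρ, hermForm_cHess_add (h2 hgs)
      ((contDiffAt_const.mul (h2 he)).add contDiffAt_const),
      hermForm_cHess_comp (g := fun x => κ * x + -(c + 1)) (S := fun z => esq (z - 0))
        hq.contDiffAt (h2 he), hermForm_cHess_esq, hqd]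
    simp only [deriv_const, zero_mul, add_zero]
    linarith [hgp z hzL X]
  · intro z hz
    have hzL := hsub z (hKΩ hz) (by linarith [hc z hz])
    have := abs_le.1 (hgu z hzL)
    change 1 / 2 ≤ -ρ z
    rw [hρz]
    linarith [hc z hz, hκR z hzL]

/-! ### Weak solutions of the `∂̄`-equation with weighted estimates -/

theorem exists_bound_of_isBounded {n : ℕ} {Ω : Set (Fin n → ℂ)} (hb : Bornology.IsBounded Ω)
    {w : (Fin n → ℂ) → ℝ} (hw : Continuous w) : ∃ M, ∀ z ∈ Ω, ‖w z‖ ≤ M := by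
  obtain ⟨M, hM⟩ := hb.isCompact_closure.exists_bound_of_continuousOn hw.continuousOn
  exact ⟨M, fun z hz => hM z (subset_closure hz)⟩

theorem integrableOn_mul_of_isBounded {n : ℕ} {Ω : Set (Fin n → ℂ)} (hΩ : IsOpen Ω)
    (hb : Bornology.IsBounded Ω) {f w : (Fin n → ℂ) → ℝ} (hf : IntegrableOn f Ω)
    (hw : Continuous w) : IntegrableOn (fun z => f z * w z) Ω := by
  obtain ⟨M, hM⟩ := exists_bound_of_isBounded hb hw
  exact Integrable.mul_bdd (c := M) hf hw.aestronglyMeasurable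
    ((ae_restrict_iff' hΩ.measurableSet).2 (ae_of_all _ hM))

theorem integrableOn_norm_sq_sum {n : ℕ} {Ω : Set (Fin n → ℂ)} {α : Fin n → (Fin n → ℂ) → ℂ}
    (hα : ∀ j, MemLp (α j) 2 (volume.restrict Ω)) :
    IntegrableOn (fun z => ∑ j, ‖α j z‖ ^ 2) Ω :=
  integrable_finsetSum _ fun j _ => (hα j).integrable_norm_pow (p := 2) (by norm_num)

theorem PseudoconvexExh.dual_estimate {n : ℕ} {Ω : Set (Fin n → ℂ)} {φ : (Fin n → ℂ) → ℝ}
    (hΩ : IsOpen Ω) (hb : Bornology.IsBounded Ω) (h : PseudoconvexExh n Ω)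
    (hφ : ContDiff ℝ (⊤ : ℕ∞) φ)
    (hφH : ∀ z ∈ Ω, ∀ X, ∑ j, ‖X j‖ ^ 2 ≤ hermForm n (cHess n φ z) X X)
    {α γ : Fin n → (Fin n → ℂ) → ℂ} (hα : ∀ j, MemLp (α j) 2 (volume.restrict Ω))
    (hαcl : ∀ j k κ, IsTestFun n κ Ω →
      ∫ z in Ω, (α j z * wderBar n k κ z - α k z * wderBar n j κ z) = 0)
    (hγ : ∀ j, IsTestFun n (γ j) Ω) :
    ‖∫ z in Ω, ∑ j, α j z * γ j z‖ ^ 2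
      ≤ 2 * Real.exp 1 * (∫ z in Ω, (∑ j, ‖α j z‖ ^ 2) * Real.exp (-φ z))
        * ∫ z in Ω, ‖∑ j, wderBar n j (γ j) z‖ ^ 2 * Real.exp (φ z) := by
  have hKc : IsCompact (⋃ j, tsupport (γ j)) := isCompact_iUnion fun j => (hγ j).2.1
  obtain ⟨V, s, c0, hV, hVΩ, hKV, hs, hspos, hK, hc0, hsH, hsK⟩ :=
    h.exists_exhaustion hΩ hKc (iUnion_subset fun j => (hγ j).2.2)
  have hsub : ∀ j, tsupport (γ j) ⊆ V := fun j => (subset_iUnion _ j).trans hKV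
  have e1 : ∫ z in Ω, ∑ j, α j z * γ j z = ∫ z in V, ∑ j, α j z * γ j z := by
    refine setIntegral_eq_of_subset_of_forall_sdiff_eq_zero hΩ.measurableSet hVΩ fun z hz => ?_
    refine Finset.sum_eq_zero fun j _ => ?_
    rw [image_eq_zero_of_notMem_tsupport fun h => hz.2 (hsub j h), mul_zero]
  have e2 : ∫ z in Ω, ‖∑ j, wderBar n j (γ j) z‖ ^ 2 * Real.exp (φ z)
      = ∫ z in V, ‖∑ j, wderBar n j (γ j) z‖ ^ 2 * Real.exp (φ z) := by
    refine setIntegral_eq_of_subset_of_forall_sdiff_eq_zero hΩ.measurableSet hVΩ fun z hz => ?_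
    rw [Finset.sum_eq_zero fun j _ =>
      wderBar_eq_zero_of_notMem_tsupport fun h => hz.2 (hsub j h)]
    simp
  rw [e1, e2]
  refine (_root_.dual_estimate hV (hb.subset hVΩ) hs hspos hK one_half_pos hc0 hsH hφ
    (fun z hz => hφH z (hVΩ hz)) (fun j => (hα j).mono_measure (Measure.restrict_mono_set _ hVΩ))
    (fun j k κ hκ => ?_) (fun j => ⟨(hγ j).1, (hγ j).2.1, hsub j⟩)
    (fun j z hz => hsK z (mem_iUnion.2 ⟨j, hz⟩))).trans ?_
  · refine Eq.trans ?_ (hαcl j k κ ⟨hκ.1, hκ.2.1, hκ.2.2.trans hVΩ⟩)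
    refine (setIntegral_eq_of_subset_of_forall_sdiff_eq_zero hΩ.measurableSet hVΩ
      fun z hz => ?_).symm
    rw [wderBar_eq_zero_of_notMem_tsupport fun h => hz.2 (hκ.2.2 h),
      wderBar_eq_zero_of_notMem_tsupport fun h => hz.2 (hκ.2.2 h)]
    ring
  · have hm : ∫ z in V, (∑ j, ‖α j z‖ ^ 2) * Real.exp (-φ z)
        ≤ ∫ z in Ω, (∑ j, ‖α j z‖ ^ 2) * Real.exp (-φ z) :=
      setIntegral_mono_set (integrableOn_mul_of_isBounded hΩ hb (integrableOn_norm_sq_sum hα)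
        (Real.continuous_exp.comp hφ.continuous.neg)) (ae_of_all _ fun z => by positivity)
        (LE.le.eventuallyLE hVΩ)
    refine mul_le_mul_of_nonneg_right (mul_le_mul_of_nonneg_left hm (by positivity)) ?_
    exact integral_nonneg fun z => by positivity

theorem exists_inner_eq_of_norm_le {H M : Type*} [NormedAddCommGroup H] [InnerProductSpace ℂ H]
    [CompleteSpace H] [AddCommGroup M] [Module ℂ M] (T : M →ₗ[ℂ] H) (ℓ : M →ₗ[ℂ] ℂ) {C : ℝ}
    (hC : 0 ≤ C) (h : ∀ v, ‖ℓ v‖ ≤ C * ‖T v‖) :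
    ∃ w : H, ‖w‖ ≤ C ∧ ∀ v, inner ℂ w (T v) = ℓ v := by
  obtain ⟨g, hg⟩ := T.rangeRestrict.exists_rightInverse_of_surjective T.range_rangeRestrict
  have hg' : ∀ y : LinearMap.range T, T (g y) = y := fun y =>
    congrArg Subtype.val (LinearMap.congr_fun hg y)
  obtain ⟨F, hF1, hF2⟩ := exists_extension_norm_eq (LinearMap.range T)
    ((ℓ ∘ₗ g).mkContinuous C fun y => (h (g y)).trans_eq (by rw [hg']; rfl))
  refine ⟨(InnerProductSpace.toDual ℂ H).symm F, ?_, fun v => ?_⟩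
  · rw [LinearIsometryEquiv.norm_map, hF2]
    exact LinearMap.mkContinuous_norm_le _ hC _
  · rw [InnerProductSpace.toDual_symm_apply]
    have h1 : F (T v) = ℓ (g ⟨T v, LinearMap.mem_range_self T v⟩) := hF1 ⟨T v, _⟩
    rw [h1, ← sub_eq_zero, ← map_sub, ← norm_le_zero_iff]
    refine (h _).trans_eq ?_
    rw [map_sub, hg', sub_self, norm_zero, mul_zero]

theorem IsTestFun.zero {n : ℕ} {Ω : Set (Fin n → ℂ)} : IsTestFun n 0 Ω :=
  ⟨contDiff_const, HasCompactSupport.zero, by simp⟩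

theorem IsTestFun.add {n : ℕ} {Ω : Set (Fin n → ℂ)} {f g : (Fin n → ℂ) → ℂ}
    (hf : IsTestFun n f Ω) (hg : IsTestFun n g Ω) : IsTestFun n (f + g) Ω :=
  ⟨hf.1.add hg.1, hf.2.1.add hg.2.1, (tsupport_add f g).trans (union_subset hf.2.2 hg.2.2)⟩

theorem IsTestFun.smul {n : ℕ} {Ω : Set (Fin n → ℂ)} {f : (Fin n → ℂ) → ℂ} (c : ℂ)
    (hf : IsTestFun n f Ω) : IsTestFun n (c • f) Ω :=
  ⟨hf.1.const_smul c, hf.2.1.smul_left, (tsupport_smul_subset_right (fun _ => c) f).trans hf.2.2⟩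

theorem IsTestFun.differentiable {n : ℕ} {Ω : Set (Fin n → ℂ)} {f : (Fin n → ℂ) → ℂ}
    (hf : IsTestFun n f Ω) : Differentiable ℝ f :=
  hf.1.differentiable (by simp)

theorem wderBar_const_smul {n : ℕ} {j : Fin n} {f : (Fin n → ℂ) → ℂ} {z : Fin n → ℂ} (c : ℂ)
    (hf : DifferentiableAt ℝ f z) : wderBar n j (c • f) z = c * wderBar n j f z := by
  simp only [wderBar, fderiv_const_smul hf c, _root_.smul_apply, smul_eq_mul]
  ring

/-- Tuples of test functions. -/
def testTuples (n : ℕ) (Ω : Set (Fin n → ℂ)) : Submodule ℂ (Fin n → (Fin n → ℂ) → ℂ) where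
  carrier := {γ | ∀ j, IsTestFun n (γ j) Ω}
  zero_mem' := fun _ => IsTestFun.zero
  add_mem' := fun hf hg j => (hf j).add (hg j)
  smul_mem' := fun c _ hf j => (hf j).smul c

theorem exists_dbar_solution {n : ℕ} {Ω : Set (Fin n → ℂ)} {φ : (Fin n → ℂ) → ℝ}
    (hΩ : IsOpen Ω) (hb : Bornology.IsBounded Ω) (h : PseudoconvexExh n Ω)
    (hφ : ContDiff ℝ (⊤ : ℕ∞) φ)
    (hφH : ∀ z ∈ Ω, ∀ X, ∑ j, ‖X j‖ ^ 2 ≤ hermForm n (cHess n φ z) X X)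
    {α : Fin n → (Fin n → ℂ) → ℂ} (hα : ∀ j, MemLp (α j) 2 (volume.restrict Ω))
    (hαcl : ∀ j k κ, IsTestFun n κ Ω →
      ∫ z in Ω, (α j z * wderBar n k κ z - α k z * wderBar n j κ z) = 0) :
    ∃ u : (Fin n → ℂ) → ℂ, MemLp u 2 (volume.restrict Ω) ∧
      ∫ z in Ω, ‖u z‖ ^ 2 * Real.exp (-φ z)
        ≤ 2 * Real.exp 1 * (∫ z in Ω, (∑ j, ‖α j z‖ ^ 2) * Real.exp (-φ z)) ∧
      ∀ j κ, IsTestFun n κ Ω →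
        ∫ z in Ω, u z * wderBar n j κ z = -∫ z in Ω, α j z * κ z := by
  set A : ℝ := 2 * Real.exp 1 * (∫ z in Ω, (∑ j, ‖α j z‖ ^ 2) * Real.exp (-φ z)) with hA
  have hA0 : 0 ≤ A := mul_nonneg (by positivity) (integral_nonneg fun z => by positivity)
  have hec : Continuous fun z => (Real.exp (φ z / 2) : ℂ) :=
    continuous_ofReal.comp (Real.continuous_exp.comp (hφ.continuous.div_const 2))
  have hc1 : ∀ γ : testTuples n Ω, ∀ j, Continuous (wderBar n j (γ.1 j)) := fun γ j =>
    ((γ.2 j).1.of_le (by simp)).continuous_wderBar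
  have hmem : ∀ γ : testTuples n Ω,
      MemLp (fun z => (Real.exp (φ z / 2) : ℂ) * ∑ j, wderBar n j (γ.1 j) z) 2
        (volume.restrict Ω) := by
    intro γ
    simp only [Finset.mul_sum]
    refine memLp_finsetSum _ fun j _ => ?_
    exact (hec.mul (hc1 γ j)).memLp_of_hasCompactSupport ((γ.2 j).2.1.wderBar.mul_left)
  have hinteg : ∀ γ : testTuples n Ω, ∀ j,
      Integrable (fun z => α j z * γ.1 j z) (volume.restrict Ω) := fun γ j =>
    MemLp.integrable_mul (p := 2) (q := 2) (hα j)
      ((γ.2 j).1.continuous.memLp_of_hasCompactSupport (γ.2 j).2.1)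
  let T : testTuples n Ω →ₗ[ℂ] Lp ℂ 2 (volume.restrict Ω) :=
    { toFun := fun γ => (hmem γ).toLp
      map_add' := fun γ δ => by
        rw [← MemLp.toLp_add]
        congr 1
        ext z
        simp only [Pi.add_apply, ← mul_add, ← Finset.sum_add_distrib]
        congr 1
        refine Finset.sum_congr rfl fun j _ => ?_
        exact wderBar_add ((γ.2 j).differentiable z) ((δ.2 j).differentiable z)
      map_smul' := fun c γ => by
        rw [RingHom.id_apply, ← MemLp.toLp_const_smul]
        congr 1
        ext z
        simp only [Pi.smul_apply, smul_eq_mul, mul_left_comm c, Finset.mul_sum]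
        refine Finset.sum_congr rfl fun j _ => ?_
        congr 1
        exact wderBar_const_smul c ((γ.2 j).differentiable z) }
  let ℓ : testTuples n Ω →ₗ[ℂ] ℂ :=
    { toFun := fun γ => ∫ z in Ω, ∑ j, α j z * γ.1 j z
      map_add' := fun γ δ => by
        rw [← integral_add (integrable_finsetSum _ fun j _ => hinteg γ j)
          (integrable_finsetSum _ fun j _ => hinteg δ j)]
        simp [mul_add, Finset.sum_add_distrib]
      map_smul' := fun c γ => by
        rw [RingHom.id_apply, smul_eq_mul, ← integral_const_mul]
        simp [Finset.mul_sum, mul_left_comm c] }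
  have hT : ∀ γ : testTuples n Ω, ‖T γ‖ ^ 2
      = ∫ z in Ω, ‖∑ j, wderBar n j (γ.1 j) z‖ ^ 2 * Real.exp (φ z) := by
    intro γ
    change ‖(hmem γ).toLp‖ ^ 2 = _
    rw [Lp.norm_toLp, ← ENNReal.toReal_pow, ← integral_norm_sq_eq (hmem γ).1]
    refine integral_congr_ae (ae_of_all _ fun z => ?_)
    simp only [norm_mul, mul_pow, norm_real, Real.norm_eq_abs, sq_abs]
    rw [← Real.exp_nat_mul, mul_comm]
    congr 2
    push_cast
    ring
  obtain ⟨w, hw, hw'⟩ := exists_inner_eq_of_norm_le T ℓ (Real.sqrt_nonneg A) fun γ => by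
    have := h.dual_estimate hΩ hb hφ hφH hα hαcl γ.2
    rw [← hT, ← hA] at this
    rw [← Real.sqrt_sq (norm_nonneg (T γ)), ← Real.sqrt_mul hA0]
    exact Real.le_sqrt_of_sq_le this
  have hwm : MemLp (w : (Fin n → ℂ) → ℂ) 2 (volume.restrict Ω) := Lp.memLp w
  have hcm : MemLp (fun z => starRingEnd ℂ (w z)) 2 (volume.restrict Ω) := hwm.star
  obtain ⟨M, hM⟩ := exists_bound_of_isBounded hb
    (Real.continuous_exp.comp (hφ.continuous.div_const 2))
  refine ⟨fun z => -((Real.exp (φ z / 2) : ℂ) * starRingEnd ℂ (w z)), ?_, ?_, ?_⟩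
  · refine MemLp.neg ?_
    refine MemLp.of_le_mul (c := M) hcm
      (hec.aestronglyMeasurable.mul hcm.aestronglyMeasurable) ?_
    refine (ae_restrict_iff' hΩ.measurableSet).2 (ae_of_all _ fun z hz => ?_)
    rw [norm_mul, norm_real]
    exact mul_le_mul_of_nonneg_right (hM z hz) (norm_nonneg _)
  · have h1 : ‖w‖ ^ 2 ≤ A := (pow_le_pow_left₀ (norm_nonneg _) hw 2).trans_eq (Real.sq_sqrt hA0)
    refine le_trans (le_of_eq ?_) h1
    rw [Lp.norm_def, ← ENNReal.toReal_pow, ← integral_norm_sq_eq hwm.1]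
    refine integral_congr_ae (ae_of_all _ fun z => ?_)
    simp only [norm_neg, norm_mul, mul_pow, norm_real, Real.norm_eq_abs, sq_abs, RCLike.norm_conj]
    rw [← Real.exp_nat_mul, mul_right_comm, ← Real.exp_add]
    push_cast
    rw [show 2 * (φ z / 2) + -φ z = 0 by ring, Real.exp_zero, one_mul]
  · intro j κ hκ
    classical
    have hγ : Pi.single j κ ∈ testTuples n Ω := by
      intro k
      by_cases hk : k = j
      · subst hk; simpa using hκ
      · rw [Pi.single_eq_of_ne hk]; exact IsTestFun.zero
    have h1 : inner ℂ w (T ⟨_, hγ⟩) = ∫ z in Ω, ∑ k, α k z * (Pi.single j κ : Fin n → (Fin n → ℂ) → ℂ) k z :=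
      hw' _
    have h2 : ∀ z, ∑ k, α k z * (Pi.single j κ : Fin n → (Fin n → ℂ) → ℂ) k z = α j z * κ z := by
      intro z
      rw [Finset.sum_eq_single j]
      · simp
      · intro k _ hk; simp [Pi.single_eq_of_ne hk]
      · simp
    have h3 : ∀ z, ∑ k, wderBar n k ((Pi.single j κ : Fin n → (Fin n → ℂ) → ℂ) k) z
        = wderBar n j κ z := by
      intro z
      rw [Finset.sum_eq_single j]
      · simp
      · intro k _ hk
        rw [Pi.single_eq_of_ne hk]
        exact wderBar_eq_zero_of_notMem_tsupport (by simp)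
      · simp
    simp only [h2] at h1
    have h4 : (T ⟨_, hγ⟩ : (Fin n → ℂ) → ℂ) =ᵐ[volume.restrict Ω] fun z =>
        (Real.exp (φ z / 2) : ℂ) * ∑ k, wderBar n k ((Pi.single j κ : Fin n → (Fin n → ℂ) → ℂ) k) z :=
      (hmem ⟨_, hγ⟩).coeFn_toLp
    rw [← h1, L2.inner_def, ← integral_neg]
    refine integral_congr_ae ?_
    filter_upwards [h4] with z hz
    rw [hz]
    simp only [h3, RCLike.inner_apply]
    ring

/-! ### Mean value property and Weyl's lemma -/

theorem integral_comp_unit_smul {n : ℕ} {F : Type*} [NormedAddCommGroup F] [NormedSpace ℝ F] {c : ℂ}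
    (hc : ‖c‖ = 1) (h : (Fin n → ℂ) → F) : ∫ t, h (c • t) = ∫ t, h t := by
  have h1 : MeasurePreserving (fun x : ℂ => c * x) :=
    (rotation ⟨c, by simpa [Submonoid.unitSphere] using hc⟩).measurePreserving
  have h2 : MeasurePreserving (fun t : Fin n → ℂ => fun i => c * t i) :=
    volume_preserving_pi fun _ => h1
  have hc0 : c ≠ 0 := fun h => by simp [h] at hc
  exact h2.integral_comp (Homeomorph.smulOfNeZero c hc0).measurableEmbedding h

theorem integral_circle_eq {n : ℕ} {f : (Fin n → ℂ) → ℂ} {z t : Fin n → ℂ} {δ : ℝ}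
    (hf : ∀ y ∈ Metric.closedBall z δ, DifferentiableAt ℂ f y) (ht : ‖t‖ ≤ δ) :
    ∫ θ in (0 : ℝ)..(2 * Real.pi), f (z - Complex.exp ((θ : ℂ) * I) • t)
      = (2 * Real.pi : ℝ) * f z := by
  have hd : ∀ ζ ∈ Metric.closedBall (0 : ℂ) 1, DifferentiableAt ℂ (fun ζ => f (z - ζ • t)) ζ := by
    intro ζ hζ
    have hm : z - ζ • t ∈ Metric.closedBall z δ := by
      rw [mem_closedBall_zero_iff] at hζ
      rw [mem_closedBall_iff_norm, sub_sub_cancel_left, norm_neg, norm_smul]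
      nlinarith [norm_nonneg t, norm_nonneg ζ]
    exact DifferentiableAt.comp (g := f) (f := fun ζ : ℂ => z - ζ • t) ζ (hf _ hm) (by fun_prop)
  have h := circleAverage_of_differentiable_on_off_countable (f := fun ζ => f (z - ζ • t))
    (c := 0) (R := 1) countable_empty
    (fun ζ hζ => (hd ζ (by simpa using hζ)).continuousAt.continuousWithinAt)
    (fun ζ hζ => hd ζ (by simpa using (Metric.ball_subset_closedBall hζ.1)))
  simp only [Real.circleAverage, circleMap, zero_smul, sub_zero, ofReal_one, one_mul, zero_add,
    real_smul] at h
  rw [← h, ← mul_assoc, ← ofReal_mul, mul_inv_cancel₀ (by positivity), ofReal_one, one_mul]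

theorem integral_mul_eq_of_differentiableAt {n : ℕ} {f : (Fin n → ℂ) → ℂ} {ψ : (Fin n → ℂ) → ℝ}
    {z : Fin n → ℂ} {δ : ℝ} (hψ : Integrable ψ) (hψr : ∀ c : ℂ, ‖c‖ = 1 → ∀ t, ψ (c • t) = ψ t)
    (hψ0 : ∀ t, δ < ‖t‖ → ψ t = 0) (hf : ∀ y ∈ Metric.closedBall z δ, DifferentiableAt ℂ f y) :
    ∫ t, (ψ t : ℂ) * f (z - t) = ((∫ t, ψ t : ℝ) : ℂ) * f z := by
  set B := Metric.closedBall z δ with hB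
  have hfc : ContinuousOn f B := fun y hy => (hf y hy).continuousAt.continuousWithinAt
  obtain ⟨M, hM⟩ := (isCompact_closedBall z δ).exists_bound_of_continuousOn hfc
  set F : (Fin n → ℂ) → ℂ := B.indicator f with hF
  have hFm : Measurable F := by
    classical
    rw [hF, ← piecewise_eq_indicator]
    exact hfc.measurable_piecewise continuousOn_const Metric.isClosed_closedBall.measurableSet
  have hFb : ∀ y, ‖F y‖ ≤ |M| := fun y => by
    by_cases hy : y ∈ B
    · rw [hF, indicator_of_mem hy]; exact (hM y hy).trans (le_abs_self M)
    · rw [hF, indicator_of_notMem hy, norm_zero]; positivity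
  have hFf : ∀ t, ‖t‖ ≤ δ → F (z - t) = f (z - t) := fun t ht => by
    refine indicator_of_mem ?_ _
    rw [hB, mem_closedBall_iff_norm, sub_sub_cancel_left, norm_neg]
    exact ht
  have hpi := Real.pi_pos
  set e : ℝ → ℂ := fun θ => Complex.exp ((θ : ℂ) * I) with he
  have hen : ∀ θ, ‖e θ‖ = 1 := fun θ => norm_exp_ofReal_mul_I θ
  have hec : Continuous e := by fun_prop
  set ν := (volume : Measure ℝ).restrict (Ioc 0 (2 * Real.pi)) with hν
  have hψC : Integrable fun t => (ψ t : ℂ) := hψ.ofReal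
  have hψi : ∫ t, (ψ t : ℂ) = ((∫ t, ψ t : ℝ) : ℂ) := integral_ofReal
  have hinteg : Integrable (Function.uncurry fun (t : Fin n → ℂ) (θ : ℝ) =>
      (ψ t : ℂ) * F (z - e θ • t)) (volume.prod ν) := by
    refine Integrable.mul_bdd (c := |M|) (hψC.comp_fst ν) ?_ (ae_of_all _ fun p => hFb _)
    exact (hFm.comp (by fun_prop : Measurable fun p : (Fin n → ℂ) × ℝ =>
      z - e p.2 • p.1)).aestronglyMeasurable
  have h1 : ∀ θ, ∫ t, (ψ t : ℂ) * F (z - e θ • t) = ∫ t, (ψ t : ℂ) * F (z - t) := by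
    intro θ
    rw [← integral_comp_unit_smul (hen θ) fun t => (ψ t : ℂ) * F (z - t)]
    simp only [hψr _ (hen θ)]
  have h2 : ∀ t, ∫ θ, (ψ t : ℂ) * F (z - e θ • t) ∂ν
      = (ψ t : ℂ) * (((2 * Real.pi : ℝ) : ℂ) * f z) := by
    intro t
    rw [integral_const_mul]
    by_cases ht : ‖t‖ ≤ δ
    · rw [← integral_circle_eq hf ht, intervalIntegral.integral_of_le (by positivity)]
      congr 2
      ext θ
      exact hFf _ (by rw [norm_smul, hen, one_mul]; exact ht)
    · rw [hψ0 t (not_le.1 ht)]; simp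
  have h3 := integral_integral_swap hinteg
  simp only [h1, h2] at h3
  rw [integral_mul_const, integral_const, hψi] at h3
  have h4 : ∫ t, (ψ t : ℂ) * f (z - t) = ∫ t, (ψ t : ℂ) * F (z - t) := by
    refine integral_congr_ae (ae_of_all _ fun t => ?_)
    by_cases ht : ‖t‖ ≤ δ
    · simp only [hFf t ht]
    · simp only [hψ0 t (not_le.1 ht)]; simp
  rw [h4]
  have h5 : (ν.real univ) = 2 * Real.pi := by
    simp [hν, hpi.le]
  rw [h5, real_smul] at h3
  have h6 : ((2 * Real.pi : ℝ) : ℂ) ≠ 0 := ofReal_ne_zero.2 (by positivity)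
  refine mul_left_cancel₀ h6 ?_
  rw [← h3]
  ring

theorem mol_eq_of_differentiableAt {n : ℕ} {f : (Fin n → ℂ) → ℂ} {z : Fin n → ℂ} {δ : ℝ}
    (hδ : 0 < δ) (hf : ∀ y ∈ Metric.closedBall z δ, DifferentiableAt ℂ f y) :
    mol n δ f z = f z := by
  have h := integral_mul_eq_of_differentiableAt (integrable_mker hδ)
    (fun c hc t => mker_smul hc t) (fun t ht => mker_eq_zero hδ ht.le) hf
  rw [integral_mker hδ, ofReal_one, one_mul] at h
  rw [← h, mol_apply]
  simp only [real_smul]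

theorem mol_congr {n : ℕ} {f g : (Fin n → ℂ) → ℂ} {z : Fin n → ℂ} {δ : ℝ} (hδ : 0 < δ)
    (h : ∀ y ∈ Metric.closedBall z δ, f y = g y) : mol n δ f z = mol n δ g z := by
  simp only [mol_apply]
  refine integral_congr_ae (ae_of_all _ fun t => ?_)
  by_cases ht : ‖t‖ ≤ δ
  · simp only
    rw [h _ (by rw [mem_closedBall_iff_norm, sub_sub_cancel_left, norm_neg]; exact ht)]
  · simp only [mker_eq_zero hδ (not_le.1 ht).le, zero_smul]

theorem contDiffAt_of_differentiableOn {n : ℕ} {f : (Fin n → ℂ) → ℂ} {Ω : Set (Fin n → ℂ)}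
    (hΩ : IsOpen Ω) (hf : DifferentiableOn ℂ f Ω) {z : Fin n → ℂ} (hz : z ∈ Ω) :
    ContDiffAt ℝ (⊤ : ℕ∞) f z := by
  obtain ⟨r, hr, hrΩ⟩ := Metric.nhds_basis_closedBall.mem_iff.1 (hΩ.mem_nhds hz)
  set B := Metric.closedBall z r with hB
  have hfc : ContinuousOn f B := hf.continuousOn.mono hrΩ
  have hl : LocallyIntegrable (B.indicator f) :=
    ((hfc.integrableOn_compact (isCompact_closedBall z r)).integrable_indicator
      Metric.isClosed_closedBall.measurableSet).locallyIntegrable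
  refine ((contDiff_mol (half_pos hr) hl).contDiffAt (x := z)).congr_of_eventuallyEq ?_
  filter_upwards [Metric.closedBall_mem_nhds z (half_pos hr)] with y hy
  have hs : Metric.closedBall y (r / 2) ⊆ B := Metric.closedBall_subset_closedBall' (by
    rw [Metric.mem_closedBall] at hy; linarith)
  rw [mol_congr (half_pos hr) (g := f) fun x hx => indicator_of_mem (hs hx) f,
    mol_eq_of_differentiableAt (half_pos hr) fun x hx =>
      hf.differentiableAt (hΩ.mem_nhds (hrΩ (hs hx)))]

theorem wderBar_eq_zero_of_differentiableAt {n : ℕ} {f : (Fin n → ℂ) → ℂ} {z : Fin n → ℂ}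
    (hf : DifferentiableAt ℂ f z) (j : Fin n) : wderBar n j f z = 0 := by
  have h : (Pi.single j I : Fin n → ℂ) = I • Pi.single j 1 := by
    rw [← Pi.single_smul, smul_eq_mul, mul_one]
  rw [wderBar, (hf.hasFDerivAt.restrictScalars ℝ).fderiv, h]
  simp only [ContinuousLinearMap.coe_restrictScalars', map_smul, smul_eq_mul, ← mul_assoc, I_mul_I]
  ring

theorem differentiableAt_of_wderBar_eq_zero {n : ℕ} {f : (Fin n → ℂ) → ℂ} {z : Fin n → ℂ}
    (hf : DifferentiableAt ℝ f z) (h : ∀ j, wderBar n j f z = 0) : DifferentiableAt ℂ f z := by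
  set L : (Fin n → ℂ) →L[ℂ] ℂ :=
    ∑ j, fderiv ℝ f z (Pi.single j 1) • ContinuousLinearMap.proj (R := ℂ) (φ := fun _ => ℂ) j with hL
  refine HasFDerivAt.differentiableAt (f' := L) (hasFDerivAt_of_restrictScalars ℝ hf.hasFDerivAt ?_)
  ext X
  have hX : X = ∑ j, ((X j).re • (Pi.single j 1 : Fin n → ℂ)
      + (X j).im • (Pi.single j I : Fin n → ℂ)) := by
    ext i
    simp [Finset.sum_apply, Pi.single_apply, Finset.sum_add_distrib]
  conv_rhs => rw [hX]
  rw [map_sum]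
  simp only [hL, ContinuousLinearMap.coe_restrictScalars', _root_.sum_apply, _root_.smul_apply,
    ContinuousLinearMap.proj_apply, smul_eq_mul, map_add, map_smul, real_smul]
  refine Finset.sum_congr rfl fun j _ => ?_
  have hj := h j
  rw [wderBar, mul_eq_zero] at hj
  have hj' := hj.resolve_left (by norm_num)
  have h1 : fderiv ℝ f z (Pi.single j I) = I * fderiv ℝ f z (Pi.single j 1) := by
    linear_combination (-I) * hj' + (fderiv ℝ f z (Pi.single j I)) * I_mul_I
  rw [h1]
  conv_lhs => rw [← re_add_im (X j)]
  ring

theorem mol_mol_comm {n : ℕ} {g : (Fin n → ℂ) → ℂ} {ε δ : ℝ} (hε : 0 < ε)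
    (hδ : 0 < δ) (hg : Integrable g) (z : Fin n → ℂ) : mol n δ (mol n ε g) z = mol n ε (mol n δ g) z := by
  have h1 : Integrable (fun p : (Fin n → ℂ) × (Fin n → ℂ) => mker n ε p.2 • g (p.1 - p.2))
      (volume.prod volume) :=
    (integrable_mker hε).convolution_integrand (ContinuousLinearMap.lsmul ℝ ℝ) hg
  have hm : MeasurePreserving (fun p : (Fin n → ℂ) × (Fin n → ℂ) => (z - p.1, p.2))
      (volume.prod volume) (volume.prod volume) :=
    (Measure.measurePreserving_sub_left volume z).prod (MeasurePreserving.id volume)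
  have h2 := hm.integrable_comp_of_integrable h1
  have h3 : Integrable (Function.uncurry fun s t : Fin n → ℂ =>
      mker n δ s • mker n ε t • g (z - s - t)) (volume.prod volume) := by
    obtain ⟨M, hM⟩ := (hasCompactSupport_mker hδ).exists_abs_le
      (contDiff_mker (n := n) (ε := δ)).continuous
    have hc : Continuous fun p : (Fin n → ℂ) × (Fin n → ℂ) => mker n δ p.1 :=
      contDiff_mker.continuous.comp continuous_fst
    have h5 : Integrable (fun p : (Fin n → ℂ) × (Fin n → ℂ) =>
        mker n ε p.2 • g (z - p.1 - p.2)) (volume.prod volume) := h2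
    exact Integrable.bdd_smul (𝕜 := ℝ) h5 M hc.aestronglyMeasurable (ae_of_all _ fun p => hM p.1)
  have h4 := integral_integral_swap h3
  simp only [integral_smul] at h4
  simp only [mol_apply]
  rw [h4]
  refine integral_congr_ae (ae_of_all _ fun t => ?_)
  simp only
  rw [← integral_smul]
  refine integral_congr_ae (ae_of_all _ fun s => ?_)
  simp only
  rw [smul_comm, sub_right_comm]

theorem differentiableAt_mol {n : ℕ} {g : (Fin n → ℂ) → ℂ} {Ω : Set (Fin n → ℂ)} {ε : ℝ}
    (hε : 0 < ε) (hg : LocallyIntegrable g)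
    (h : ∀ j κ, IsTestFun n κ Ω → ∫ z, g z * wderBar n j κ z = 0) {z : Fin n → ℂ}
    (hz : Metric.closedBall z ε ⊆ Ω) : DifferentiableAt ℂ (mol n ε g) z := by
  refine differentiableAt_of_wderBar_eq_zero
    ((contDiff_mol hε hg).differentiable (by simp) z) fun j => ?_
  rw [wderBar_mol hε hg, h j _ (isTestFun_mker_sub hε hz), neg_zero]

theorem mol_eq_mol {n : ℕ} {g : (Fin n → ℂ) → ℂ} {Ω : Set (Fin n → ℂ)} {ε δ : ℝ}
    (hε : 0 < ε) (hδ : 0 < δ) (hg : Integrable g)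
    (h : ∀ j κ, IsTestFun n κ Ω → ∫ z, g z * wderBar n j κ z = 0) {z : Fin n → ℂ}
    (hz : Metric.closedBall z (ε + δ) ⊆ Ω) : mol n ε g z = mol n δ g z := by
  have key : ∀ ε δ : ℝ, 0 < ε → 0 < δ → Metric.closedBall z (ε + δ) ⊆ Ω →
      mol n δ (mol n ε g) z = mol n ε g z := by
    intro ε δ hε hδ hz
    refine mol_eq_of_differentiableAt hδ fun y hy =>
      differentiableAt_mol hε hg.locallyIntegrable h (subset_trans ?_ hz)
    refine Metric.closedBall_subset_closedBall' ?_
    rw [Metric.mem_closedBall] at hy; linarith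
  rw [← key ε δ hε hδ hz, mol_mol_comm hε hδ hg, key δ ε hδ hε (by rwa [add_comm])]

/-- **Weyl's lemma** for the `∂̄`-operator. -/
theorem exists_differentiableOn_ae_eq {n : ℕ} {Ω : Set (Fin n → ℂ)} (hΩ : IsOpen Ω)
    (hb : Bornology.IsBounded Ω) {u : (Fin n → ℂ) → ℂ} (hu : MemLp u 2 (volume.restrict Ω))
    (h : ∀ j κ, IsTestFun n κ Ω → ∫ z in Ω, u z * wderBar n j κ z = 0) :
    ∃ F : (Fin n → ℂ) → ℂ, DifferentiableOn ℂ F Ω ∧ F =ᵐ[volume.restrict Ω] u := by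
  set g := Ω.indicator u with hgdef
  have hg2 : MemLp g 2 := (memLp_indicator_iff_restrict hΩ.measurableSet).2 hu
  have hg1 : Integrable g := by
    have : IsFiniteMeasure (volume.restrict Ω) := ⟨by
      rw [Measure.restrict_apply_univ]; exact hb.measure_lt_top⟩
    exact (integrable_indicator_iff hΩ.measurableSet).2 (hu.integrable (by norm_num))
  have hgl := hg1.locallyIntegrable
  have hw : ∀ j κ, IsTestFun n κ Ω → ∫ z, g z * wderBar n j κ z = 0 := by
    intro j κ hκ
    rw [← h j κ hκ, ← integral_indicator hΩ.measurableSet]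
    congr 1; ext z
    rw [hgdef, indicator_mul_left]
  have hr : ∀ z, ∃ ρ : ℝ, 0 < ρ ∧ (z ∈ Ω → Metric.closedBall z (3 * ρ) ⊆ Ω) := by
    intro z
    by_cases hz : z ∈ Ω
    · obtain ⟨r, hr, hrΩ⟩ := Metric.nhds_basis_closedBall.mem_iff.1 (hΩ.mem_nhds hz)
      exact ⟨r / 3, by positivity, fun _ => by rwa [mul_div_cancel₀ r (by norm_num)]⟩
    · exact ⟨1, one_pos, fun h => absurd h hz⟩
  choose ρ hρ0 hρ using hr
  have hloc : ∀ z ∈ Ω, ∀ y ∈ Metric.ball z (ρ z), ∀ η, 0 < η → η ≤ ρ z →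
      mol n (ρ z) g y = mol n η g y := by
    intro z hz y hy η hη hηz
    refine mol_eq_mol (hρ0 z) hη hg1 hw (subset_trans ?_ (hρ z hz))
    refine Metric.closedBall_subset_closedBall' ?_
    rw [Metric.mem_ball] at hy; linarith
  have hF : ∀ z ∈ Ω, ∀ y ∈ Metric.ball z (ρ z), mol n (ρ y) g y = mol n (ρ z) g y := by
    intro z hz y hy
    have hyΩ : y ∈ Ω := hρ z hz (Metric.ball_subset_closedBall.trans
      (Metric.closedBall_subset_closedBall (by linarith [hρ0 z])) hy)
    have hη := lt_min (hρ0 y) (hρ0 z)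
    rw [hloc z hz y hy _ hη (min_le_right _ _),
      hloc y hyΩ y (Metric.mem_ball_self (hρ0 y)) _ hη (min_le_left _ _)]
  refine ⟨fun z => mol n (ρ z) g z, fun z hz => ?_, ?_⟩
  · refine DifferentiableAt.differentiableWithinAt ?_
    have hd : DifferentiableAt ℂ (mol n (ρ z) g) z := differentiableAt_mol (hρ0 z) hgl hw
      ((Metric.closedBall_subset_closedBall (by linarith [hρ0 z])).trans (hρ z hz))
    refine hd.congr_of_eventuallyEq ?_
    filter_upwards [Metric.ball_mem_nhds z (hρ0 z)] with y hy using hF z hz y hy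
  · rw [EventuallyEq, ae_restrict_iff' hΩ.measurableSet, ae_iff]
    refine measure_null_of_locally_null _ fun z hz => ?_
    rw [mem_ofPred_eq, Classical.not_imp] at hz
    obtain ⟨hzΩ, -⟩ := hz
    refine ⟨{y | y ∈ Metric.ball z (ρ z) ∧ y ∈ Ω ∧ mol n (ρ y) g y ≠ u y}, ?_, ?_⟩
    · filter_upwards [self_mem_nhdsWithin,
        mem_nhdsWithin_of_mem_nhds (Metric.ball_mem_nhds z (hρ0 z))] with y hy1 hy2
      exact ⟨hy2, Classical.not_imp.1 hy1⟩
    have h0 : ∫⁻ y in Metric.ball z (ρ z), ‖mol n (ρ z) g y - g y‖ₑ ^ 2 = 0 := by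
      refine le_antisymm (ge_of_tendsto (tendsto_lintegral_mol_sub hg2) ?_) zero_le
      filter_upwards [Ioo_mem_nhdsGT (hρ0 z)] with η hη
      refine le_trans (le_of_eq ?_) (setLIntegral_le_lintegral (Metric.ball z (ρ z)) _)
      refine setLIntegral_congr_fun Metric.isOpen_ball.measurableSet fun y hy => ?_
      rw [hloc z hzΩ y hy η hη.1 hη.2.le]
    have hm : AEStronglyMeasurable fun y => mol n (ρ z) g y - g y :=
      (contDiff_mol (hρ0 z) hgl).continuous.aestronglyMeasurable.sub hg2.1
    rw [lintegral_eq_zero_iff' (hm.restrict.enorm.pow_const 2), EventuallyEq,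
      ae_restrict_iff' Metric.isOpen_ball.measurableSet, ae_iff] at h0
    refine measure_mono_null (fun y hy => ?_) h0
    obtain ⟨hyb, hyΩ, hne⟩ := hy
    rw [mem_ofPred_eq, Classical.not_imp]
    refine ⟨hyb, fun h => hne ?_⟩
    simp only [Pi.zero_apply, ne_eq, OfNat.ofNat_ne_zero, not_false_eq_true, pow_eq_zero_iff,
      enorm_eq_zero, sub_eq_zero] at h
    rw [hF z hzΩ y hyb, h, hgdef, indicator_of_mem hyΩ]

/-! ### Pointwise bounds for holomorphic functions -/

theorem norm_sq_mul_le_setIntegral {n : ℕ} {g : (Fin n → ℂ) → ℂ} {q : Fin n → ℂ} {r : ℝ}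
    (hg : ∀ y ∈ Metric.closedBall q r, DifferentiableAt ℂ g y) :
    ‖g q‖ ^ 2 * volume.real (Metric.closedBall (0 : Fin n → ℂ) r)
      ≤ ∫ z in Metric.closedBall q r, ‖g z‖ ^ 2 := by
  set ψ : (Fin n → ℂ) → ℝ := (Metric.closedBall 0 r).indicator 1 with hψ
  have hψi : Integrable ψ := (integrable_indicator_iff Metric.isClosed_closedBall.measurableSet).2
    (integrableOn_const (isCompact_closedBall _ _).measure_lt_top.ne)
  have hψI : ∫ t, ψ t = volume.real (Metric.closedBall (0 : Fin n → ℂ) r) := by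
    rw [hψ, integral_indicator_one Metric.isClosed_closedBall.measurableSet]
  have hψm : ∀ t, t ∈ Metric.closedBall (0 : Fin n → ℂ) r → ψ t = 1 := fun t ht =>
    indicator_of_mem ht _
  have hψn : ∀ t, t ∉ Metric.closedBall (0 : Fin n → ℂ) r → ψ t = 0 := fun t ht =>
    indicator_of_notMem ht _
  have h := integral_mul_eq_of_differentiableAt (f := fun z => g z ^ 2) (z := q) (δ := r) hψi
    (fun c hc t => ?_) (fun t ht => hψn t (by simpa using ht)) (fun y hy => (hg y hy).pow 2)
  swap
  · by_cases ht : t ∈ Metric.closedBall (0 : Fin n → ℂ) r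
    · rw [hψm t ht, hψm]
      rw [mem_closedBall_zero_iff] at ht ⊢
      rwa [norm_smul, hc, one_mul]
    · rw [hψn t ht, hψn]
      rw [mem_closedBall_zero_iff] at ht ⊢
      rwa [norm_smul, hc, one_mul]
  have h2 := congrArg norm h
  rw [hψI, norm_mul, norm_pow, norm_real, Real.norm_of_nonneg measureReal_nonneg] at h2
  rw [mul_comm, ← h2]
  refine (norm_integral_le_integral_norm _).trans (le_of_eq ?_)
  rw [← integral_indicator Metric.isClosed_closedBall.measurableSet,
    ← integral_sub_left_eq_self ((Metric.closedBall q r).indicator fun z => ‖g z‖ ^ 2) volume q]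
  refine integral_congr_ae (ae_of_all _ fun t => ?_)
  simp only
  by_cases ht : t ∈ Metric.closedBall (0 : Fin n → ℂ) r
  · rw [hψm t ht, indicator_of_mem]
    · simp
    · rw [mem_closedBall_iff_norm, sub_sub_cancel_left, norm_neg]
      simpa using ht
  · rw [hψn t ht, indicator_of_notMem]
    · simp
    · rw [mem_closedBall_iff_norm, sub_sub_cancel_left, norm_neg]
      simpa using ht

theorem volume_real_closedBall (n : ℕ) {r : ℝ} (hr : 0 ≤ r) :
    volume.real (Metric.closedBall (0 : Fin n → ℂ) r)
      = r ^ (2 * n) * volume.real (Metric.ball (0 : Fin n → ℂ) 1) := by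
  rw [Measure.real, Measure.addHaar_closedBall _ _ hr, ENNReal.toReal_mul,
    ENNReal.toReal_ofReal (by positivity)]
  congr 2
  simp [Module.finrank_pi_fintype, mul_comm]

theorem holDeriv_eq_fderiv {n : ℕ} (f : (Fin n → ℂ) → ℂ) (p X : Fin n → ℂ) :
    holDeriv n f p X = fderiv ℂ f p X := by
  conv_rhs => rw [pi_eq_sum_univ' X]
  rw [map_sum, holDeriv]
  refine Finset.sum_congr rfl fun i _ => ?_
  rw [map_smul, smul_eq_mul]

theorem norm_holDeriv_le {n : ℕ} {g : (Fin n → ℂ) → ℂ} {p X : Fin n → ℂ} {r M : ℝ} (hr : 0 < r)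
    (hg : ∀ y ∈ Metric.closedBall p r, DifferentiableAt ℂ g y)
    (hM : ∀ y ∈ Metric.closedBall p r, ‖g y‖ ≤ M) :
    ‖holDeriv n g p X‖ ≤ M * ‖X‖ / r := by
  rw [holDeriv_eq_fderiv]
  have hp : p ∈ Metric.closedBall p r := Metric.mem_closedBall_self hr.le
  by_cases hX : X = 0
  · simp [hX]
  have hX0 : 0 < ‖X‖ := norm_pos_iff.2 hX
  have hm : ∀ ζ ∈ Metric.closedBall (0 : ℂ) (r / ‖X‖), p + ζ • X ∈ Metric.closedBall p r := by
    intro ζ hζ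
    rw [mem_closedBall_zero_iff, le_div_iff₀ hX0] at hζ
    rw [mem_closedBall_iff_norm, add_sub_cancel_left, norm_smul]
    exact hζ
  have hd : ∀ ζ ∈ Metric.closedBall (0 : ℂ) (r / ‖X‖),
      DifferentiableAt ℂ (fun ζ => g (p + ζ • X)) ζ := fun ζ hζ =>
    DifferentiableAt.comp (g := g) (f := fun ζ : ℂ => p + ζ • X) ζ (hg _ (hm ζ hζ)) (by fun_prop)
  have h1 : deriv (fun ζ : ℂ => g (p + ζ • X)) 0 = fderiv ℂ g p X := by
    have e : HasDerivAt (fun ζ : ℂ => p + ζ • X) X 0 := by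
      simpa using ((hasDerivAt_id (0 : ℂ)).smul_const X).const_add p
    have e2 : HasFDerivAt g (fderiv ℂ g p) (p + (0 : ℂ) • X) := by
      simpa using (hg p hp).hasFDerivAt
    exact (e2.comp_hasDerivAt 0 e).deriv
  have hR : 0 < r / ‖X‖ := by positivity
  have h2 := Complex.norm_deriv_le_of_forall_mem_sphere_norm_le (f := fun ζ : ℂ => g (p + ζ • X))
    (c := 0) (C := M) hR ?_ fun ζ hζ => hM _ (hm ζ (Metric.sphere_subset_closedBall hζ))
  · rw [h1] at h2
    calc _ ≤ _ := h2
      _ = _ := by field_simp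
  · exact DifferentiableOn.diffContOnCl_ball (U := Metric.closedBall 0 (r / ‖X‖))
      (fun ζ hζ => (hd ζ hζ).differentiableWithinAt) subset_rfl

/-! ### The weights -/

/-- The plurisubharmonic weight with an approximate logarithmic pole at `p`. -/
noncomputable def poleWeight (n : ℕ) (p : Fin n → ℂ) (ε : ℝ) (z : Fin n → ℂ) : ℝ :=
  esq (z - 0) + (n + 2) * Real.log (esq (z - p) + ε ^ 2)

theorem contDiff_esq_sub {n : ℕ} {k : WithTop ℕ∞} (p : Fin n → ℂ) :
    ContDiff ℝ k fun z : Fin n → ℂ => esq (z - p) :=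
  contDiff_esq.comp (contDiff_id.sub contDiff_const)

theorem contDiff_poleWeight {n : ℕ} {p : Fin n → ℂ} {ε : ℝ} (hε : 0 < ε) :
    ContDiff ℝ (⊤ : ℕ∞) (poleWeight n p ε) := by
  have h : ∀ z : Fin n → ℂ, esq (z - p) + ε ^ 2 ≠ 0 := fun z => by
    have := esq_nonneg (z - p); positivity
  exact (contDiff_esq_sub 0).add
    (contDiff_const.mul (((contDiff_esq_sub p).add contDiff_const).log h))

theorem hermForm_poleWeight_ge {n : ℕ} {p : Fin n → ℂ} {ε : ℝ} (hε : 0 < ε)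
    (z X : Fin n → ℂ) : ∑ j, ‖X j‖ ^ 2 ≤ hermForm n (cHess n (poleWeight n p ε) z) X X := by
  set g : ℝ → ℝ := fun x => (n + 2) * Real.log (x + ε ^ 2) with hg
  have hS0 := esq_nonneg (z - p)
  have hS : ContDiff ℝ 2 fun z : Fin n → ℂ => esq (z - p) := contDiff_esq_sub p
  have hpos : 0 < esq (z - p) + ε ^ 2 := by positivity
  have hgc : ContDiffAt ℝ 2 g (esq (z - p)) :=
    contDiffAt_const.mul ((contDiffAt_id.add contDiffAt_const).log hpos.ne')
  have hd : ∀ x : ℝ, 0 < x + ε ^ 2 → HasDerivAt g ((n + 2) * (x + ε ^ 2)⁻¹) x := by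
    intro x hx
    have h1 := (((hasDerivAt_id x).add_const (ε ^ 2)).log hx.ne').const_mul ((n : ℝ) + 2)
    simpa [hg] using h1
  have hd1 : deriv g (esq (z - p)) = (n + 2) * (esq (z - p) + ε ^ 2)⁻¹ := (hd _ hpos).deriv
  have hd2 : deriv (deriv g) (esq (z - p)) = -((n + 2) * ((esq (z - p) + ε ^ 2) ^ 2)⁻¹) := by
    have e : deriv g =ᶠ[𝓝 (esq (z - p))] fun x => (n + 2) * (x + ε ^ 2)⁻¹ := by
      have : ∀ᶠ x in 𝓝 (esq (z - p)), 0 < x + ε ^ 2 :=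
        (continuous_id.add continuous_const).continuousAt.eventually (lt_mem_nhds hpos)
      filter_upwards [this] with x hx using (hd x hx).deriv
    rw [e.deriv_eq]
    have h1 := (((hasDerivAt_id (esq (z - p))).add_const (ε ^ 2)).inv hpos.ne').const_mul
      ((n : ℝ) + 2)
    have h2 : HasDerivAt (fun x : ℝ => (n + 2) * (x + ε ^ 2)⁻¹) _ (esq (z - p)) := h1
    rw [h2.deriv]
    simp only [id]
    field_simp
  have hgS : ContDiffAt ℝ 2 (fun v => g (esq (v - p))) z :=
    ContDiffAt.comp (g := g) z hgc hS.contDiffAt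
  have e : hermForm n (cHess n (poleWeight n p ε) z) X X = _ :=
    hermForm_cHess_add (f := fun v => esq (v - 0)) (g := fun v => g (esq (v - p)))
      (contDiff_esq_sub 0).contDiffAt hgS X
  rw [e, hermForm_cHess_esq, hermForm_cHess_comp (S := fun v => esq (v - p)) hgc hS.contDiffAt, hermForm_cHess_esq, hd1, hd2]
  set s := ∑ j, ‖X j‖ ^ 2 with hs
  have hcs : ‖∑ j, wder n j (fun v => (esq (v - p) : ℂ)) z * X j‖ ^ 2 ≤ esq (z - p) * s := by
    simp only [wder_esq]
    have h1 : ‖∑ j, starRingEnd ℂ (z j - p j) * X j‖ ≤ ∑ j, ‖z j - p j‖ * ‖X j‖ := by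
      refine (norm_sum_le _ _).trans (le_of_eq ?_)
      simp only [norm_mul, RCLike.norm_conj]
    calc _ ≤ (∑ j, ‖z j - p j‖ * ‖X j‖) ^ 2 := pow_le_pow_left₀ (norm_nonneg _) h1 2
      _ ≤ _ := Finset.sum_mul_sq_le_sq_mul_sq _ _ _
  set A := ‖∑ j, wder n j (fun v => (esq (v - p) : ℂ)) z * X j‖ ^ 2
  set S := esq (z - p)
  have hs0 : 0 ≤ s := by positivity
  have : 0 ≤ (n + 2) * (S + ε ^ 2)⁻¹ * s + -((n + 2) * ((S + ε ^ 2) ^ 2)⁻¹) * A := by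
    have e2 : (n + 2) * (S + ε ^ 2)⁻¹ * s + -((n + 2) * ((S + ε ^ 2) ^ 2)⁻¹) * A
        = (n + 2) * (((S + ε ^ 2) * s - A) / (S + ε ^ 2) ^ 2) := by
      field_simp
      ring
    rw [e2]
    have : 0 ≤ (S + ε ^ 2) * s - A := by nlinarith [mul_nonneg (sq_nonneg ε) hs0]
    positivity
  linarith

theorem exp_neg_poleWeight {n : ℕ} {p : Fin n → ℂ} {ε : ℝ} (hε : 0 < ε) (z : Fin n → ℂ) :
    Real.exp (-poleWeight n p ε z)
      = Real.exp (-esq z) / (esq (z - p) + ε ^ 2) ^ (n + 2) := by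
  have hpos : 0 < esq (z - p) + ε ^ 2 := by have := esq_nonneg (z - p); positivity
  rw [poleWeight, sub_zero, neg_add, Real.exp_add, Real.exp_neg (_ * _), div_eq_mul_inv]
  congr 2
  have := Real.exp_nat_mul (Real.log (esq (z - p) + ε ^ 2)) (n + 2)
  rw [Real.exp_log hpos] at this
  rw [← this]
  push_cast
  rfl

theorem exp_neg_poleWeight_le {n : ℕ} {p : Fin n → ℂ} {ε δ : ℝ} (hε : 0 < ε) (hδ : 0 < δ)
    {z : Fin n → ℂ} (hz : δ ≤ ‖z - p‖) :
    Real.exp (-poleWeight n p ε z) ≤ 1 / (δ ^ 2) ^ (n + 2) := by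
  rw [exp_neg_poleWeight hε]
  have h1 : δ ^ 2 ≤ esq (z - p) + ε ^ 2 := by
    have := pow_le_pow_left₀ hδ.le hz 2
    linarith [norm_sq_le_esq (z - p), sq_nonneg ε]
  have h2 : Real.exp (-esq z) ≤ 1 := Real.exp_le_one_iff.2 (by linarith [esq_nonneg z])
  gcongr

theorem le_exp_neg_poleWeight {n : ℕ} {p : Fin n → ℂ} {ε D r : ℝ} (hε : 0 < ε)
    {z : Fin n → ℂ} (hz : ‖z‖ ≤ D) (hr : ε ≤ r) (hzp : ‖z - p‖ ≤ r) :
    Real.exp (-(n * D ^ 2)) / ((n + 1) * r ^ 2) ^ (n + 2) ≤ Real.exp (-poleWeight n p ε z) := by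
  rw [exp_neg_poleWeight hε]
  have hpos : 0 < esq (z - p) + ε ^ 2 := by have := esq_nonneg (z - p); positivity
  have hn : (0 : ℝ) ≤ n := Nat.cast_nonneg n
  have h1 : esq z ≤ n * D ^ 2 := (esq_le z).trans
    (mul_le_mul_of_nonneg_left (pow_le_pow_left₀ (norm_nonneg _) hz 2) hn)
  have h2 : esq (z - p) ≤ n * r ^ 2 := (esq_le _).trans
    (mul_le_mul_of_nonneg_left (pow_le_pow_left₀ (norm_nonneg _) hzp 2) hn)
  have h3 : ε ^ 2 ≤ r ^ 2 := pow_le_pow_left₀ hε.le hr 2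
  have h4 : esq (z - p) + ε ^ 2 ≤ (n + 1) * r ^ 2 := by linarith
  gcongr

/-! ### Cutting off a holomorphic function -/

theorem exists_cutoff {n : ℕ} {K U : Set (Fin n → ℂ)} (hK : IsCompact K) (hU : IsOpen U)
    (hKU : K ⊆ U) : ∃ χ : (Fin n → ℂ) → ℂ, ∃ δ > 0, IsTestFun n χ U ∧ (∀ z, ‖χ z‖ ≤ 1) ∧
      ∀ p ∈ K, ∀ z ∈ Metric.ball p δ, χ z = 1 := by
  obtain ⟨r, hr, hrU⟩ := hK.exists_cthickening_subset_open hU hKU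
  set S := Metric.cthickening (2 * (r / 3)) K with hS
  have hr3 : 0 < r / 3 := by positivity
  have hSm : MeasurableSet S := Metric.isClosed_cthickening.measurableSet
  have hl : LocallyIntegrable (S.indicator fun _ : Fin n → ℂ => (1 : ℂ)) :=
    ((integrable_indicator_iff hSm).2 (integrableOn_const
      hK.cthickening.measure_lt_top.ne)).locallyIntegrable
  have hsupp : tsupport (mol n (r / 3) (S.indicator fun _ : Fin n → ℂ => (1 : ℂ)))
      ⊆ Metric.cthickening r K := by
    refine closure_minimal (fun z hz => ?_) Metric.isClosed_cthickening
    by_contra h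
    refine hz ?_
    rw [mol_congr (g := fun _ => 0) hr3, mol_apply]
    · simp
    · intro y hy
      refine indicator_of_notMem (fun hyS => h ?_) _
      rw [hS, hK.cthickening_eq_biUnion_closedBall (by positivity)] at hyS
      obtain ⟨x, hx, hyx⟩ := mem_iUnion₂.1 hyS
      rw [hK.cthickening_eq_biUnion_closedBall hr.le]
      refine mem_iUnion₂.2 ⟨x, hx, ?_⟩
      rw [Metric.mem_closedBall] at hy hyx ⊢
      linarith [dist_triangle z y x, dist_comm y z]
  refine ⟨_, r / 3, hr3, ⟨contDiff_mol hr3 hl, hK.cthickening.of_isClosed_subset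
    isClosed_closure hsupp, hsupp.trans hrU⟩, fun z => ?_, fun p hp z hz => ?_⟩
  · rw [mol_apply, ← integral_mker hr3 (n := n)]
    refine norm_integral_le_of_norm_le (integrable_mker hr3) (ae_of_all _ fun t => ?_)
    rw [norm_smul, Real.norm_of_nonneg (mker_nonneg hr3 t)]
    refine mul_le_of_le_one_right (mker_nonneg hr3 t) ?_
    exact (norm_indicator_le_norm_self _ _).trans (by simp)
  · rw [mol_congr (g := fun _ => 1) hr3]
    · exact mol_eq_of_differentiableAt hr3 fun y _ => differentiableAt_const _
    · intro y hy
      refine indicator_of_mem ?_ _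
      rw [hS, hK.cthickening_eq_biUnion_closedBall (by positivity)]
      refine mem_iUnion₂.2 ⟨p, hp, ?_⟩
      rw [Metric.mem_closedBall] at hy ⊢
      rw [Metric.mem_ball] at hz
      linarith [dist_triangle y z p]

theorem IsTestFun.mul_inter {n : ℕ} {a κ : (Fin n → ℂ) → ℂ} {U Ω : Set (Fin n → ℂ)}
    (ha : IsTestFun n a U) (hκ : IsTestFun n κ Ω) : IsTestFun n (fun z => a z * κ z) (U ∩ Ω) :=
  ⟨ha.1.mul hκ.1, hκ.2.1.mul_left,
    fun _ hz => ⟨ha.2.2 (tsupport_mul_subset_left hz), hκ.2.2 (tsupport_mul_subset_right hz)⟩⟩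

theorem IsTestFun.wderBar {n : ℕ} {a : (Fin n → ℂ) → ℂ} {U : Set (Fin n → ℂ)}
    (ha : IsTestFun n a U) (j : Fin n) : IsTestFun n (wderBar n j a) U :=
  ⟨ha.1.wderBar, ha.2.1.wderBar, (tsupport_wderBar_subset j a).trans ha.2.2⟩

theorem IsTestFun.eq_zero {n : ℕ} {κ : (Fin n → ℂ) → ℂ} {Ω : Set (Fin n → ℂ)}
    (hκ : IsTestFun n κ Ω) {z : Fin n → ℂ} (hz : z ∉ Ω) : κ z = 0 :=
  image_eq_zero_of_notMem_tsupport fun h => hz (hκ.2.2 h)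

theorem integrable_mul_test {n : ℕ} {f g : (Fin n → ℂ) → ℂ} {V : Set (Fin n → ℂ)}
    (hV : IsOpen V) (hf : DifferentiableOn ℂ f V) (hg : IsTestFun n g V) :
    Integrable fun z => f z * g z :=
  (ContDiff.mul_of_contDiffAt_tsupport hg.1 fun _ hx =>
    contDiffAt_of_differentiableOn hV hf (hg.2.2 hx)).continuous.integrable_of_hasCompactSupport
    hg.2.1.mul_left

theorem integral_mul_wderBar_eq_zero {n : ℕ} {f g : (Fin n → ℂ) → ℂ} {V : Set (Fin n → ℂ)}
    (hV : IsOpen V) (hf : DifferentiableOn ℂ f V) (hg : IsTestFun n g V) (j : Fin n) :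
    ∫ z, f z * wderBar n j g z = 0 := by
  rw [integral_mul_wderBar (hg.1.of_le (by simp)) hg.2.1 (fun x hx =>
    (contDiffAt_of_differentiableOn hV hf (hg.2.2 hx)).of_le (by simp)), neg_eq_zero]
  refine integral_eq_zero_of_ae (ae_of_all _ fun z => ?_)
  by_cases hz : z ∈ V
  · simp only
    rw [wderBar_eq_zero_of_differentiableAt (hf.differentiableAt (hV.mem_nhds hz)), zero_mul]
    rfl
  · simp only [hg.eq_zero hz, mul_zero]; rfl

theorem setIntegral_mul_cutoff_wderBar {n : ℕ} {f χ κ : (Fin n → ℂ) → ℂ} {U Ω : Set (Fin n → ℂ)}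
    (hU : IsOpen U) (hΩ : IsOpen Ω) (hf : DifferentiableOn ℂ f (U ∩ Ω)) (hχ : IsTestFun n χ U)
    (hκ : IsTestFun n κ Ω) (j : Fin n) :
    ∫ z in Ω, (χ z * f z) * wderBar n j κ z = -∫ z in Ω, (f z * wderBar n j χ z) * κ z := by
  have hV := hU.inter hΩ
  have hz : ∀ z, z ∉ Ω → (χ z * f z) * wderBar n j κ z = 0 := fun z hz => by
    rw [(hκ.wderBar j).eq_zero hz, mul_zero]
  have hz' : ∀ z, z ∉ Ω → (f z * wderBar n j χ z) * κ z = 0 := fun z hz => by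
    rw [hκ.eq_zero hz, mul_zero]
  rw [setIntegral_eq_integral_of_forall_compl_eq_zero hz,
    setIntegral_eq_integral_of_forall_compl_eq_zero hz']
  have h := integral_mul_wderBar_eq_zero hV hf (hχ.mul_inter hκ) j
  have e : ∀ z, f z * wderBar n j (fun z => χ z * κ z) z
      = f z * (χ z * wderBar n j κ z) + f z * (wderBar n j χ z * κ z) := fun z => by
    rw [wderBar_mul (hχ.1.differentiable (by simp) z) (hκ.1.differentiable (by simp) z), mul_add]
  simp only [e] at h
  rw [integral_add (integrable_mul_test hV hf (hχ.mul_inter (hκ.wderBar j)))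
    (integrable_mul_test hV hf ((hχ.wderBar j).mul_inter hκ))] at h
  rw [← add_eq_zero_iff_eq_neg, ← h]
  congr 2 <;> ext z <;> ring

theorem setIntegral_cutoff_closed {n : ℕ} {f χ κ : (Fin n → ℂ) → ℂ} {U Ω : Set (Fin n → ℂ)}
    (hU : IsOpen U) (hΩ : IsOpen Ω) (hf : DifferentiableOn ℂ f (U ∩ Ω)) (hχ : IsTestFun n χ U)
    (hκ : IsTestFun n κ Ω) (j k : Fin n) :
    ∫ z in Ω, ((f z * wderBar n j χ z) * wderBar n k κ z
      - (f z * wderBar n k χ z) * wderBar n j κ z) = 0 := by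
  have hV := hU.inter hΩ
  have hz : ∀ z, z ∉ Ω → (f z * wderBar n j χ z) * wderBar n k κ z
      - (f z * wderBar n k χ z) * wderBar n j κ z = 0 := fun z hz => by
    rw [(hκ.wderBar j).eq_zero hz, (hκ.wderBar k).eq_zero hz, mul_zero, mul_zero, sub_zero]
  rw [setIntegral_eq_integral_of_forall_compl_eq_zero hz]
  have t1 := (hχ.wderBar j).mul_inter hκ
  have t2 := (hχ.wderBar k).mul_inter hκ
  have e : ∀ z, (f z * wderBar n j χ z) * wderBar n k κ z
      - (f z * wderBar n k χ z) * wderBar n j κ z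
      = f z * wderBar n k (fun z => wderBar n j χ z * κ z) z
        - f z * wderBar n j (fun z => wderBar n k χ z * κ z) z := fun z => by
    have d := hκ.1.differentiable (by simp) z
    rw [wderBar_mul ((hχ.wderBar j).1.differentiable (by simp) z) d,
      wderBar_mul ((hχ.wderBar k).1.differentiable (by simp) z) d,
      wderBar_wderBar_comm (hχ.1.contDiffAt.of_le
        (WithTop.coe_le_coe.2 (le_top : ((2 : ℕ) : ℕ∞) ≤ ⊤)))]
    ring
  simp only [e]
  rw [integral_sub (integrable_mul_test hV hf (t1.wderBar k))
    (integrable_mul_test hV hf (t2.wderBar j)), integral_mul_wderBar_eq_zero hV hf t1,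
    integral_mul_wderBar_eq_zero hV hf t2, sub_zero]

theorem InBergman.memLp {n : ℕ} {V : Set (Fin n → ℂ)} (hV : IsOpen V) {f : (Fin n → ℂ) → ℂ}
    (hf : InBergman n V f) : MemLp f 2 (volume.restrict V) :=
  (memLp_two_iff_integrable_sq_norm
    (hf.1.continuousOn.aestronglyMeasurable hV.measurableSet)).2 hf.2

theorem InBergman.memLp_mul_test {n : ℕ} {U Ω : Set (Fin n → ℂ)} (hU : IsOpen U) (hΩ : IsOpen Ω)
    {f a : (Fin n → ℂ) → ℂ} (hf : InBergman n (U ∩ Ω) f) (ha : IsTestFun n a U) :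
    MemLp (fun z => f z * a z) 2 (volume.restrict Ω) := by
  have e : (fun z => f z * a z) = U.indicator fun z => f z * a z := by
    ext z
    by_cases hz : z ∈ U
    · rw [indicator_of_mem hz]
    · rw [indicator_of_notMem hz, ha.eq_zero hz, mul_zero]
  obtain ⟨M, hM⟩ := ha.1.continuous.bounded_above_of_compact_support ha.2.1
  rw [e, memLp_indicator_iff_restrict hU.measurableSet, Measure.restrict_restrict hU.measurableSet]
  have h := hf.memLp (hU.inter hΩ)
  refine h.of_le_mul (c := M) (h.1.mul ha.1.continuous.aestronglyMeasurable)
    (ae_of_all _ fun z => ?_)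
  rw [norm_mul, mul_comm]
  exact mul_le_mul_of_nonneg_right (hM z) (norm_nonneg _)

theorem memLp_mul_test_integrableOn {n : ℕ} {Ω : Set (Fin n → ℂ)} (hb : Bornology.IsBounded Ω)
    {u g : (Fin n → ℂ) → ℂ} (hu : MemLp u 2 (volume.restrict Ω)) (hg : IsTestFun n g Ω) :
    IntegrableOn (fun z => u z * g z) Ω := by
  have : IsFiniteMeasure (volume.restrict Ω) :=
    ⟨by rw [Measure.restrict_apply_univ]; exact hb.measure_lt_top⟩
  obtain ⟨M, hM⟩ := hg.1.continuous.bounded_above_of_compact_support hg.2.1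
  exact (hu.integrable (by norm_num)).mul_bdd (c := M) hg.1.continuous.aestronglyMeasurable
    (ae_of_all _ hM)

theorem mul_setIntegral_le {n : ℕ} {S Ω : Set (Fin n → ℂ)} {v w : (Fin n → ℂ) → ℝ} {m : ℝ}
    (hS : MeasurableSet S) (hSΩ : S ⊆ Ω) (hv : IntegrableOn v Ω)
    (hvw : IntegrableOn (fun z => v z * w z) Ω) (hv0 : ∀ z, 0 ≤ v z) (hw0 : ∀ z, 0 ≤ w z)
    (hm : ∀ z ∈ S, m ≤ w z) :
    m * ∫ z in S, v z ≤ ∫ z in Ω, v z * w z := by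
  rw [← integral_const_mul]
  refine (setIntegral_mono_on ((hv.mono_set hSΩ).const_mul m) (hvw.mono_set hSΩ) hS
    fun z hz => ?_).trans (setIntegral_mono_set hvw (ae_of_all _ fun z => mul_nonneg (hv0 z) (hw0 z))
      (LE.le.eventuallyLE hSΩ))
  rw [mul_comm]
  exact mul_le_mul_of_nonneg_left (hm z hz) (hv0 z)

theorem setIntegral_cutoff_weight_le {n : ℕ} {U Ω : Set (Fin n → ℂ)} (hU : IsOpen U)
    (hΩ : IsOpen Ω) {f χ : (Fin n → ℂ) → ℂ} (hf : InBergman n (U ∩ Ω) f) (hχ : IsTestFun n χ U)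
    {p : Fin n → ℂ} {δ ε M : ℝ} (hδ : 0 < δ) (hε : 0 < ε) (hχ1 : ∀ z ∈ Metric.ball p δ, χ z = 1)
    (hM : ∀ z ∈ Ω, ∑ j, ‖wderBar n j χ z‖ ^ 2 ≤ M) (hM0 : 0 ≤ M) :
    ∫ z in Ω, (∑ j, ‖f z * wderBar n j χ z‖ ^ 2) * Real.exp (-poleWeight n p ε z)
      ≤ M * (1 / (δ ^ 2) ^ (n + 2)) * l2sq n (U ∩ Ω) f := by
  set K := 1 / (δ ^ 2) ^ (n + 2) with hK
  have hK0 : 0 ≤ K := by positivity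
  have hr : ∫ z in Ω, U.indicator (fun z => M * K * ‖f z‖ ^ 2) z = M * K * l2sq n (U ∩ Ω) f := by
    rw [setIntegral_indicator hU.measurableSet, integral_const_mul, inter_comm]
    rfl
  rw [← hr]
  refine integral_mono_of_nonneg (ae_of_all _ fun z => by positivity) ?_
    ((ae_restrict_iff' hΩ.measurableSet).2 (ae_of_all _ fun z hz => ?_))
  · rw [integrable_indicator_iff hU.measurableSet, IntegrableOn,
      Measure.restrict_restrict hU.measurableSet]
    exact Integrable.const_mul hf.2 _
  · simp only
    by_cases hzU : z ∈ U
    · rw [indicator_of_mem hzU]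
      simp only [norm_mul, mul_pow, ← Finset.mul_sum]
      by_cases hzp : z ∈ Metric.ball p δ
      · have h0 : ∀ j, wderBar n j χ z = 0 := fun j => by
          refine wderBar_eq_zero_of_differentiableAt
            ((differentiableAt_const (1 : ℂ)).congr_of_eventuallyEq ?_) j
          filter_upwards [Metric.isOpen_ball.mem_nhds hzp] with y hy using hχ1 y hy
        simp only [h0]
        simp
        positivity
      · have h1 := exp_neg_poleWeight_le (n := n) (p := p) (z := z) hε hδ (by
          rw [Metric.mem_ball, not_lt, dist_eq_norm] at hzp; exact hzp)
        calc _ ≤ ‖f z‖ ^ 2 * M * K := by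
              gcongr
              exact hM z hz
          _ = _ := by ring
    · rw [indicator_of_notMem hzU]
      simp [(hχ.wderBar _).eq_zero hzU]

theorem exists_holomorphic_approx {n : ℕ} {Ω U W : Set (Fin n → ℂ)} (hΩ : IsOpen Ω)
    (hb : Bornology.IsBounded Ω) (hpsc : PseudoconvexExh n Ω) (hU : IsOpen U)
    (hWU : closure W ⊆ U) (hWc : IsCompact (closure W)) :
    ∃ C > 0, ∃ δ > 0, ∀ p ∈ W ∩ Ω, ∀ f, InBergman n (U ∩ Ω) f → ∀ ε, 0 < ε → ε < δ →
      Metric.closedBall p ε ⊆ U ∩ Ω → ∃ F, InBergman n Ω F ∧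
        l2sq n Ω F ≤ C * l2sq n (U ∩ Ω) f ∧
        ∫ z in Metric.closedBall p ε, ‖F z - f z‖ ^ 2
          ≤ C * (ε ^ 2) ^ (n + 2) * l2sq n (U ∩ Ω) f := by
  obtain ⟨χ, δ, hδ, hχ, hχle, hχ1⟩ := exists_cutoff hWc hU hWU
  obtain ⟨D, hD0, hD⟩ := hb.exists_pos_norm_le
  obtain ⟨M', hM'⟩ := exists_bound_of_isBounded hb
    (w := fun z => ∑ j, ‖wderBar n j χ z‖ ^ 2)
    (continuous_finsetSum _ fun j _ => (hχ.wderBar j).1.continuous.norm.pow 2)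
  have hM : ∀ z ∈ Ω, ∑ j, ‖wderBar n j χ z‖ ^ 2 ≤ |M'| := fun z hz =>
    (le_abs_self _).trans ((hM' z hz).trans (le_abs_self _))
  set A := 2 * Real.exp 1 * (|M'| * (1 / (δ ^ 2) ^ (n + 2))) with hA
  have hA0 : 0 ≤ A := by positivity
  set m₀ := Real.exp (-(n * D ^ 2)) / ((n + 1) * (2 * D + 1) ^ 2) ^ (n + 2) with hm₀
  have hm₀0 : 0 < m₀ := by positivity
  set B := A * ((n + 1) ^ (n + 2) / Real.exp (-(n * D ^ 2))) with hB
  have hB0 : 0 ≤ B := by positivity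
  refine ⟨2 + 2 * (A / m₀) + B, by positivity, min δ 1, by positivity, ?_⟩
  intro p hp f hf ε hε hεδ hball
  have hε1 : ε < 1 := hεδ.trans_le (min_le_right _ _)
  have hεδ' : ε < δ := hεδ.trans_le (min_le_left _ _)
  have hpχ := hχ1 p (subset_closure hp.1)
  set I := l2sq n (U ∩ Ω) f with hI
  have hI0 : 0 ≤ I := integral_nonneg fun z => by positivity
  obtain ⟨u, hu2, hue, huw⟩ := exists_dbar_solution hΩ hb hpsc (contDiff_poleWeight (p := p) hε)
    (fun z _ X => hermForm_poleWeight_ge hε z X) (α := fun j z => f z * wderBar n j χ z)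
    (fun j => hf.memLp_mul_test hU hΩ (hχ.wderBar j))
    (fun j k κ hκ => setIntegral_cutoff_closed hU hΩ hf.1 hχ hκ j k)
  have huA : ∫ z in Ω, ‖u z‖ ^ 2 * Real.exp (-poleWeight n p ε z) ≤ A * I := by
    refine hue.trans ?_
    have := setIntegral_cutoff_weight_le hU hΩ hf hχ hδ hε hpχ hM (abs_nonneg _)
    refine (mul_le_mul_of_nonneg_left this
      (by positivity : (0 : ℝ) ≤ 2 * Real.exp 1)).trans' (le_of_eq ?_) |>.trans (le_of_eq ?_)
    · ring
    · rw [hA]; ring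
  have hui : IntegrableOn (fun z => ‖u z‖ ^ 2) Ω := hu2.integrable_norm_pow (by norm_num)
  have hφc : Continuous fun z => Real.exp (-poleWeight n p ε z) :=
    Real.continuous_exp.comp (contDiff_poleWeight hε).continuous.neg
  have huwi := integrableOn_mul_of_isBounded hΩ hb hui hφc
  have hu0 : m₀ * ∫ z in Ω, ‖u z‖ ^ 2 ≤ A * I := by
    refine (mul_setIntegral_le hΩ.measurableSet subset_rfl hui huwi
      (fun z => by positivity) (fun z => by positivity) fun z hz => ?_).trans huA
    refine le_exp_neg_poleWeight hε (hD z hz) (by linarith) ?_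
    linarith [norm_sub_le z p, hD z hz, hD p hp.2]
  have hu1 : (Real.exp (-(n * D ^ 2)) / ((n + 1) * ε ^ 2) ^ (n + 2)) *
      ∫ z in Metric.closedBall p ε, ‖u z‖ ^ 2 ≤ A * I := by
    refine (mul_setIntegral_le Metric.isClosed_closedBall.measurableSet
      (hball.trans inter_subset_right) hui huwi
      (fun z => by positivity) (fun z => by positivity) fun z hz => ?_).trans huA
    exact le_exp_neg_poleWeight hε (hD z (hball hz).2) le_rfl (mem_closedBall_iff_norm.1 hz)
  have hχf : MemLp (fun z => χ z * f z) 2 (volume.restrict Ω) := by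
    simpa only [mul_comm] using hf.memLp_mul_test hU hΩ hχ
  obtain ⟨F, hFd, hFe⟩ := exists_differentiableOn_ae_eq hΩ hb (hχf.sub hu2) (fun j κ hκ => by
    have i1 := memLp_mul_test_integrableOn hb hχf (hκ.wderBar j)
    have i2 := memLp_mul_test_integrableOn hb hu2 (hκ.wderBar j)
    simp only [Pi.sub_apply, sub_mul]
    rw [integral_sub i1 i2, huw j κ hκ, setIntegral_mul_cutoff_wderBar hU hΩ hf.1 hχ hκ, sub_self])
  have hF2 : MemLp F 2 (volume.restrict Ω) := (memLp_congr_ae hFe).2 (hχf.sub hu2)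
  have hχfI : ∫ z in Ω, ‖χ z * f z‖ ^ 2 ≤ I := by
    have hr : ∫ z in Ω, U.indicator (fun z => ‖f z‖ ^ 2) z = I := by
      rw [setIntegral_indicator hU.measurableSet, inter_comm]
      rfl
    rw [← hr]
    refine integral_mono_of_nonneg (ae_of_all _ fun z => by positivity) ?_ (ae_of_all _ fun z => ?_)
    · rw [integrable_indicator_iff hU.measurableSet, IntegrableOn,
        Measure.restrict_restrict hU.measurableSet]
      exact hf.2
    · simp only
      by_cases hz : z ∈ U
      · rw [indicator_of_mem hz, norm_mul, mul_pow]
        exact mul_le_of_le_one_left (by positivity) (pow_le_one₀ (norm_nonneg _) (hχle z))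
      · rw [indicator_of_notMem hz, hχ.eq_zero hz]; simp
  refine ⟨F, ⟨hFd, hF2.integrable_norm_pow (by norm_num)⟩, ?_, ?_⟩
  · have h1 : l2sq n Ω F ≤ ∫ z in Ω, (2 * ‖χ z * f z‖ ^ 2 + 2 * ‖u z‖ ^ 2) := by
      refine integral_mono_ae (hF2.integrable_norm_pow (by norm_num))
        (((hχf.integrable_norm_pow (by norm_num)).const_mul 2).add (hui.const_mul 2)) ?_
      filter_upwards [hFe] with z hz
      rw [hz, Pi.sub_apply]
      have := norm_sub_le (χ z * f z) (u z)
      nlinarith [norm_nonneg (χ z * f z - u z), sq_nonneg (‖χ z * f z‖ - ‖u z‖)]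
    rw [integral_add ((hχf.integrable_norm_pow (by norm_num)).const_mul 2) (hui.const_mul 2),
      integral_const_mul, integral_const_mul] at h1
    have h2 : ∫ z in Ω, ‖u z‖ ^ 2 ≤ A / m₀ * I := by
      rw [div_mul_eq_mul_div, le_div_iff₀ hm₀0, mul_comm]; exact hu0
    nlinarith [mul_nonneg hB0 hI0]
  · have h1 : ∫ z in Metric.closedBall p ε, ‖F z - f z‖ ^ 2
        = ∫ z in Metric.closedBall p ε, ‖u z‖ ^ 2 := by
      refine integral_congr_ae ?_
      have hFe' := ae_restrict_of_ae_restrict_of_subset (hball.trans inter_subset_right) hFe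
      filter_upwards [hFe', ae_restrict_mem Metric.isClosed_closedBall.measurableSet] with z hz hzm
      rw [hz, Pi.sub_apply, hpχ z ((Metric.closedBall_subset_ball hεδ') hzm), one_mul,
        sub_sub_cancel_left, norm_neg]
    rw [h1]
    have h2 : ∫ z in Metric.closedBall p ε, ‖u z‖ ^ 2 ≤ B * (ε ^ 2) ^ (n + 2) * I := by
      rw [div_mul_eq_mul_div, div_le_iff₀ (by positivity), mul_comm, ← le_div_iff₀ (by positivity)]
        at hu1
      refine hu1.trans (le_of_eq ?_)
      rw [hB, mul_pow]
      field_simp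
    refine h2.trans ?_
    gcongr
    have : 0 ≤ A / m₀ := by positivity
    linarith

theorem norm_and_holDeriv_le_of_setIntegral_le {n : ℕ} {p X : Fin n → ℂ} {g : (Fin n → ℂ) → ℂ}
    {ε A : ℝ} (hε : 0 < ε) (hA : 0 ≤ A)
    (hg : ∀ y ∈ Metric.closedBall p ε, DifferentiableAt ℂ g y)
    (hI : ∫ z in Metric.closedBall p ε, ‖g z‖ ^ 2 ≤ A * (ε ^ 2) ^ (n + 2)) :
    ‖g p‖ ≤ √(A * 4 ^ n / volume.real (Metric.ball (0 : Fin n → ℂ) 1)) * ε ^ 2 ∧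
    ‖holDeriv n g p X‖ ≤
      2 * √(A * 4 ^ n / volume.real (Metric.ball (0 : Fin n → ℂ) 1)) * ‖X‖ * ε := by
  set v := volume.real (Metric.ball (0 : Fin n → ℂ) 1) with hv
  have hv0 : 0 < v := ENNReal.toReal_pos
    (Metric.measure_ball_pos volume _ one_pos).ne' measure_ball_lt_top.ne
  have hε2 : 0 < ε / 2 := by positivity
  have hgi : IntegrableOn (fun z => ‖g z‖ ^ 2) (Metric.closedBall p ε) :=
    ContinuousOn.integrableOn_compact (isCompact_closedBall p ε)
      fun y hy => ((hg y hy).continuousAt.norm.pow 2).continuousWithinAt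
  have key : ∀ q ∈ Metric.closedBall p (ε / 2), ‖g q‖ ≤ √(A * 4 ^ n / v) * ε ^ 2 := by
    intro q hq
    have hsub : Metric.closedBall q (ε / 2) ⊆ Metric.closedBall p ε :=
      Metric.closedBall_subset_closedBall' (by rw [Metric.mem_closedBall] at hq; linarith)
    have h := (norm_sq_mul_le_setIntegral fun y hy => hg y (hsub hy)).trans
      ((setIntegral_mono_set hgi (ae_of_all _ fun z => by positivity)
        (LE.le.eventuallyLE hsub)).trans hI)
    rw [volume_real_closedBall n hε2.le, ← hv] at h
    refine le_of_sq_le_sq ?_ (by positivity)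
    rw [mul_pow, Real.sq_sqrt (by positivity)]
    have e : A * (ε ^ 2) ^ (n + 2)
        = A * 4 ^ n / v * (ε ^ 2) ^ 2 * ((ε / 2) ^ (2 * n) * v) := by
      rw [pow_mul, div_pow, div_pow]
      norm_num
      field_simp
      ring
    rw [e] at h
    exact le_of_mul_le_mul_right h (by positivity)
  refine ⟨key p (Metric.mem_closedBall_self hε2.le), ?_⟩
  refine (norm_holDeriv_le hε2 (fun y hy => hg y
    (Metric.closedBall_subset_closedBall (by linarith) hy)) key).trans (le_of_eq ?_)
  field_simp

theorem InBergman.sub_const_mul {n : ℕ} {Ω : Set (Fin n → ℂ)} (hΩ : IsOpen Ω)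
    (hb : Bornology.IsBounded Ω) {F : (Fin n → ℂ) → ℂ} (hF : InBergman n Ω F) (a c : ℂ) :
    InBergman n Ω (fun z => c * (F z - a)) ∧
    l2sq n Ω (fun z => c * (F z - a))
      ≤ ‖c‖ ^ 2 * (2 * l2sq n Ω F + 2 * ‖a‖ ^ 2 * volume.real Ω) := by
  have : IsFiniteMeasure (volume.restrict Ω) :=
    ⟨by rw [Measure.restrict_apply_univ]; exact hb.measure_lt_top⟩
  have hm : MemLp (fun z => c * (F z - a)) 2 (volume.restrict Ω) :=
    ((hF.memLp hΩ).sub (memLp_const a)).const_mul c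
  have hi := hm.integrable_norm_pow (by norm_num)
  refine ⟨⟨(hF.1.sub_const a).const_mul c, hi⟩, ?_⟩
  have hi1 : IntegrableOn (fun z => 2 * ‖F z‖ ^ 2) Ω := Integrable.const_mul hF.2 2
  have hi2 : IntegrableOn (fun _ : Fin n → ℂ => 2 * ‖a‖ ^ 2) Ω := integrable_const _
  have e : ‖c‖ ^ 2 * (2 * l2sq n Ω F + 2 * ‖a‖ ^ 2 * volume.real Ω)
      = ∫ z in Ω, ‖c‖ ^ 2 * (2 * ‖F z‖ ^ 2 + 2 * ‖a‖ ^ 2) := by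
    rw [integral_const_mul, integral_add hi1 hi2, integral_const_mul, setIntegral_const,
      smul_eq_mul, l2sq]
    ring
  rw [e]
  refine integral_mono hi ((hi1.add hi2).const_mul _) fun z => ?_
  simp only [norm_mul, mul_pow]
  gcongr
  nlinarith [norm_nonneg (F z - a), norm_sub_le (F z) a, sq_nonneg (‖F z‖ - ‖a‖)]

theorem bddBelow_I1_set (n : ℕ) (Ω : Set (Fin n → ℂ)) (p X : Fin n → ℂ) :
    BddBelow {r | ∃ f, InBergman n Ω f ∧ f p = 0 ∧ holDeriv n f p X = 1 ∧ r = l2sq n Ω f} :=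
  ⟨0, by rintro r ⟨f, -, -, -, rfl⟩; exact integral_nonneg fun z => by positivity⟩

theorem I1_zero (n : ℕ) (Ω : Set (Fin n → ℂ)) (p : Fin n → ℂ) : I1 n Ω p 0 = 0 := by
  have : {r | ∃ f, InBergman n Ω f ∧ f p = 0 ∧ holDeriv n f p 0 = 1 ∧ r = l2sq n Ω f} = ∅ := by
    refine eq_empty_of_forall_notMem ?_
    rintro r ⟨f, -, -, h, -⟩
    simp [holDeriv] at h
  rw [I1, this, Real.sInf_empty]

theorem exists_inBergman_holDeriv_eq_one {n : ℕ} {Ω : Set (Fin n → ℂ)} (hΩ : IsOpen Ω)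
    (hb : Bornology.IsBounded Ω) (p : Fin n → ℂ) {X : Fin n → ℂ} (hX : X ≠ 0) :
    ∃ f, InBergman n Ω f ∧ f p = 0 ∧ holDeriv n f p X = 1 := by
  obtain ⟨i, hi⟩ := Function.ne_iff.1 hX
  have hi : X i ≠ 0 := hi
  have hm : MemLp (fun z : Fin n → ℂ => z i) 2 (volume.restrict Ω) := by
    have : IsFiniteMeasure (volume.restrict Ω) :=
      ⟨by rw [Measure.restrict_apply_univ]; exact hb.measure_lt_top⟩
    obtain ⟨D, hD⟩ := hb.exists_norm_le
    exact MemLp.of_bound (continuous_apply i).aestronglyMeasurable D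
      ((ae_restrict_iff' hΩ.measurableSet).2 (ae_of_all _ fun z hz =>
        (norm_le_pi_norm z i).trans (hD z hz)))
  have h0 : InBergman n Ω (fun z => z i) :=
    ⟨(differentiable_apply i).differentiableOn, hm.integrable_norm_pow (by norm_num)⟩
  refine ⟨fun z => (X i)⁻¹ * (z i - p i), (h0.sub_const_mul hΩ hb (p i) (X i)⁻¹).1, by simp, ?_⟩
  have hd : HasFDerivAt (fun z : Fin n → ℂ => (X i)⁻¹ * (z i - p i))
      ((X i)⁻¹ • (ContinuousLinearMap.proj i : (Fin n → ℂ) →L[ℂ] ℂ)) p :=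
    ((hasFDerivAt_apply i p).sub_const _).const_mul _
  rw [holDeriv_eq_fderiv, hd.fderiv]
  simp [hi]

theorem InBergman.mono {n : ℕ} {V Ω : Set (Fin n → ℂ)} (hV : V ⊆ Ω) {f : (Fin n → ℂ) → ℂ}
    (hf : InBergman n Ω f) : InBergman n V f ∧ l2sq n V f ≤ l2sq n Ω f :=
  ⟨⟨hf.1.mono hV, hf.2.mono_set hV⟩,
    setIntegral_mono_set hf.2 (ae_of_all _ fun z => by positivity) (LE.le.eventuallyLE hV)⟩

theorem I1_mono {n : ℕ} {V Ω : Set (Fin n → ℂ)} (hΩ : IsOpen Ω) (hb : Bornology.IsBounded Ω)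
    (hV : V ⊆ Ω) (p : Fin n → ℂ) {X : Fin n → ℂ} (hX : X ≠ 0) : I1 n V p X ≤ I1 n Ω p X := by
  obtain ⟨f, h1, h2, h3⟩ := exists_inBergman_holDeriv_eq_one hΩ hb p hX
  refine le_csInf ⟨_, f, h1, h2, h3, rfl⟩ ?_
  rintro r ⟨g, hg, hg0, hg1, rfl⟩
  exact (csInf_le (bddBelow_I1_set n V p X) ⟨g, (hg.mono hV).1, hg0, hg1, rfl⟩).trans
    (hg.mono hV).2

theorem I1_le_of_approx {n : ℕ} {Ω : Set (Fin n → ℂ)} (hΩ : IsOpen Ω)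
    (hb : Bornology.IsBounded Ω) {p X : Fin n → ℂ} (hp : p ∈ Ω) {F : (Fin n → ℂ) → ℂ}
    (hF : InBergman n Ω F) {J a d : ℝ} (hJ : l2sq n Ω F ≤ J) (ha : ‖F p‖ ≤ a)
    (hd : ‖holDeriv n F p X - 1‖ ≤ d) (hd1 : d < 1) :
    I1 n Ω p X ≤ ((1 - d) ^ 2)⁻¹ * (2 * J + 2 * a ^ 2 * volume.real Ω) := by
  set c := holDeriv n F p X with hc
  have hc1 : 1 - d ≤ ‖c‖ := by
    have := norm_sub_norm_le (1 : ℂ) c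
    rw [norm_one, norm_sub_rev] at this
    linarith
  have hc0 : c ≠ 0 := norm_pos_iff.1 (by linarith)
  obtain ⟨h1, h2⟩ := hF.sub_const_mul hΩ hb (F p) c⁻¹
  have hFd : DifferentiableAt ℂ F p := hF.1.differentiableAt (hΩ.mem_nhds hp)
  have h3 : holDeriv n (fun z => c⁻¹ * (F z - F p)) p X = 1 := by
    rw [holDeriv_eq_fderiv, ((hFd.hasFDerivAt.sub_const (F p)).const_mul c⁻¹).fderiv,
      _root_.smul_apply, ← holDeriv_eq_fderiv, smul_eq_mul, ← hc, inv_mul_cancel₀ hc0]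
  refine (csInf_le (bddBelow_I1_set n Ω p X) ⟨_, h1, by simp, h3, rfl⟩).trans (h2.trans ?_)
  rw [norm_inv, inv_pow]
  have : 0 < 1 - d := by linarith
  have h0 : 0 ≤ l2sq n Ω F := integral_nonneg fun z => by positivity
  gcongr

theorem I1_le_mul_l2sq {n : ℕ} {Ω V : Set (Fin n → ℂ)} (hΩ : IsOpen Ω)
    (hb : Bornology.IsBounded Ω) (hV : IsOpen V) (hVΩ : V ⊆ Ω) {p X : Fin n → ℂ} (hp : p ∈ V)
    {f : (Fin n → ℂ) → ℂ} (hf : InBergman n V f) (hf0 : f p = 0) (hf1 : holDeriv n f p X = 1)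
    {C δ : ℝ} (hC : 0 < C) (hδ : 0 < δ)
    (H : ∀ ε, 0 < ε → ε < δ → Metric.closedBall p ε ⊆ V → ∃ F, InBergman n Ω F ∧
      l2sq n Ω F ≤ C * l2sq n V f ∧
      ∫ z in Metric.closedBall p ε, ‖F z - f z‖ ^ 2 ≤ C * (ε ^ 2) ^ (n + 2) * l2sq n V f) :
    I1 n Ω p X ≤ 2 * C * l2sq n V f := by
  set I := l2sq n V f with hI
  have hI0 : 0 ≤ I := integral_nonneg fun z => by positivity
  set K := √(C * I * 4 ^ n / volume.real (Metric.ball (0 : Fin n → ℂ) 1)) with hK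
  have hlim : Tendsto (fun ε : ℝ => ((1 - 2 * K * ‖X‖ * ε) ^ 2)⁻¹ *
      (2 * (C * I) + 2 * (K * ε ^ 2) ^ 2 * volume.real Ω)) (𝓝[>] 0) (𝓝 (2 * C * I)) := by
    have : ContinuousAt (fun ε : ℝ => ((1 - 2 * K * ‖X‖ * ε) ^ 2)⁻¹ *
      (2 * (C * I) + 2 * (K * ε ^ 2) ^ 2 * volume.real Ω)) 0 := by
      refine ContinuousAt.mul (ContinuousAt.inv₀ (by fun_prop) (by simp)) (by fun_prop)
    have h := this.tendsto.mono_left (nhdsWithin_le_nhds (s := Ioi 0))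
    convert h using 2
    simp
    ring
  refine ge_of_tendsto hlim ?_
  obtain ⟨r, hr, hrV⟩ := Metric.nhds_basis_closedBall.mem_iff.1 (hV.mem_nhds hp)
  have hlt : ∀ᶠ ε : ℝ in 𝓝[>] 0, 2 * K * ‖X‖ * ε < 1 := by
    have : ContinuousAt (fun ε : ℝ => 2 * K * ‖X‖ * ε) 0 := by fun_prop
    exact (this.eventually_lt continuousAt_const (by simp)).filter_mono nhdsWithin_le_nhds
  filter_upwards [Ioo_mem_nhdsGT (lt_min hδ hr), hlt] with ε hε hε1
  have hεV : Metric.closedBall p ε ⊆ V :=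
    (Metric.closedBall_subset_closedBall (hε.2.le.trans (min_le_right _ _))).trans hrV
  obtain ⟨F, hF, hFI, hFf⟩ := H ε hε.1 (hε.2.trans_le (min_le_left _ _)) hεV
  have hFd : ∀ y ∈ V, DifferentiableAt ℂ F y := fun y hy =>
    hF.1.differentiableAt (hΩ.mem_nhds (hVΩ hy))
  have hfd : ∀ y ∈ V, DifferentiableAt ℂ f y := fun y hy => hf.1.differentiableAt (hV.mem_nhds hy)
  obtain ⟨h1, h2⟩ := norm_and_holDeriv_le_of_setIntegral_le (X := X) (g := fun z => F z - f z)
    hε.1 (mul_nonneg hC.le hI0) (fun y hy => (hFd y (hεV hy)).sub (hfd y (hεV hy)))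
    (hFf.trans (le_of_eq (by ring)))
  rw [hf0, sub_zero] at h1
  have h3 : holDeriv n (fun z => F z - f z) p X = holDeriv n F p X - 1 := by
    rw [← hf1, holDeriv_eq_fderiv, holDeriv_eq_fderiv, holDeriv_eq_fderiv,
      ((hFd p hp).hasFDerivAt.fun_sub (hfd p hp).hasFDerivAt).fderiv, _root_.sub_apply]
  rw [h3] at h2
  exact I1_le_of_approx hΩ hb (hVΩ hp) hF hFI h1 h2 hε1

end

/-- Localization of the minimum integral `I¹`: for a bounded pseudoconvex domain
`Ω ⊂ ℂⁿ`, `z₀ ∈ ∂Ω`, and open neighborhoods `W ⊂⊂ U` of `z₀`, there is `C₁ > 0` with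
`I¹_{U∩Ω}(p;X) ≤ I¹_Ω(p;X) ≤ C₁ · I¹_{U∩Ω}(p;X)` for all `p ∈ W ∩ Ω` and `X ∈ ℂⁿ`. -/
theorem I1_localization
    {n : ℕ} (Ω : Set (Fin n → ℂ)) (hΩ : IsOpen Ω) (hb : Bornology.IsBounded Ω)
    (hconn : IsPreconnected Ω) (hpsc : PseudoconvexExh n Ω)
    (z₀ : Fin n → ℂ) (hz₀ : z₀ ∈ frontier Ω)
    (W U : Set (Fin n → ℂ)) (hWo : IsOpen W) (hUo : IsOpen U)
    (hz₀W : z₀ ∈ W) (hWU : closure W ⊆ U) (hWc : IsCompact (closure W)) :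
    ∃ C₁ > (0:ℝ), ∀ p ∈ W ∩ Ω, ∀ X : Fin n → ℂ,
      I1 n (U ∩ Ω) p X ≤ I1 n Ω p X ∧ I1 n Ω p X ≤ C₁ * I1 n (U ∩ Ω) p X := by
  obtain ⟨C, hC, δ, hδ, H⟩ := exists_holomorphic_approx hΩ hb hpsc hUo hWU hWc
  refine ⟨2 * C, by positivity, fun p hp X => ?_⟩
  have hV := hUo.inter hΩ
  by_cases hX : X = 0
  · subst hX
    simp [I1_zero]
  refine ⟨I1_mono hΩ hb inter_subset_right p hX, ?_⟩
  rw [← div_le_iff₀' (by positivity)]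
  obtain ⟨f₀, h1, h2, h3⟩ :=
    exists_inBergman_holDeriv_eq_one hV (hb.subset inter_subset_right) p hX
  refine le_csInf ⟨_, f₀, h1, h2, h3, rfl⟩ ?_
  rintro r ⟨f, hf, hf0, hf1, rfl⟩
  rw [div_le_iff₀' (by positivity)]
  exact I1_le_mul_l2sq hΩ hb hV inter_subset_right ⟨hWU (subset_closure hp.1), hp.2⟩ hf hf0 hf1
    hC hδ (H p hp f hf)
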